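/- For any fixed α > 0 there exists a constant C > 0 depending only on α such that for every integer d ≥ C the following holds: for every probability space (Ω, ℙ) carrying a white-noise Gaussian process (h_n(x)) as in the context, ℙ-almost surely the thick point set 𝒯^W_α contains an unbounded path. -/

import Mathlib

open MeasureTheory ProbabilityTheory

/-- The covariance kernel of the white-noise approximation of the log-correlated field:
`K((n,x),(m,y)) = ∫_{2^{−min(n,m)}}^{1} [vol(B_t(x) ∩ B_t(y)) / vol(B_t(0))] t⁻¹ dt`. -/
noncomputable def wnKernel (d : ℕ) (n m : ℕ) (x y : EuclideanSpace ℝ (Fin d)) : ℝ :=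
  ∫ t in Set.Ioc ((2 : ℝ) ^ (-(min n m : ℤ))) 1,
    (volume (Metric.ball x t ∩ Metric.ball y t)).toReal /
      (volume (Metric.ball (0 : EuclideanSpace ℝ (Fin d)) t)).toReal * t⁻¹

/-- `(h_n(x))_{n ≥ 1}` is a centered Gaussian process with covariance kernel `wnKernel`,
each `h_n(·)(ω)` being continuous: every finite linear combination
`Σ_i c_i h_{n_i}(x_i)` (with all `n_i ≥ 1`) is a centered Gaussian with variance
`Σ_{i,j} c_i c_j K((n_i,x_i),(n_j,x_j))`. -/
def IsWhiteNoiseField (d : ℕ) {Ω : Type} [MeasurableSpace Ω] (P : Measure Ω)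
    (h : ℕ → EuclideanSpace ℝ (Fin d) → Ω → ℝ) : Prop :=
  (∀ n x, Measurable (h n x)) ∧
  (∀ (N : ℕ) (idx : Fin N → ℕ × EuclideanSpace ℝ (Fin d)) (c : Fin N → ℝ),
    (∀ i, 1 ≤ (idx i).1) →
    P.map (fun ω => ∑ i, c i * h (idx i).1 (idx i).2 ω) =
      gaussianReal 0 (Real.toNNReal (∑ i, ∑ j,
        c i * c j * wnKernel d (idx i).1 (idx j).1 (idx i).2 (idx j).2))) ∧
  (∀ ω n, Continuous (fun x => h n x ω))

lemma integrable_of_mem_unitInterval {X : Type*} [MeasurableSpace X] (ν : Measure X)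
    [IsProbabilityMeasure ν] {F : X → ℝ} (hF : Measurable F)
    (h : ∀ x, F x ∈ Set.Icc (0 : ℝ) 1) : Integrable F ν := by
  refine Integrable.of_bound hF.aestronglyMeasurable 1 (Filter.Eventually.of_forall fun x => ?_)
  rw [Real.norm_eq_abs, abs_of_nonneg (h x).1]
  exact (h x).2

/-- Chebyshev's association inequality for two bounded monotone functions on the line. -/
lemma integral_mul_integral_le_of_monotone (μ : Measure ℝ) [IsProbabilityMeasure μ]
    {f g : ℝ → ℝ} (hf : Monotone f) (hg : Monotone g)
    (hf' : ∀ x, f x ∈ Set.Icc (0 : ℝ) 1) (hg' : ∀ x, g x ∈ Set.Icc (0 : ℝ) 1) :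
    (∫ x, f x ∂μ) * ∫ x, g x ∂μ ≤ ∫ x, f x * g x ∂μ := by
  have hfm := hf.measurable
  have hgm := hg.measurable
  have h01 : ∀ {a b : ℝ}, a ∈ Set.Icc (0 : ℝ) 1 → b ∈ Set.Icc (0 : ℝ) 1 →
      a * b ∈ Set.Icc (0 : ℝ) 1 := fun ha hb =>
    ⟨mul_nonneg ha.1 hb.1, mul_le_one₀ ha.2 hb.1 hb.2⟩
  have key : 0 ≤ ∫ p : ℝ × ℝ, (f p.1 - f p.2) * (g p.1 - g p.2) ∂(μ.prod μ) := by
    refine integral_nonneg fun p => ?_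
    rcases le_total p.1 p.2 with h | h
    · exact mul_nonneg_of_nonpos_of_nonpos (sub_nonpos.2 (hf h)) (sub_nonpos.2 (hg h))
    · exact mul_nonneg (sub_nonneg.2 (hf h)) (sub_nonneg.2 (hg h))
  have i1 : Integrable (fun p : ℝ × ℝ => f p.1 * g p.1) (μ.prod μ) :=
    integrable_of_mem_unitInterval _ (by fun_prop) fun p => h01 (hf' _) (hg' _)
  have i2 : Integrable (fun p : ℝ × ℝ => f p.2 * g p.2) (μ.prod μ) :=
    integrable_of_mem_unitInterval _ (by fun_prop) fun p => h01 (hf' _) (hg' _)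
  have i3 : Integrable (fun p : ℝ × ℝ => f p.1 * g p.2) (μ.prod μ) :=
    integrable_of_mem_unitInterval _ (by fun_prop) fun p => h01 (hf' _) (hg' _)
  have i4 : Integrable (fun p : ℝ × ℝ => g p.1 * f p.2) (μ.prod μ) :=
    integrable_of_mem_unitInterval _ (by fun_prop) fun p => h01 (hg' _) (hf' _)
  have e1 : ∫ p : ℝ × ℝ, f p.1 * g p.1 ∂(μ.prod μ) = ∫ x, f x * g x ∂μ := by
    have := integral_prod_mul (μ := μ) (ν := μ) (fun x => f x * g x) (fun _ => (1 : ℝ))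
    simpa using this
  have e2 : ∫ p : ℝ × ℝ, f p.2 * g p.2 ∂(μ.prod μ) = ∫ x, f x * g x ∂μ := by
    have := integral_prod_mul (μ := μ) (ν := μ) (fun _ => (1 : ℝ)) (fun x => f x * g x)
    simpa using this
  have e3 := integral_prod_mul (μ := μ) (ν := μ) f g
  have e4 := integral_prod_mul (μ := μ) (ν := μ) g f
  have : ∫ p : ℝ × ℝ, (f p.1 - f p.2) * (g p.1 - g p.2) ∂(μ.prod μ) =
      (∫ x, f x * g x ∂μ) + (∫ x, f x * g x ∂μ) - (∫ x, f x ∂μ) * (∫ x, g x ∂μ)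
        - (∫ x, g x ∂μ) * ∫ x, f x ∂μ := by
    rw [← e3, ← e4]
    nth_rw 1 [← e1]
    have j1 := integral_add i1 i2
    have j2 := integral_sub (i1.add i2) i3
    have j3 := integral_sub ((i1.add i2).sub i3) i4
    simp only [Pi.add_apply, Pi.sub_apply] at j1 j2 j3
    rw [← e2, ← j1, ← j2, ← j3]
    refine integral_congr_ae (Filter.Eventually.of_forall fun p => ?_)
    ring
  linarith [mul_comm (∫ x, f x ∂μ) (∫ x, g x ∂μ)]

/-- Harris' inequality for finite products of probability measures on the line. -/
lemma harris_pi (μ : Measure ℝ) [IsProbabilityMeasure μ] (n : ℕ) :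
    ∀ {f g : (Fin n → ℝ) → ℝ}, Monotone f → Monotone g → Measurable f → Measurable g →
    (∀ x, f x ∈ Set.Icc (0 : ℝ) 1) → (∀ x, g x ∈ Set.Icc (0 : ℝ) 1) →
    (∫ x, f x ∂(Measure.pi fun _ => μ)) * ∫ x, g x ∂(Measure.pi fun _ => μ) ≤
      ∫ x, f x * g x ∂(Measure.pi fun _ => μ) := by
  induction n with
  | zero =>
    intro f g _ _ _ _ _ _
    have : ∀ F : (Fin 0 → ℝ) → ℝ, ∫ x, F x ∂(Measure.pi fun _ => μ) = F default := by
      intro F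
      have : F = fun _ => F default := funext fun x => by rw [Subsingleton.elim x default]
      rw [this]; simp
    rw [this, this, this]
  | succ n ih =>
    intro f g hf hg hfm hgm hf' hg'
    have mp := (measurePreserving_piFinSuccAbove (fun _ : Fin (n + 1) => μ) 0).symm
    have tr : ∀ F : (Fin (n + 1) → ℝ) → ℝ, ∫ x, F x ∂(Measure.pi fun _ => μ) =
        ∫ p : ℝ × (Fin n → ℝ), F (Fin.cons p.1 p.2)
          ∂(μ.prod (Measure.pi fun _ => μ)) := by
      intro F
      rw [← mp.integral_comp' F]
      refine integral_congr_ae (Filter.Eventually.of_forall fun p => ?_)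
      show F _ = F _
      congr 1
      rw [MeasurableEquiv.symm_apply_eq]
      ext i <;> simp [MeasurableEquiv.piFinSuccAbove]
    have hc : Measurable fun p : ℝ × (Fin n → ℝ) => (Fin.cons p.1 p.2 : Fin (n + 1) → ℝ) := by
      rw [measurable_pi_iff]
      intro i
      refine Fin.cases ?_ (fun j => ?_) i
      · simpa using measurable_fst
      · simp only [Fin.cons_succ]; fun_prop
    have h01 : ∀ {a b : ℝ}, a ∈ Set.Icc (0 : ℝ) 1 → b ∈ Set.Icc (0 : ℝ) 1 →
        a * b ∈ Set.Icc (0 : ℝ) 1 := fun ha hb =>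
      ⟨mul_nonneg ha.1 hb.1, mul_le_one₀ ha.2 hb.1 hb.2⟩
    have fub : ∀ {F : (Fin (n + 1) → ℝ) → ℝ}, Measurable F → (∀ x, F x ∈ Set.Icc (0 : ℝ) 1) →
        ∫ x, F x ∂(Measure.pi fun _ => μ) =
          ∫ t, ∫ y, F (Fin.cons t y) ∂(Measure.pi fun _ => μ) ∂μ := by
      intro F hF h
      rw [tr, integral_prod]
      exact integrable_of_mem_unitInterval _ (hF.comp hc) fun p => h _
    have sec : ∀ {F : (Fin (n + 1) → ℝ) → ℝ} (t : ℝ), Measurable F →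
        Measurable fun y : Fin n → ℝ => F (Fin.cons t y) := fun t hF =>
      hF.comp (hc.comp (measurable_const.prodMk measurable_id))
    have mono1 : ∀ {F : (Fin (n + 1) → ℝ) → ℝ}, Monotone F → Measurable F →
        (∀ x, F x ∈ Set.Icc (0 : ℝ) 1) →
        Monotone fun t => ∫ y : Fin n → ℝ, F (Fin.cons t y) ∂(Measure.pi fun _ => μ) := by
      intro F hF hFm h s t hst
      refine integral_mono (integrable_of_mem_unitInterval _ (sec s hFm) fun y => h _) (integrable_of_mem_unitInterval _ (sec t hFm) fun y => h _)
        fun y => hF ?_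
      exact Fin.cons_le_cons.2 ⟨hst, le_rfl⟩
    have range1 : ∀ {F : (Fin (n + 1) → ℝ) → ℝ}, Measurable F →
        (∀ x, F x ∈ Set.Icc (0 : ℝ) 1) → ∀ t,
        (∫ y : Fin n → ℝ, F (Fin.cons t y) ∂(Measure.pi fun _ => μ)) ∈ Set.Icc (0 : ℝ) 1 := by
      intro F hFm h t
      refine ⟨integral_nonneg fun y => (h _).1, ?_⟩
      calc _ ≤ ∫ y : Fin n → ℝ, (1 : ℝ) ∂(Measure.pi fun _ => μ) :=
            integral_mono (integrable_of_mem_unitInterval _ (sec t hFm) fun y => h _) (integrable_const _) fun y => (h _).2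
        _ = 1 := by simp
    rw [fub hfm hf', fub hgm hg', fub (F := fun x => f x * g x) (hfm.mul hgm) fun x => h01 (hf' x) (hg' x)]
    refine (integral_mul_integral_le_of_monotone μ (mono1 hf hfm hf') (mono1 hg hgm hg')
      (range1 hfm hf') (range1 hgm hg')).trans ?_
    refine integral_mono (integrable_of_mem_unitInterval _ (((mono1 hf hfm hf').measurable).mul
      ((mono1 hg hgm hg').measurable)) fun t => h01 (range1 hfm hf' t) (range1 hgm hg' t)) ?_ ?_
    · have hm : Measurable fun p : ℝ × (Fin n → ℝ) =>
          f (Fin.cons p.1 p.2) * g (Fin.cons p.1 p.2) := (hfm.comp hc).mul (hgm.comp hc)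
      exact (integrable_of_mem_unitInterval (μ.prod (Measure.pi fun _ => μ)) hm
        fun p => h01 (hf' _) (hg' _)).integral_prod_left
    · intro t
      have hle : ∀ {y z : Fin n → ℝ}, y ≤ z →
          (Fin.cons t y : Fin (n + 1) → ℝ) ≤ Fin.cons t z := fun h => Fin.cons_le_cons.2 ⟨le_rfl, h⟩
      exact ih (fun y z h => hf (hle h)) (fun y z h => hg (hle h)) (sec t hfm) (sec t hgm)
        (fun y => hf' _) fun y => hg' _

lemma harris_pi_measure (μ : Measure ℝ) [IsProbabilityMeasure μ] (n : ℕ)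
    {A B : Set (Fin n → ℝ)} (hA : IsUpperSet A) (hB : IsUpperSet B) (hAm : MeasurableSet A)
    (hBm : MeasurableSet B) :
    (Measure.pi fun _ => μ).real A * (Measure.pi fun _ => μ).real B ≤
      (Measure.pi fun _ => μ).real (A ∩ B) := by
  have mono : ∀ {S : Set (Fin n → ℝ)}, IsUpperSet S → Monotone (S.indicator (1 : (Fin n → ℝ) → ℝ)) := by
    intro S hS x y hxy
    by_cases hx : x ∈ S
    · simp [hx, hS hxy hx]
    · simp only [hx, not_false_eq_true, Set.indicator_of_notMem]
      exact Set.indicator_nonneg (fun _ _ => zero_le_one) _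
  have range : ∀ (S : Set (Fin n → ℝ)) x, S.indicator (1 : (Fin n → ℝ) → ℝ) x ∈ Set.Icc (0 : ℝ) 1 := by
    intro S x
    by_cases hx : x ∈ S <;> simp [hx]
  have := harris_pi μ n (mono hA) (mono hB) (measurable_one.indicator hAm)
    (measurable_one.indicator hBm) (range A) (range B)
  rw [integral_indicator_one hAm, integral_indicator_one hBm] at this
  refine this.trans (le_of_eq ?_)
  rw [← integral_indicator_one (hAm.inter hBm)]
  congr 1
  ext x
  rw [Set.inter_indicator_one]
  rfl

lemma dual_pi_apply {ι : Type*} [Fintype ι] [DecidableEq ι] (L : StrongDual ℝ (ι → ℝ))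
    (x : ι → ℝ) : L x = ∑ j, L (Pi.single j 1) * x j := by
  have : x = ∑ j, x j • (Pi.single j 1 : ι → ℝ) := by
    ext k; simp [Finset.sum_apply, Pi.single_apply]
  conv_lhs => rw [this, map_sum]
  exact Finset.sum_congr rfl fun j _ => by rw [map_smul, smul_eq_mul, mul_comm]

/-- `X` is (a version of) the white noise with control measure `μ` evaluated on the sets `R i`. -/
structure IsNoise {Ω Z I : Type} [MeasurableSpace Ω] [MeasurableSpace Z] (μ : Measure Z)
    (P : Measure Ω) (X : I → Ω → ℝ) (R : I → Set Z) : Prop where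
  meas : ∀ i, Measurable (X i)
  measR : ∀ i, MeasurableSet (R i)
  fin : ∀ i, μ (R i) ≠ ⊤
  law : ∀ (ι : Type) [Fintype ι] (idx : ι → I) (c : ι → ℝ),
    P.map (fun ω => ∑ j, c j * X (idx j) ω) =
      gaussianReal 0 (∫ z, (∑ j, c j * (R (idx j)).indicator 1 z) ^ 2 ∂μ).toNNReal

namespace IsNoise

variable {Ω Z I : Type} [MeasurableSpace Ω] [MeasurableSpace Z] {μ : Measure Z}
  {P : Measure Ω} {X : I → Ω → ℝ} {R : I → Set Z}

lemma charFunDual_map (h : IsNoise μ P X R) {ι : Type} [Fintype ι] [DecidableEq ι] (idx : ι → I)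
    (L : StrongDual ℝ (ι → ℝ)) :
    charFunDual (P.map fun ω j => X (idx j) ω) L = Complex.exp
      (-((∫ z, (∑ j, L (Pi.single j 1) * (R (idx j)).indicator 1 z) ^ 2 ∂μ : ℝ) : ℂ) / 2) := by
  have hm : Measurable fun ω j => X (idx j) ω := measurable_pi_iff.2 fun j => h.meas _
  have hL : (⇑L ∘ fun ω j => X (idx j) ω) =
      fun ω => ∑ j, L (Pi.single j 1) * X (idx j) ω := by
    ext ω
    rw [Function.comp_apply, dual_pi_apply]
  rw [charFunDual_eq_charFun_map_one, Measure.map_map L.continuous.measurable hm, hL, h.law,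
    charFun_gaussianReal]
  have : 0 ≤ ∫ z, (∑ j, L (Pi.single j 1) * (R (idx j)).indicator 1 z) ^ 2 ∂μ :=
    integral_nonneg fun z => sq_nonneg _
  simp only [Real.coe_toNNReal _ this]
  congr 1
  push_cast
  ring

lemma indepFun (h : IsNoise μ P X R) [IsFiniteMeasure P] {ι κ : Type} [Fintype ι] [Fintype κ]
    (f : ι → I) (g : κ → I) (hd : ∀ i j, μ (R (f i) ∩ R (g j)) = 0) :
    IndepFun (fun ω i => X (f i) ω) (fun ω j => X (g j) ω) P := by
  classical
  have hmf : Measurable fun ω i => X (f i) ω := measurable_pi_iff.2 fun j => h.meas _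
  have hmg : Measurable fun ω j => X (g j) ω := measurable_pi_iff.2 fun j => h.meas _
  rw [indepFun_iff_charFunDual_prod hmf.aemeasurable hmg.aemeasurable]
  intro L
  rw [h.charFunDual_map, h.charFunDual_map, charFunDual_eq_charFun_map_one,
    Measure.map_map L.continuous.measurable (hmf.prodMk hmg)]
  set a : ι → ℝ := fun i => (L.comp (.inl ℝ (ι → ℝ) (κ → ℝ))) (Pi.single i 1) with ha
  set b : κ → ℝ := fun j => (L.comp (.inr ℝ (ι → ℝ) (κ → ℝ))) (Pi.single j 1) with hb
  have hL : (⇑L ∘ fun ω => (fun i => X (f i) ω, fun j => X (g j) ω)) =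
      fun ω => ∑ k : ι ⊕ κ, Sum.elim a b k * X (Sum.elim f g k) ω := by
    ext ω
    have e3 : ((fun i => X (f i) ω, fun j => X (g j) ω) : (ι → ℝ) × (κ → ℝ)) =
        ContinuousLinearMap.inl ℝ (ι → ℝ) (κ → ℝ) (fun i => X (f i) ω) +
        ContinuousLinearMap.inr ℝ (ι → ℝ) (κ → ℝ) (fun j => X (g j) ω) := by
      simp
    rw [Function.comp_apply, e3, map_add, ← ContinuousLinearMap.comp_apply,
      ← ContinuousLinearMap.comp_apply, dual_pi_apply, dual_pi_apply (L.comp _),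
      Fintype.sum_sum_type]
    simp only [Sum.elim_inl, Sum.elim_inr, ha, hb]
  rw [hL, h.law, charFun_gaussianReal]
  have i1 : ∀ {ι : Type} [Fintype ι] (u v : ι → I) (a b : ι → ℝ) i j, Integrable (fun z =>
      a i * (R (u i)).indicator (1 : Z → ℝ) z * (b j * (R (v j)).indicator (1 : Z → ℝ) z)) μ := by
    intro ι _ u v a b i j
    have : (fun z => a i * (R (u i)).indicator (1 : Z → ℝ) z * (b j * (R (v j)).indicator 1 z)) =
      fun z => (a i * b j) * (R (u i) ∩ R (v j)).indicator 1 z := by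
      ext z; rw [Set.inter_indicator_one]; simp only [Pi.mul_apply]; ring
    rw [this]
    refine Integrable.const_mul ?_ _
    rw [integrable_indicator_iff ((h.measR _).inter (h.measR _))]
    exact integrableOn_const (C := (1 : ℝ))
      (ne_top_of_le_ne_top (h.fin (u i)) (measure_mono Set.inter_subset_left))
  have i2 : ∀ {ι : Type} [Fintype ι] (u : ι → I) (a : ι → ℝ), Integrable (fun z =>
      (∑ i, a i * (R (u i)).indicator (1 : Z → ℝ) z) ^ 2) μ := by
    intro ι _ u a
    simp only [sq, Finset.sum_mul_sum]
    exact integrable_finsetSum _ fun i _ => integrable_finsetSum _ fun j _ => i1 u u a a i j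
  have hs : ∫ z, (∑ k : ι ⊕ κ, Sum.elim a b k * (R (Sum.elim f g k)).indicator 1 z) ^ 2 ∂μ =
      (∫ z, (∑ i, a i * (R (f i)).indicator 1 z) ^ 2 ∂μ) +
      ∫ z, (∑ j, b j * (R (g j)).indicator 1 z) ^ 2 ∂μ := by
    rw [← integral_add (i2 _ _) (i2 _ _)]
    refine integral_congr_ae ?_
    have : ∀ᵐ z ∂μ, ∀ i j, z ∉ R (f i) ∩ R (g j) := by
      rw [ae_all_iff]; intro i
      rw [ae_all_iff]; intro j
      exact measure_eq_zero_iff_ae_notMem.1 (hd i j)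
    filter_upwards [this] with z hz
    have hz' : (∑ i, a i * (R (f i)).indicator (1 : Z → ℝ) z) *
        ∑ j, b j * (R (g j)).indicator (1 : Z → ℝ) z = 0 := by
      rw [Finset.sum_mul_sum]
      refine Finset.sum_eq_zero fun i _ => Finset.sum_eq_zero fun j _ => ?_
      by_cases h1 : z ∈ R (f i)
      · have h2 : z ∉ R (g j) := fun h2 => hz i j ⟨h1, h2⟩
        simp [h2]
      · simp [h1]
    simp only [Fintype.sum_sum_type, Sum.elim_inl, Sum.elim_inr]
    linear_combination 2 * hz'
  have n1 : 0 ≤ ∫ z, (∑ i, a i * (R (f i)).indicator 1 z) ^ 2 ∂μ :=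
    integral_nonneg fun z => sq_nonneg _
  have n2 : 0 ≤ ∫ z, (∑ j, b j * (R (g j)).indicator 1 z) ^ 2 ∂μ :=
    integral_nonneg fun z => sq_nonneg _
  rw [hs, ← Complex.exp_add, Real.coe_toNNReal _ (add_nonneg n1 n2)]
  congr 1
  simp only [Complex.ofReal_add, Complex.ofReal_one, Complex.ofReal_zero]
  ring

/-- The event that every `X i`, `i ∈ s`, exceeds the level `a i`. -/
def above (X : I → Ω → ℝ) (a : I → ℝ) (s : Set I) : Set Ω := {ω | ∀ i ∈ s, a i ≤ X i ω}

lemma measurableSet_above (h : IsNoise μ P X R) (a : I → ℝ) {s : Set I} (hs : s.Finite) :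
    MeasurableSet (above X a s) := by
  have : above X a s = ⋂ i ∈ s, {ω | a i ≤ X i ω} := by ext; simp [above]
  rw [this]
  exact MeasurableSet.biInter hs.countable fun i _ => measurableSet_le measurable_const (h.meas i)

lemma above_union (a : I → ℝ) (s t : Set I) : above X a (s ∪ t) = above X a s ∩ above X a t := by
  ext ω
  simp only [above, Set.mem_union, Set.mem_ofPred_eq, Set.mem_inter_iff]
  exact ⟨fun h => ⟨fun i hi => h i (.inl hi), fun i hi => h i (.inr hi)⟩,
    fun h i hi => hi.elim (h.1 i) (h.2 i)⟩

lemma above_anti (a : I → ℝ) {s t : Set I} (hst : s ⊆ t) : above X a t ⊆ above X a s :=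
  fun _ h i hi => h i (hst hi)

lemma prob_above_union_of_disjoint (h : IsNoise μ P X R) [IsFiniteMeasure P] (a : I → ℝ)
    {s t : Set I} (hs : s.Finite) (ht : t.Finite)
    (hd : ∀ i ∈ s, ∀ j ∈ t, μ (R i ∩ R j) = 0) :
    P.real (above X a (s ∪ t)) = P.real (above X a s) * P.real (above X a t) := by
  have := hs.fintype
  have := ht.fintype
  have hi := h.indepFun (fun i : s => i.1) (fun j : t => j.1) fun i j => hd _ i.2 _ j.2
  have key : ∀ (u : Set I) [Fintype u], ∃ A : Set (u → ℝ), MeasurableSet A ∧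
      above X a u = (fun ω (i : u) => X i.1 ω) ⁻¹' A := by
    intro u _
    refine ⟨{v | ∀ i, a i.1 ≤ v i}, ?_, by ext; simp [above]⟩
    rw [Set.ofPred_forall]
    exact MeasurableSet.iInter fun i => measurableSet_le measurable_const (measurable_pi_apply i)
  obtain ⟨A, hA, eA⟩ := key s
  obtain ⟨B, hB, eB⟩ := key t
  rw [above_union, eA, eB, measureReal_def, hi.measure_inter_preimage_eq_mul _ _ hA hB,
    ENNReal.toReal_mul]
  rfl

/-- Positive association of the increasing events `above X a s`. -/
lemma prob_above_mul_le (h : IsNoise μ P X R) [IsProbabilityMeasure P] (a : I → ℝ)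
    {s t : Set I} (hs : s.Finite) (ht : t.Finite) :
    P.real (above X a s) * P.real (above X a t) ≤ P.real (above X a (s ∪ t)) := by
  classical
  have := (hs.union ht).fintype
  set ι : Type := ↥(s ∪ t)
  set f : ι → I := fun i => i.1
  set A : Finset ι → Set Z := fun σ => {z | ∀ i, z ∈ R (f i) ↔ i ∈ σ} with hAdef
  have hAm : ∀ σ, MeasurableSet (A σ) := by
    intro σ
    simp only [hAdef, Set.ofPred_forall]
    refine MeasurableSet.iInter fun i => ?_
    by_cases hi : i ∈ σ
    · simp only [hi, iff_true]; exact h.measR (f i)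
    · simp only [hi, iff_false]; exact (h.measR (f i)).compl
  have hAfin : ∀ σ : Finset ι, ∀ i ∈ σ, μ (A σ) ≠ ⊤ := fun σ i hi =>
    ne_top_of_le_ne_top (h.fin (f i)) (measure_mono fun z hz => (hz i).2 hi)
  set n := Fintype.card (Finset ι)
  set e : Fin n ≃ Finset ι := (Fintype.equivFin _).symm
  set T : (Fin n → ℝ) →L[ℝ] (ι → ℝ) := ContinuousLinearMap.pi fun i =>
    ∑ k, (if i ∈ e k then √(μ.real (A (e k))) else 0) • ContinuousLinearMap.proj k with hT
  have hTa : ∀ x i, T x i = ∑ k, (if i ∈ e k then √(μ.real (A (e k))) else 0) * x k := by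
    intro x i
    simp only [hT, ContinuousLinearMap.pi_apply, sum_apply, smul_apply,
      ContinuousLinearMap.proj_apply, smul_eq_mul]
  have hTmono : Monotone T := by
    intro x y hxy i
    rw [hTa, hTa]
    refine Finset.sum_le_sum fun k _ => mul_le_mul_of_nonneg_left (hxy k) ?_
    split_ifs <;> positivity
  have hm : Measurable fun ω (i : ι) => X (f i) ω := measurable_pi_iff.2 fun j => h.meas _
  have hlaw : (P.map fun ω (i : ι) => X (f i) ω) =
      (Measure.pi fun _ : Fin n => gaussianReal 0 1).map T := by
    have := Measure.isProbabilityMeasure_map (μ := P) hm.aemeasurable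
    have := Measure.isProbabilityMeasure_map (μ := Measure.pi fun _ : Fin n => gaussianReal 0 1)
      T.continuous.measurable.aemeasurable
    refine Measure.ext_of_charFunDual (funext fun L => ?_)
    rw [h.charFunDual_map, charFunDual_eq_charFun_map_one,
      Measure.map_map L.continuous.measurable T.continuous.measurable,
      ← ContinuousLinearMap.coe_comp, ← charFunDual_eq_charFun_map_one, charFunDual_pi]
    set c : ι → ℝ := fun i => L (Pi.single i 1) with hc
    have hLx : ∀ x : ι → ℝ, L x = ∑ i, c i * x i := dual_pi_apply L
    have h_int : ∫ z, (∑ i, c i * (R (f i)).indicator 1 z) ^ 2 ∂μ =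
        ∑ k, (∑ i ∈ e k, c i) ^ 2 * μ.real (A (e k)) := by
      have : ∀ z, (∑ i, c i * (R (f i)).indicator (1 : Z → ℝ) z) ^ 2 =
          ∑ k, (∑ i ∈ e k, c i) ^ 2 * (A (e k)).indicator (1 : Z → ℝ) z := by
        intro z
        set σ : Finset ι := Finset.univ.filter fun i => z ∈ R (f i) with hσ
        have hz : ∀ k, z ∈ A (e k) ↔ k = e.symm σ := by
          intro k
          rw [Equiv.eq_symm_apply]
          constructor
          · intro hk; ext i; simp [hσ, hk i]
          · intro hk i; rw [hk]; simp [hσ]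
        rw [Finset.sum_eq_single (e.symm σ)]
        · have : z ∈ A (e (e.symm σ)) := (hz _).2 rfl
          rw [Set.indicator_of_mem this, Equiv.apply_symm_apply, hσ, Finset.sum_filter]
          simp only [Pi.one_apply, mul_one]
          congr 1
          refine Finset.sum_congr rfl fun i _ => ?_
          by_cases hi : z ∈ R (f i) <;> simp [hi]
        · intro k _ hk
          rw [Set.indicator_of_notMem (fun hh => hk ((hz k).1 hh)), mul_zero]
        · simp
      simp only [this]
      rw [integral_finsetSum]
      · refine Finset.sum_congr rfl fun k _ => ?_
        rw [integral_const_mul, integral_indicator_one (hAm _)]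
      · intro k _
        rcases (e k).eq_empty_or_nonempty with h0 | ⟨i, hi⟩
        · simp [h0]
        · refine Integrable.const_mul ?_ _
          rw [integrable_indicator_iff (hAm _)]
          exact integrableOn_const (C := (1 : ℝ)) (hAfin _ i hi)
    have hk : ∀ k, charFunDual (gaussianReal 0 1)
        ((L.comp T).comp (.single ℝ (fun _ => ℝ) k)) =
        Complex.exp (-(((∑ i ∈ e k, c i) ^ 2 * μ.real (A (e k)) : ℝ) : ℂ) / 2) := by
      intro k
      set w : ℝ := (∑ i ∈ e k, c i) * √(μ.real (A (e k))) with hw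
      have : ((L.comp T).comp (.single ℝ (fun _ => ℝ) k) : StrongDual ℝ ℝ) =
          w • ContinuousLinearMap.id ℝ ℝ := by
        ext
        simp only [ContinuousLinearMap.comp_apply, smul_apply, hLx, hTa,
          ContinuousLinearMap.single_apply, Pi.single_apply]
        simp [hw, Finset.sum_mul, Finset.sum_ite_mem]
      have hww : w ^ 2 = (∑ i ∈ e k, c i) ^ 2 * μ.real (A (e k)) := by
        rw [hw, mul_pow, Real.sq_sqrt measureReal_nonneg]
      rw [this, ← hww, charFunDual_apply]
      have := charFun_gaussianReal (μ := 0) (v := 1) w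
      rw [charFun_apply_real] at this
      simp only [smul_apply, ContinuousLinearMap.id_apply, smul_eq_mul,
        Complex.ofReal_mul]
      rw [this]
      congr 1
      push_cast
      ring
    rw [h_int, Finset.prod_congr rfl fun k _ => hk k, ← Complex.exp_sum]
    congr 1
    push_cast
    rw [← Finset.sum_div, ← Finset.sum_neg_distrib]
  have hval : ∀ u : Set I, u ⊆ s ∪ t → ∃ B : Set (Fin n → ℝ), IsUpperSet B ∧ MeasurableSet B ∧
      (∀ x, x ∈ B ↔ ∀ i : ι, f i ∈ u → a (f i) ≤ T x i) ∧
      P.real (above X a u) = (Measure.pi fun _ : Fin n => gaussianReal 0 1).real B := by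
    intro u hu
    set D : Set (ι → ℝ) := {v | ∀ i : ι, f i ∈ u → a (f i) ≤ v i}
    have hD : MeasurableSet D := by
      simp only [D, Set.ofPred_forall]
      exact MeasurableSet.iInter fun i => MeasurableSet.iInter fun _ =>
        measurableSet_le measurable_const (measurable_pi_apply i)
    refine ⟨T ⁻¹' D, ?_, hD.preimage T.continuous.measurable, fun x => Iff.rfl, ?_⟩
    · intro x y hxy hx i hi
      exact (hx i hi).trans (hTmono hxy i)
    · have e1 : above X a u = (fun ω (i : ι) => X (f i) ω) ⁻¹' D := by
        ext ω
        exact ⟨fun hω i hi => hω _ hi, fun hω i hi => hω ⟨i, hu hi⟩ hi⟩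
      rw [e1, measureReal_def, ← Measure.map_apply hm hD, hlaw,
        Measure.map_apply T.continuous.measurable hD]
      rfl
  obtain ⟨B₁, u₁, m₁, d₁, p₁⟩ := hval s Set.subset_union_left
  obtain ⟨B₂, u₂, m₂, d₂, p₂⟩ := hval t Set.subset_union_right
  obtain ⟨B₃, u₃, m₃, d₃, p₃⟩ := hval (s ∪ t) subset_rfl
  have : B₃ = B₁ ∩ B₂ := by
    ext x
    rw [Set.mem_inter_iff, d₁, d₂, d₃]
    exact ⟨fun hx => ⟨fun i hi => hx i (.inl hi), fun i hi => hx i (.inr hi)⟩,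
      fun hx i hi => hi.elim (hx.1 i) (hx.2 i)⟩
  rw [p₁, p₂, p₃, this]
  exact harris_pi_measure _ n u₁ u₂ m₁ m₂

lemma gaussianReal_Ici_le {v w : NNReal} (hvw : v ≤ w) {τ : ℝ} (hτ : 0 ≤ τ) :
    (gaussianReal 0 v).real (Set.Ici τ) ≤ Real.exp (-τ ^ 2 / (2 * w)) := by
  have : HasSubgaussianMGF id w (gaussianReal 0 v) := by
    refine ⟨fun t => integrable_exp_mul_gaussianReal t, fun t => ?_⟩
    rw [mgf_id_gaussianReal]
    simp only [zero_mul, zero_add]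
    gcongr
  exact this.measure_ge_le hτ

lemma prob_ge_eq (h : IsNoise μ P X R) (i : I) (τ : ℝ) :
    P.real {ω | τ ≤ X i ω} = (gaussianReal 0 (μ.real (R i)).toNNReal).real (Set.Ici τ) := by
  have hl := h.law Unit (fun _ => i) fun _ => 1
  have : ∀ z, (∑ _j : Unit, (1 : ℝ) * (R i).indicator 1 z) ^ 2 = (R i).indicator 1 z := by
    intro z
    by_cases hz : z ∈ R i <;> simp [hz]
  simp only [this] at hl
  rw [integral_indicator_one (h.measR i)] at hl
  simp only [one_mul, Finset.univ_unique, Finset.sum_singleton] at hl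
  rw [← hl, measureReal_def, measureReal_def, Measure.map_apply (h.meas i) measurableSet_Ici]
  rfl

/-- Gaussian tail bound. -/
lemma prob_ge_le (h : IsNoise μ P X R) (i : I) {v τ : ℝ}
    (hτ : 0 ≤ τ) (hv : μ.real (R i) ≤ v) :
    P.real {ω | τ ≤ X i ω} ≤ Real.exp (-τ ^ 2 / (2 * v)) := by
  rw [h.prob_ge_eq]
  have := gaussianReal_Ici_le (Real.toNNReal_le_toNNReal hv) hτ
  rwa [Real.coe_toNNReal _ (measureReal_nonneg.trans hv)] at this

/-- Gaussian tail bound for increments. -/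
lemma prob_sub_ge_le (h : IsNoise μ P X R) (i j : I) {v τ : ℝ}
    (hτ : 0 ≤ τ) (hij : μ.real (R i \ R j) + μ.real (R j \ R i) ≤ v) :
    P.real {ω | τ ≤ X i ω - X j ω} ≤ Real.exp (-τ ^ 2 / (2 * v)) := by
  have hl := h.law Bool (fun k => if k then i else j) fun k => if k then 1 else -1
  have : ∀ z, (∑ k : Bool, (if k then (1 : ℝ) else -1) *
      (R (if k then i else j)).indicator 1 z) ^ 2 =
      (R i \ R j).indicator 1 z + (R j \ R i).indicator 1 z := by
    intro z
    by_cases hi : z ∈ R i <;> by_cases hj : z ∈ R j <;> simp [hi, hj]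
  have hm : Measurable fun ω => X i ω - X j ω := (h.meas i).sub (h.meas j)
  have m1 : MeasurableSet (R i \ R j) := (h.measR i).diff (h.measR j)
  have m2 : MeasurableSet (R j \ R i) := (h.measR j).diff (h.measR i)
  have i1 : Integrable ((R i \ R j).indicator (1 : Z → ℝ)) μ :=
    (integrable_indicator_iff m1).2 (integrableOn_const (C := (1 : ℝ))
      (ne_top_of_le_ne_top (h.fin i) (measure_mono Set.sdiff_subset)))
  have i2 : Integrable ((R j \ R i).indicator (1 : Z → ℝ)) μ :=
    (integrable_indicator_iff m2).2 (integrableOn_const (C := (1 : ℝ))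
      (ne_top_of_le_ne_top (h.fin j) (measure_mono Set.sdiff_subset)))
  simp only [this] at hl
  rw [integral_add i1 i2, integral_indicator_one m1, integral_indicator_one m2] at hl
  have e : (fun ω => ∑ k : Bool, (if k then (1 : ℝ) else -1) * X (if k then i else j) ω) =
      fun ω => X i ω - X j ω := by
    ext ω; simp [sub_eq_add_neg]
  rw [e] at hl
  have := gaussianReal_Ici_le (Real.toNNReal_le_toNNReal hij) hτ
  rw [Real.coe_toNNReal _ ((add_nonneg measureReal_nonneg measureReal_nonneg).trans hij),
    ← hl, measureReal_def, Measure.map_apply hm measurableSet_Ici] at this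
  exact this

end IsNoise

/-- Points `(t, z)` with `a < t ≤ b` and `|z - x| < t`. -/
def coneSlab {d : ℕ} (a b : ℝ) (x : EuclideanSpace ℝ (Fin d)) :
    Set (ℝ × EuclideanSpace ℝ (Fin d)) :=
  {p | a < p.1 ∧ p.1 ≤ b ∧ p.2 ∈ Metric.ball x p.1}

/-- The control measure of the white noise: `dz dt / (t vol(B_t))`. -/
noncomputable def coneMeasure (d : ℕ) : Measure (ℝ × EuclideanSpace ℝ (Fin d)) :=
  (volume.withDensity fun t : ℝ =>
    (ENNReal.ofReal t * volume (Metric.ball (0 : EuclideanSpace ℝ (Fin d)) t))⁻¹).prod volume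

section Cone

variable {d : ℕ}

lemma measurableSet_coneSlab (a b : ℝ) (x : EuclideanSpace ℝ (Fin d)) :
    MeasurableSet (coneSlab a b x) := by
  refine (measurableSet_lt measurable_const measurable_fst).inter
    ((measurableSet_le measurable_fst measurable_const).inter ?_)
  exact measurableSet_lt (by fun_prop) measurable_fst

lemma coneMeasure_apply {a b : ℝ} {S : Set (ℝ × EuclideanSpace ℝ (Fin d))} (hS : MeasurableSet S)
    (hab : ∀ p ∈ S, p.1 ∈ Set.Ioc a b) :
    coneMeasure d S = ∫⁻ t in Set.Ioc a b,
      (ENNReal.ofReal t * volume (Metric.ball (0 : EuclideanSpace ℝ (Fin d)) t))⁻¹ *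
        volume {z | (t, z) ∈ S} := by
  have hdens : Measurable fun t : ℝ =>
      (ENNReal.ofReal t * volume (Metric.ball (0 : EuclideanSpace ℝ (Fin d)) t))⁻¹ := by
    refine (ENNReal.measurable_ofReal.mul (Monotone.measurable fun s t hst => ?_)).inv
    exact measure_mono (Metric.ball_subset_ball hst)
  rw [coneMeasure, Measure.prod_apply hS,
    lintegral_withDensity_eq_lintegral_mul _ hdens (measurable_measure_prodMk_left hS),
    ← lintegral_indicator measurableSet_Ioc]
  refine lintegral_congr fun t => ?_
  by_cases ht : t ∈ Set.Ioc a b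
  · rw [Set.indicator_of_mem ht]; rfl
  · rw [Set.indicator_of_notMem ht]
    have : Prod.mk t ⁻¹' S = ∅ := by
      ext z
      simp only [Set.mem_preimage, Set.mem_empty_iff_false, iff_false]
      exact fun hz => ht (hab _ hz)
    simp [this]

lemma lintegral_const_mul_inv {a b κ : ℝ} (ha : 0 < a) (hab : a ≤ b) (hκ : 0 ≤ κ) :
    ∫⁻ t in Set.Ioc a b, ENNReal.ofReal (κ * t⁻¹) = ENNReal.ofReal (κ * Real.log (b / a)) := by
  have h_int : IntegrableOn (fun t : ℝ => κ * t⁻¹) (Set.Ioc a b) := by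
    rw [← intervalIntegrable_iff_integrableOn_Ioc_of_le hab]
    refine IntervalIntegrable.const_mul ?_ κ
    refine intervalIntegrable_inv_iff.2 (.inr ?_)
    rw [Set.uIcc_of_le hab]
    exact fun h => absurd h.1 (not_le.2 ha)
  rw [← ofReal_integral_eq_lintegral_ofReal h_int, integral_const_mul,
    ← intervalIntegral.integral_of_le hab, integral_inv_of_pos ha (ha.trans_le hab)]
  filter_upwards [ae_restrict_mem measurableSet_Ioc] with t ht
  exact mul_nonneg hκ (inv_nonneg.2 (ha.trans ht.1).le)

lemma inv_ofReal_mul_volume_mul {κ t : ℝ} (hκ : 0 ≤ κ) (ht0 : 0 < t) :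
    (ENNReal.ofReal t * volume (Metric.ball (0 : EuclideanSpace ℝ (Fin d)) t))⁻¹ *
        (ENNReal.ofReal κ * volume (Metric.ball (0 : EuclideanSpace ℝ (Fin d)) t)) =
      ENNReal.ofReal (κ * t⁻¹) := by
  have hb0 : volume (Metric.ball (0 : EuclideanSpace ℝ (Fin d)) t) ≠ 0 :=
    (Metric.measure_ball_pos volume _ ht0).ne'
  have hbt : volume (Metric.ball (0 : EuclideanSpace ℝ (Fin d)) t) ≠ ⊤ := measure_ball_lt_top.ne
  have ho : ENNReal.ofReal t ≠ 0 := by simpa using ht0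
  rw [ENNReal.mul_inv (.inl ho) (.inr hb0), ENNReal.ofReal_mul hκ, ENNReal.ofReal_inv_of_pos ht0]
  rw [show ∀ u v w z : ENNReal, u * v * (w * z) = w * u * (v * z) from fun u v w z => by ring,
    ENNReal.inv_mul_cancel hb0 hbt, mul_one]

lemma coneMeasure_le {a b κ : ℝ} (ha : 0 < a) (hab : a ≤ b) (hκ : 0 ≤ κ)
    {S : Set (ℝ × EuclideanSpace ℝ (Fin d))} (hS : MeasurableSet S)
    (h1 : ∀ p ∈ S, p.1 ∈ Set.Ioc a b)
    (h2 : ∀ t ∈ Set.Ioc a b, volume {z | (t, z) ∈ S} ≤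
      ENNReal.ofReal κ * volume (Metric.ball (0 : EuclideanSpace ℝ (Fin d)) t)) :
    coneMeasure d S ≤ ENNReal.ofReal (κ * Real.log (b / a)) := by
  rw [coneMeasure_apply hS h1, ← lintegral_const_mul_inv ha hab hκ]
  refine setLIntegral_mono' measurableSet_Ioc fun t ht => ?_
  rw [← inv_ofReal_mul_volume_mul hκ (ha.trans ht.1)]
  gcongr
  exact h2 t ht

lemma coneMeasure_coneSlab {a b : ℝ} (ha : 0 < a) (hab : a ≤ b) (x : EuclideanSpace ℝ (Fin d)) :
    coneMeasure d (coneSlab a b x) = ENNReal.ofReal (Real.log (b / a)) := by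
  rw [coneMeasure_apply (measurableSet_coneSlab a b x) (fun p hp => ⟨hp.1, hp.2.1⟩),
    ← one_mul (Real.log (b / a)), ← lintegral_const_mul_inv ha hab zero_le_one]
  refine setLIntegral_congr_fun measurableSet_Ioc fun t ht => ?_
  rw [← inv_ofReal_mul_volume_mul (d := d) zero_le_one (ha.trans ht.1), ENNReal.ofReal_one, one_mul,
    ← Measure.addHaar_ball_center volume x]
  congr 2
  ext z
  exact ⟨fun h => h.2.2, fun h => ⟨ht.1, ht.2, h⟩⟩

lemma wnKernel_eq (n m : ℕ) (x y : EuclideanSpace ℝ (Fin d)) :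
    wnKernel d n m x y = (coneMeasure d).real
      (coneSlab ((2 : ℝ) ^ n)⁻¹ 1 x ∩ coneSlab ((2 : ℝ) ^ m)⁻¹ 1 y) := by
  have e2 : ∀ k : ℕ, (2 : ℝ) ^ (-(k : ℤ)) = ((2 : ℝ) ^ k)⁻¹ := fun k => by
    rw [zpow_neg, zpow_natCast]
  have emax : (2 : ℝ) ^ (-(min n m : ℤ)) = max ((2 : ℝ) ^ n)⁻¹ ((2 : ℝ) ^ m)⁻¹ := by
    rw [← e2, ← e2]
    rcases le_total n m with h | h
    · rw [min_eq_left (by exact_mod_cast h), max_eq_left]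
      exact zpow_le_zpow_right₀ one_le_two (by simpa using h)
    · rw [min_eq_right (by exact_mod_cast h), max_eq_right]
      exact zpow_le_zpow_right₀ one_le_two (by simpa using h)
  set a := max ((2 : ℝ) ^ n)⁻¹ ((2 : ℝ) ^ m)⁻¹ with ha
  have ha0 : 0 < a := lt_max_of_lt_left (by positivity)
  set S := coneSlab ((2 : ℝ) ^ n)⁻¹ 1 x ∩ coneSlab ((2 : ℝ) ^ m)⁻¹ 1 y
  have hS : MeasurableSet S := (measurableSet_coneSlab _ _ _).inter (measurableSet_coneSlab _ _ _)
  have h1 : ∀ p ∈ S, p.1 ∈ Set.Ioc a 1 := fun p hp => ⟨max_lt hp.1.1 hp.2.1, hp.1.2.1⟩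
  have hdens : Measurable fun t : ℝ =>
      (ENNReal.ofReal t * volume (Metric.ball (0 : EuclideanSpace ℝ (Fin d)) t))⁻¹ := by
    refine (ENNReal.measurable_ofReal.mul (Monotone.measurable fun s t hst => ?_)).inv
    exact measure_mono (Metric.ball_subset_ball hst)
  rw [wnKernel, emax, measureReal_def, coneMeasure_apply hS h1,
    ← integral_toReal (f := fun t => (ENNReal.ofReal t *
      volume (Metric.ball (0 : EuclideanSpace ℝ (Fin d)) t))⁻¹ * volume {z | (t, z) ∈ S})
      (hdens.mul (measurable_measure_prodMk_left hS)).aemeasurable]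
  · refine setIntegral_congr_fun measurableSet_Ioc fun t ht => ?_
    have hsec : {z | (t, z) ∈ S} = Metric.ball x t ∩ Metric.ball y t := by
      ext z
      exact ⟨fun hz => ⟨hz.1.2.2, hz.2.2.2⟩, fun hz =>
        ⟨⟨(le_max_left _ _).trans_lt ht.1, ht.2, hz.1⟩, ⟨(le_max_right _ _).trans_lt ht.1, ht.2, hz.2⟩⟩⟩
    simp only [Pi.mul_apply, ENNReal.toReal_mul, ENNReal.toReal_inv]
    rw [ENNReal.toReal_ofReal (ha0.trans ht.1).le, hsec, mul_inv]
    ring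
  · filter_upwards [ae_restrict_mem measurableSet_Ioc] with t ht
    have ht0 := ha0.trans ht.1
    refine ENNReal.mul_lt_top ?_ ?_
    · rw [ENNReal.inv_lt_top]
      exact ENNReal.mul_pos (by simpa using ht0) (Metric.measure_ball_pos volume _ ht0).ne'
    · refine lt_of_le_of_lt (measure_mono fun z hz => hz.1.2.2) ?_
      exact measure_ball_lt_top (x := x) (r := t)

end Cone

/-- The field `h_n`, extended by `h_0 = 0`. -/
def extField {d : ℕ} {Ω : Type} (h : ℕ → EuclideanSpace ℝ (Fin d) → Ω → ℝ)
    (i : ℕ × EuclideanSpace ℝ (Fin d)) (ω : Ω) : ℝ :=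
  if i.1 = 0 then 0 else h i.1 i.2 ω

/-- The layers `h_n - h_{n-1}` of the field. -/
def layerField {d : ℕ} {Ω : Type} (h : ℕ → EuclideanSpace ℝ (Fin d) → Ω → ℝ)
    (i : ℕ × EuclideanSpace ℝ (Fin d)) (ω : Ω) : ℝ :=
  extField h i ω - extField h (i.1 - 1, i.2) ω

section Fields

variable {d : ℕ} {Ω : Type} [MeasurableSpace Ω] {P : Measure Ω}
  {h : ℕ → EuclideanSpace ℝ (Fin d) → Ω → ℝ}

lemma coneSlab_ne_top {a b : ℝ} (ha : 0 < a) (hab : a ≤ b) (x : EuclideanSpace ℝ (Fin d)) :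
    coneMeasure d (coneSlab a b x) ≠ ⊤ :=
  (coneMeasure_coneSlab ha hab x).trans_ne ENNReal.ofReal_ne_top

lemma inv_two_pow_le_one (n : ℕ) : ((2 : ℝ) ^ n)⁻¹ ≤ 1 :=
  inv_le_one_of_one_le₀ (one_le_pow₀ one_le_two)

lemma isNoise_extField (hw : IsWhiteNoiseField d P h) :
    IsNoise (coneMeasure d) P (extField h) fun i => coneSlab ((2 : ℝ) ^ i.1)⁻¹ 1 i.2 := by
  refine ⟨fun i => ?_, fun i => measurableSet_coneSlab _ _ _,
    fun i => coneSlab_ne_top (by positivity) (inv_two_pow_le_one _) _, fun ι _ idx c => ?_⟩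
  · unfold extField
    split_ifs
    · exact measurable_const
    · exact hw.1 _ _
  set e := (Fintype.equivFin ι).symm
  have hl := hw.2.1 (Fintype.card ι)
    (fun k => if (idx (e k)).1 = 0 then (1, (idx (e k)).2) else idx (e k))
    (fun k => if (idx (e k)).1 = 0 then 0 else c (e k)) (fun k => by
      split_ifs with h0
      · exact le_rfl
      · exact Nat.one_le_iff_ne_zero.2 h0)
  have e1 : (fun ω => ∑ j, c j * extField h (idx j) ω) = fun ω => ∑ k,
      (if (idx (e k)).1 = 0 then 0 else c (e k)) *
      h (if (idx (e k)).1 = 0 then (1, (idx (e k)).2) else idx (e k)).1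
        (if (idx (e k)).1 = 0 then (1, (idx (e k)).2) else idx (e k)).2 ω := by
    ext ω
    rw [← e.sum_comp]
    refine Finset.sum_congr rfl fun k _ => ?_
    unfold extField
    split_ifs <;> simp
  rw [e1, hl]
  congr 2
  have hfin : ∀ i j : ι, coneMeasure d (coneSlab ((2 : ℝ) ^ (idx i).1)⁻¹ 1 (idx i).2 ∩
      coneSlab ((2 : ℝ) ^ (idx j).1)⁻¹ 1 (idx j).2) ≠ ⊤ := fun i j =>
    ne_top_of_le_ne_top (coneSlab_ne_top (by positivity) (inv_two_pow_le_one _) _)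
      (measure_mono Set.inter_subset_left)
  have hm : ∀ i j : ι, MeasurableSet (coneSlab ((2 : ℝ) ^ (idx i).1)⁻¹ 1 (idx i).2 ∩
      coneSlab ((2 : ℝ) ^ (idx j).1)⁻¹ 1 (idx j).2) := fun i j =>
    (measurableSet_coneSlab _ _ _).inter (measurableSet_coneSlab _ _ _)
  have e2 : ∀ z, (∑ j, c j * (coneSlab ((2 : ℝ) ^ (idx j).1)⁻¹ 1 (idx j).2).indicator 1 z) ^ 2 =
      ∑ i, ∑ j, (c i * c j) * (coneSlab ((2 : ℝ) ^ (idx i).1)⁻¹ 1 (idx i).2 ∩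
        coneSlab ((2 : ℝ) ^ (idx j).1)⁻¹ 1 (idx j).2).indicator (1 : ℝ × EuclideanSpace ℝ (Fin d) → ℝ) z := by
    intro z
    rw [sq, Finset.sum_mul_sum]
    refine Finset.sum_congr rfl fun i _ => Finset.sum_congr rfl fun j _ => ?_
    rw [Set.inter_indicator_one]
    simp only [Pi.mul_apply]
    ring
  have hi : ∀ i j : ι, Integrable (fun z => (c i * c j) *
      (coneSlab ((2 : ℝ) ^ (idx i).1)⁻¹ 1 (idx i).2 ∩
        coneSlab ((2 : ℝ) ^ (idx j).1)⁻¹ 1 (idx j).2).indicator (1 : ℝ × EuclideanSpace ℝ (Fin d) → ℝ) z)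
      (coneMeasure d) := fun i j =>
    ((integrable_indicator_iff (hm i j)).2 (integrableOn_const (C := (1 : ℝ)) (hfin i j))).const_mul _
  simp only [e2]
  rw [integral_finsetSum _ fun i _ => integrable_finsetSum _ fun j _ => hi i j, ← e.sum_comp]
  refine Finset.sum_congr rfl fun k _ => ?_
  rw [integral_finsetSum _ fun j _ => hi _ j, ← e.sum_comp]
  refine Finset.sum_congr rfl fun l _ => ?_
  rw [integral_const_mul, integral_indicator_one (hm _ _)]
  by_cases h0 : (idx (e k)).1 = 0
  · have : coneSlab ((2 : ℝ) ^ (idx (e k)).1)⁻¹ 1 (idx (e k)).2 = ∅ := by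
      rw [h0, pow_zero, inv_one]
      ext z; simp only [coneSlab, Set.mem_ofPred_eq, Set.mem_empty_iff_false, iff_false]
      exact fun hz => absurd hz.1 (not_lt.2 hz.2.1)
    rw [if_pos h0, this]; simp
  by_cases h1 : (idx (e l)).1 = 0
  · have : coneSlab ((2 : ℝ) ^ (idx (e l)).1)⁻¹ 1 (idx (e l)).2 = ∅ := by
      rw [h1, pow_zero, inv_one]
      ext z; simp only [coneSlab, Set.mem_ofPred_eq, Set.mem_empty_iff_false, iff_false]
      exact fun hz => absurd hz.1 (not_lt.2 hz.2.1)
    rw [if_pos h1, this]; simp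
  simp only [h0, h1, if_false, wnKernel_eq]

lemma isNoise_layerField (hw : IsWhiteNoiseField d P h) :
    IsNoise (coneMeasure d) P (layerField h)
      fun i => coneSlab ((2 : ℝ) ^ i.1)⁻¹ ((2 : ℝ) ^ (i.1 - 1))⁻¹ i.2 := by
  have hH := isNoise_extField hw
  have hle : ∀ n : ℕ, ((2 : ℝ) ^ n)⁻¹ ≤ ((2 : ℝ) ^ (n - 1))⁻¹ := fun n =>
    inv_anti₀ (by positivity) (pow_le_pow_right₀ one_le_two (Nat.sub_le _ _))
  refine ⟨fun i => (hH.meas _).sub (hH.meas _), fun i => measurableSet_coneSlab _ _ _,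
    fun i => coneSlab_ne_top (by positivity) (hle _) _, fun ι _ idx c => ?_⟩
  have hl := hH.law (ι ⊕ ι) (Sum.elim idx fun j => ((idx j).1 - 1, (idx j).2))
    (Sum.elim c fun j => -c j)
  simp only [Fintype.sum_sum_type, Sum.elim_inl, Sum.elim_inr, ← Finset.sum_add_distrib] at hl
  convert hl using 3
  · refine Finset.sum_congr rfl fun j _ => ?_
    rw [layerField]; ring
  · refine integral_congr_ae (Filter.Eventually.of_forall fun z => ?_)
    simp only
    congr 1
    refine Finset.sum_congr rfl fun j _ => ?_
    set n := (idx j).1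
    set x := (idx j).2
    have : (coneSlab ((2 : ℝ) ^ n)⁻¹ ((2 : ℝ) ^ (n - 1))⁻¹ x).indicator (1 : ℝ × EuclideanSpace ℝ (Fin d) → ℝ) z =
        (coneSlab ((2 : ℝ) ^ n)⁻¹ 1 x).indicator 1 z -
        (coneSlab ((2 : ℝ) ^ (n - 1))⁻¹ 1 x).indicator 1 z := by
      classical
      have h1 := hle n
      have h2 := inv_two_pow_le_one (n - 1)
      have h3 : ∀ a b : ℝ, z ∈ coneSlab a b x ↔ a < z.1 ∧ z.1 ≤ b ∧ z.2 ∈ Metric.ball x z.1 :=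
        fun _ _ => Iff.rfl
      simp only [Set.indicator_apply, h3, Pi.one_apply]
      by_cases hb : z.2 ∈ Metric.ball x z.1
      · simp only [hb, and_true]
        clear_value n x
        clear h3 hl
        split_ifs <;> first | norm_num; done | (exfalso; grind)
      · simp [hb]
    rw [this]; ring

end Fields

section Ball

variable {d : ℕ}

lemma integrableOn_ball_of_continuous {f : EuclideanSpace ℝ (Fin d) → ℝ} (hf : Continuous f) (t : ℝ) :
    IntegrableOn f (Metric.ball 0 t) :=
  (hf.continuousOn.integrableOn_compact (isCompact_closedBall 0 t)).mono_set
    Metric.ball_subset_closedBall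

lemma setIntegral_ball_inner_sq_eq {v w : EuclideanSpace ℝ (Fin d)} (hvw : ‖v‖ = ‖w‖) (t : ℝ) :
    ∫ z in Metric.ball 0 t, (inner ℝ z v) ^ 2 = ∫ z in Metric.ball 0 t, (inner ℝ z w) ^ 2 := by
  set ρ := (Submodule.span ℝ {v - w})ᗮ.reflection
  have h1 : ρ v = w := Submodule.reflection_sub hvw
  have h2 := (ρ.measurePreserving).setIntegral_preimage_emb
    ρ.toHomeomorph.measurableEmbedding (fun z => (inner ℝ z w) ^ 2) (Metric.ball 0 t)
  rw [← h2]
  have h3 : ρ ⁻¹' Metric.ball 0 t = Metric.ball 0 t := by ext z; simp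
  rw [h3]
  refine setIntegral_congr_fun measurableSet_ball fun z _ => ?_
  rw [← h1, ρ.inner_map_map]

lemma setIntegral_ball_inner_sq_le (v : EuclideanSpace ℝ (Fin d)) (t : ℝ) :
    d * ∫ z in Metric.ball 0 t, (inner ℝ z v) ^ 2 ≤
      ‖v‖ ^ 2 * (t ^ 2 * volume.real (Metric.ball (0 : EuclideanSpace ℝ (Fin d)) t)) := by
  have h1 : ∀ i : Fin d, ∫ z in Metric.ball (0 : EuclideanSpace ℝ (Fin d)) t, (inner ℝ z v) ^ 2 =
      ‖v‖ ^ 2 * ∫ z in Metric.ball (0 : EuclideanSpace ℝ (Fin d)) t, (z i) ^ 2 := fun i => by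
    rw [setIntegral_ball_inner_sq_eq (w := ‖v‖ • EuclideanSpace.single i (1 : ℝ)) (by simp [norm_smul]),
      ← integral_const_mul]
    refine integral_congr_ae (Filter.Eventually.of_forall fun z => ?_)
    simp [inner_smul_right, mul_pow, EuclideanSpace.inner_single_right]
  have h2 : d * ∫ z in Metric.ball (0 : EuclideanSpace ℝ (Fin d)) t, (inner ℝ z v) ^ 2 =
      ‖v‖ ^ 2 * ∫ z in Metric.ball (0 : EuclideanSpace ℝ (Fin d)) t, ‖z‖ ^ 2 := by
    have : (d : ℝ) * ∫ z in Metric.ball (0 : EuclideanSpace ℝ (Fin d)) t, (inner ℝ z v) ^ 2 =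
      ∑ i : Fin d, ∫ z in Metric.ball (0 : EuclideanSpace ℝ (Fin d)) t, (inner ℝ z v) ^ 2 := by simp
    rw [this, Finset.sum_congr rfl fun i _ => h1 i, ← Finset.mul_sum, ← integral_finsetSum]
    · simp [EuclideanSpace.norm_sq_eq]
    · exact fun i _ => integrableOn_ball_of_continuous (by fun_prop) t
  rw [h2]
  gcongr
  calc ∫ z in Metric.ball (0 : EuclideanSpace ℝ (Fin d)) t, ‖z‖ ^ 2
      ≤ ∫ z in Metric.ball (0 : EuclideanSpace ℝ (Fin d)) t, t ^ 2 := by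
        refine setIntegral_mono_on (integrableOn_ball_of_continuous (by fun_prop) t)
          (integrableOn_const measure_ball_lt_top.ne) measurableSet_ball fun z hz => ?_
        have : ‖z‖ ≤ t := (mem_ball_zero_iff.1 hz).le
        gcongr
    _ = _ := by simp [mul_comm]

lemma volume_ball_diff_ball_zero_le (hd : 0 < d) {t z : ℝ} (ht : 0 < t) (hz : 0 < z) (hz2 : z ≤ 1 / 2)
    {v : EuclideanSpace ℝ (Fin d)} (hv : √d * ‖v‖ / t ≤ z ^ 3) :
    volume.real (Metric.ball (0 : EuclideanSpace ℝ (Fin d)) t \ Metric.ball v t) ≤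
      17 * z ^ 2 * volume.real (Metric.ball (0 : EuclideanSpace ℝ (Fin d)) t) := by
  have hd' : (1 : ℝ) ≤ d := by exact_mod_cast hd
  set V := volume.real (Metric.ball (0 : EuclideanSpace ℝ (Fin d)) t) with hV
  have hVpos : 0 < V := ENNReal.toReal_pos (Metric.measure_ball_pos volume _ ht).ne'
    measure_ball_lt_top.ne
  set δ := z ^ 2 / d with hδ
  have hδ0 : 0 < δ := by positivity
  have hδ1 : δ < 1 := by
    rw [hδ, div_lt_one (by positivity)]; nlinarith
  have hv2 : d * ‖v‖ ^ 2 ≤ z ^ 6 * t ^ 2 := by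
    rw [div_le_iff₀ ht] at hv
    have := pow_le_pow_left₀ (by positivity) hv 2
    rw [mul_pow, Real.sq_sqrt (by positivity)] at this
    nlinarith
  have hδd : δ * d = z ^ 2 := by rw [hδ]; field_simp
  have hz4 : z ^ 4 ≤ 1 / 2 := by
    calc z ^ 4 ≤ (1 / 2) ^ 4 := by gcongr
      _ ≤ 1 / 2 := by norm_num
  have hvδ : ‖v‖ ^ 2 ≤ δ * t ^ 2 / 2 := by
    have : d * ‖v‖ ^ 2 ≤ d * (δ * t ^ 2 / 2) := by
      calc d * ‖v‖ ^ 2 ≤ z ^ 6 * t ^ 2 := hv2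
        _ = z ^ 4 * (z ^ 2 * t ^ 2) := by ring
        _ ≤ 1 / 2 * (z ^ 2 * t ^ 2) := by gcongr
        _ = _ := by rw [← hδd]; ring
    exact le_of_mul_le_mul_left this (by positivity)
  set A := Metric.ball (0 : EuclideanSpace ℝ (Fin d)) t \ Metric.ball 0 ((1 - δ) * t) with hA
  set B := Metric.ball (0 : EuclideanSpace ℝ (Fin d)) t ∩
    {x | (δ * t ^ 2 / 4) ^ 2 ≤ (inner ℝ x v) ^ 2} with hB
  have hsub : Metric.ball (0 : EuclideanSpace ℝ (Fin d)) t \ Metric.ball v t ⊆ A ∪ B := by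
    rintro x ⟨hx, hxv⟩
    by_cases hxA : x ∈ Metric.ball (0 : EuclideanSpace ℝ (Fin d)) ((1 - δ) * t)
    · refine .inr ⟨hx, ?_⟩
      rw [mem_ball_zero_iff] at hxA
      rw [mem_ball_iff_norm, not_lt] at hxv
      have e := norm_sub_sq_real x v
      have h1 : t ^ 2 ≤ ‖x - v‖ ^ 2 := by gcongr
      have h2 : ‖x‖ ^ 2 ≤ ((1 - δ) * t) ^ 2 := by gcongr
      have h3 : ((1 - δ) * t) ^ 2 ≤ (1 - δ) * t ^ 2 := by
        rw [mul_pow]; gcongr; nlinarith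
      have h4 : δ * t ^ 2 / 4 ≤ - inner ℝ x v := by linarith
      show (δ * t ^ 2 / 4) ^ 2 ≤ (inner ℝ x v) ^ 2
      rw [← neg_sq (inner ℝ x v)]
      gcongr
    · exact .inl ⟨hx, hxA⟩
  have hAfin : volume A ≠ ⊤ := ne_top_of_le_ne_top measure_ball_lt_top.ne
    (measure_mono Set.sdiff_subset)
  have hBfin : volume B ≠ ⊤ := ne_top_of_le_ne_top measure_ball_lt_top.ne
    (measure_mono Set.inter_subset_left)
  have hAle : volume.real A ≤ z ^ 2 * V := by
    rw [hA, measureReal_sdiff (Metric.ball_subset_ball (by nlinarith)) measurableSet_ball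
      measure_ball_lt_top.ne]
    have : volume.real (Metric.ball (0 : EuclideanSpace ℝ (Fin d)) ((1 - δ) * t)) =
        (1 - δ) ^ d * V := by
      rw [measureReal_def, Measure.addHaar_ball_mul_of_pos volume 0 (sub_pos.2 hδ1) t]
      simp [hV, measureReal_def, ENNReal.toReal_ofReal (pow_nonneg (sub_nonneg.2 hδ1.le) d)]
    rw [this]
    have hb := one_add_mul_le_pow (show (-2 : ℝ) ≤ -δ by linarith) d
    rw [← sub_eq_add_neg] at hb
    have : (1 - z ^ 2) * V ≤ (1 - δ) ^ d * V := by gcongr; rw [← hδd]; linarith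
    linarith
  have hBle : volume.real B ≤ 16 * z ^ 2 * V := by
    have hc := mul_meas_ge_le_integral_of_nonneg
      (μ := volume.restrict (Metric.ball (0 : EuclideanSpace ℝ (Fin d)) t))
      (f := fun x => (inner ℝ x v) ^ 2) (Filter.Eventually.of_forall fun x => sq_nonneg _)
      (integrableOn_ball_of_continuous (by fun_prop) t) ((δ * t ^ 2 / 4) ^ 2)
    have hr : (volume.restrict (Metric.ball (0 : EuclideanSpace ℝ (Fin d)) t)).real
        {x | (δ * t ^ 2 / 4) ^ 2 ≤ (inner ℝ x v) ^ 2} = volume.real B := by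
      rw [measureReal_restrict_apply (measurableSet_le (by fun_prop) (by fun_prop)), hB,
        Set.inter_comm]
    have hc2 := setIntegral_ball_inner_sq_le v t
    rw [hr] at hc
    have : d * ((δ * t ^ 2 / 4) ^ 2 * volume.real B) * d ^ 2 ≤
        (16 * z ^ 2 * V) * (d * (δ * t ^ 2 / 4) ^ 2 * d ^ 2) := by
      calc d * ((δ * t ^ 2 / 4) ^ 2 * volume.real B) * d ^ 2
          ≤ (‖v‖ ^ 2 * (t ^ 2 * V)) * d ^ 2 := by
            have := (mul_le_mul_of_nonneg_left hc (Nat.cast_nonneg d)).trans hc2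
            gcongr
        _ = (d * ‖v‖ ^ 2) * (t ^ 2 * V * d) := by ring
        _ ≤ (z ^ 6 * t ^ 2) * (t ^ 2 * V * d) := by gcongr
        _ = (16 * z ^ 2 * V) * (d * (z ^ 2 * t ^ 2 / 4) ^ 2) := by ring
        _ = _ := by rw [← hδd]; ring
    have hpos : 0 < d * (δ * t ^ 2 / 4) ^ 2 * (d : ℝ) ^ 2 := by positivity
    refine le_of_mul_le_mul_right ?_ hpos
    linarith
  calc _ ≤ volume.real (A ∪ B) :=
        measureReal_mono hsub (measure_union_ne_top hAfin hBfin)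
    _ ≤ volume.real A + volume.real B := measureReal_union_le _ _
    _ ≤ _ := by linarith

lemma volume_ball_diff_ball_le (hd : 0 < d) {t z : ℝ} (ht : 0 < t) (hz : 0 < z) (hz2 : z ≤ 1 / 2)
    {x y : EuclideanSpace ℝ (Fin d)} (hxy : √d * dist x y / t ≤ z ^ 3) :
    volume (Metric.ball x t \ Metric.ball y t) ≤
      ENNReal.ofReal (17 * z ^ 2) * volume (Metric.ball (0 : EuclideanSpace ℝ (Fin d)) t) := by
  have h := volume_ball_diff_ball_zero_le (v := y - x) hd ht hz hz2
    (by rwa [← dist_eq_norm, dist_comm])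
  have e : (fun u => x + u) ⁻¹' (Metric.ball x t \ Metric.ball y t) =
      Metric.ball 0 t \ Metric.ball (y - x) t := by
    ext u
    simp only [Set.mem_preimage, Set.mem_sdiff, mem_ball_iff_norm]
    rw [add_sub_cancel_left, sub_zero, show x + u - y = u - (y - x) by abel]
  rw [← measure_preimage_add volume x, e]
  have hf1 : volume (Metric.ball (0 : EuclideanSpace ℝ (Fin d)) t \ Metric.ball (y - x) t) ≠ ⊤ :=
    ne_top_of_le_ne_top measure_ball_lt_top.ne (measure_mono Set.sdiff_subset)
  rw [← ENNReal.ofReal_toReal hf1,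
    ← ENNReal.ofReal_toReal (measure_ball_lt_top (x := (0 : EuclideanSpace ℝ (Fin d)))
      (r := t) (μ := volume)).ne,
    ← ENNReal.ofReal_mul (by positivity)]
  exact ENNReal.ofReal_le_ofReal h

lemma coneMeasure_coneSlab_diff_le (hd : 0 < d) {a b z : ℝ} (ha : 0 < a) (hab : a ≤ b) (hz : 0 < z)
    (hz2 : z ≤ 1 / 2) {x y : EuclideanSpace ℝ (Fin d)} (hxy : √d * dist x y / a ≤ z ^ 3) :
    (coneMeasure d).real (coneSlab a b x \ coneSlab a b y) ≤ 17 * z ^ 2 * Real.log (b / a) := by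
  have hlog : 0 ≤ Real.log (b / a) := Real.log_nonneg (by rwa [one_le_div ha])
  refine ENNReal.toReal_le_of_le_ofReal (by positivity) ?_
  refine coneMeasure_le ha hab (by positivity)
    ((measurableSet_coneSlab _ _ _).diff (measurableSet_coneSlab _ _ _))
    (fun p hp => ⟨hp.1.1, hp.1.2.1⟩) fun t ht => ?_
  have ht0 : 0 < t := ha.trans ht.1
  refine le_trans (measure_mono ?_) (volume_ball_diff_ball_le hd ht0 hz hz2 (x := x) (y := y) ?_)
  · exact fun u hu => ⟨hu.1.2.2, fun h => hu.2 ⟨ht.1, ht.2, h⟩⟩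
  · refine le_trans ?_ hxy
    have := ht.1.le
    gcongr

lemma coneSlab_inter_null_of_ne {n n' : ℕ} (hn : 1 ≤ n) (hn' : 1 ≤ n') (hne : n ≠ n')
    (x y : EuclideanSpace ℝ (Fin d)) :
    coneMeasure d (coneSlab ((2 : ℝ) ^ n)⁻¹ ((2 : ℝ) ^ (n - 1))⁻¹ x ∩
      coneSlab ((2 : ℝ) ^ n')⁻¹ ((2 : ℝ) ^ (n' - 1))⁻¹ y) = 0 := by
  convert measure_empty (μ := coneMeasure d)
  ext p
  simp only [Set.mem_inter_iff, Set.mem_empty_iff_false, iff_false]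
  rintro ⟨⟨h1, h2, -⟩, ⟨h3, h4, -⟩⟩
  have key : ∀ k l : ℕ, k ≤ l - 1 → ((2 : ℝ) ^ (l - 1))⁻¹ ≤ ((2 : ℝ) ^ k)⁻¹ := fun k l h =>
    inv_anti₀ (by positivity) (pow_le_pow_right₀ one_le_two h)
  rcases lt_or_gt_of_ne hne with h | h
  · have := key n n' (by omega); linarith
  · have := key n' n (by omega); linarith

lemma coneSlab_inter_null_of_dist {a b a' b' : ℝ} {x y : EuclideanSpace ℝ (Fin d)}
    (hxy : 2 * b ≤ dist x y) :
    coneMeasure d (coneSlab a b x ∩ coneSlab a' b' y) = 0 := by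
  convert measure_empty (μ := coneMeasure d)
  ext p
  simp only [Set.mem_inter_iff, Set.mem_empty_iff_false, iff_false]
  rintro ⟨⟨-, h2, h3⟩, ⟨-, -, h6⟩⟩
  have := dist_triangle_left x y p.2
  rw [Metric.mem_ball] at h3 h6
  linarith

end Ball

section Increments

variable {d : ℕ} {Ω : Type} [MeasurableSpace Ω] {P : Measure Ω}
  {h : ℕ → EuclideanSpace ℝ (Fin d) → Ω → ℝ}

lemma inv_two_pow_div {n : ℕ} (hn : 1 ≤ n) : ((2 : ℝ) ^ (n - 1))⁻¹ / ((2 : ℝ) ^ n)⁻¹ = 2 := by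
  obtain ⟨k, rfl⟩ := Nat.exists_eq_add_of_le' hn
  rw [Nat.add_sub_cancel, pow_succ]
  field_simp

lemma two_pow_inv_le (n : ℕ) : ((2 : ℝ) ^ n)⁻¹ ≤ ((2 : ℝ) ^ (n - 1))⁻¹ :=
  inv_anti₀ (by positivity) (pow_le_pow_right₀ one_le_two (Nat.sub_le _ _))

lemma prob_layerField_ge (hw : IsWhiteNoiseField d P h) {n : ℕ} (hn : 1 ≤ n)
    (x : EuclideanSpace ℝ (Fin d)) (τ : ℝ) :
    P.real {ω | τ ≤ layerField h (n, x) ω} =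
      (gaussianReal 0 (Real.log 2).toNNReal).real (Set.Ici τ) := by
  have : (coneMeasure d).real (coneSlab ((2 : ℝ) ^ n)⁻¹ ((2 : ℝ) ^ (n - 1))⁻¹ x) = Real.log 2 := by
    rw [measureReal_def, coneMeasure_coneSlab (by positivity) (two_pow_inv_le n),
      inv_two_pow_div hn, ENNReal.toReal_ofReal (Real.log_nonneg one_le_two)]
  rw [(isNoise_layerField hw).prob_ge_eq, this]

lemma prob_layerField_sub_ge_le (hw : IsWhiteNoiseField d P h) (hd : 0 < d) {n : ℕ} (hn : 1 ≤ n)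
    {x y : EuclideanSpace ℝ (Fin d)} {z τ : ℝ} (hz : 0 < z) (hz2 : z ≤ 1 / 2) (hτ : 0 ≤ τ)
    (hxy : √d * dist x y * 2 ^ n ≤ z ^ 3) :
    P.real {ω | τ ≤ layerField h (n, x) ω - layerField h (n, y) ω} ≤
      Real.exp (-τ ^ 2 / (48 * z ^ 2)) := by
  have hl := Real.log_two_lt_d9
  have hl0 := Real.log_pos one_lt_two
  have key : ∀ u v : EuclideanSpace ℝ (Fin d), √d * dist u v * 2 ^ n ≤ z ^ 3 →
      (coneMeasure d).real (coneSlab ((2 : ℝ) ^ n)⁻¹ ((2 : ℝ) ^ (n - 1))⁻¹ u \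
        coneSlab ((2 : ℝ) ^ n)⁻¹ ((2 : ℝ) ^ (n - 1))⁻¹ v) ≤ 12 * z ^ 2 := fun u v huv => by
    have := coneMeasure_coneSlab_diff_le hd (by positivity) (two_pow_inv_le n) hz hz2
      (x := u) (y := v) (by rwa [div_inv_eq_mul])
    rw [inv_two_pow_div hn] at this
    nlinarith [sq_nonneg z]
  have := (isNoise_layerField hw).prob_sub_ge_le (n, x) (n, y) hτ (v := 24 * z ^ 2)
    (by linarith [key x y hxy, key y x (by rwa [dist_comm])])
  convert this using 3
  ring

lemma prob_extField_sub_ge_le (hw : IsWhiteNoiseField d P h) (hd : 0 < d) (n : ℕ)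
    {x y : EuclideanSpace ℝ (Fin d)} {z τ : ℝ} (hz : 0 < z) (hz2 : z ≤ 1 / 2) (hτ : 0 ≤ τ)
    (hxy : √d * dist x y * 2 ^ n ≤ z ^ 3) :
    P.real {ω | τ ≤ extField h (n, x) ω - extField h (n, y) ω} ≤
      Real.exp (-τ ^ 2 / (48 * n * z ^ 2)) := by
  have hl := Real.log_two_lt_d9
  have key : ∀ u v : EuclideanSpace ℝ (Fin d), √d * dist u v * 2 ^ n ≤ z ^ 3 →
      (coneMeasure d).real (coneSlab ((2 : ℝ) ^ n)⁻¹ 1 u \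
        coneSlab ((2 : ℝ) ^ n)⁻¹ 1 v) ≤ 12 * n * z ^ 2 := fun u v huv => by
    have := coneMeasure_coneSlab_diff_le hd (by positivity) (inv_two_pow_le_one n) hz hz2
      (x := u) (y := v) (by rwa [div_inv_eq_mul])
    rw [one_div, inv_inv, Real.log_pow] at this
    have h2 : 0 ≤ (n : ℝ) * z ^ 2 := by positivity
    nlinarith
  have := (isNoise_extField hw).prob_sub_ge_le (n, x) (n, y) hτ (v := 24 * n * z ^ 2)
    (by linarith [key x y hxy, key y x (by rwa [dist_comm])])
  convert this using 3
  ring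

lemma prob_chain [IsFiniteMeasure P] (E : ℕ → Set Ω) (ε : ℕ → ℝ)
    (hE : ∀ L, P.real (E L \ E (L + 1)) ≤ ε L) (L : ℕ) :
    P.real (E 0) - ∑ i ∈ Finset.range L, ε i ≤ P.real (E L) := by
  induction L with
  | zero => simp
  | succ L ih =>
    rw [Finset.sum_range_succ]
    have h1 : P.real (E L) ≤ P.real (E L \ E (L + 1)) + P.real (E (L + 1)) :=
      (measureReal_mono (by intro x hx; by_cases h : x ∈ E (L + 1) <;> simp [h, hx])).trans
        (measureReal_union_le _ _)
    linarith [hE L]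

end Increments

/-- Curves of Hölder exponent `2/3`, quantified along the scales `4096 ^ j`. -/
def IsHolderCurve {E : Type*} [NormedAddCommGroup E] (γ : ℝ → E) : Prop :=
  ∀ (j : ℕ) (s t : ℝ), |s - t| ≤ ((4096 : ℝ) ^ j)⁻¹ → ‖γ s - γ t‖ ≤ 1000 * ((256 : ℝ) ^ j)⁻¹

/-- The `l`-th point of the level `k₀ + L` subdivision of the `k`-th level `k₀` interval. -/
noncomputable def gridTime (k : ℤ) (k₀ L l : ℕ) : ℝ :=
  (k * 4096 ^ L + l) / 4096 ^ (k₀ + L)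

section Cell

variable {d : ℕ} {Ω : Type} [MeasurableSpace Ω] {P : Measure Ω}
  {h : ℕ → EuclideanSpace ℝ (Fin d) → Ω → ℝ}

lemma abs_gridTime_sub_le (k : ℤ) (k₀ L l : ℕ) :
    |gridTime k k₀ (L + 1) l - gridTime k k₀ L (l / 4096)| ≤ ((4096 : ℝ) ^ (k₀ + L))⁻¹ := by
  have h1 : (l : ℝ) = 4096 * (l / 4096 : ℕ) + (l % 4096 : ℕ) := by
    exact_mod_cast (Nat.div_add_mod l 4096).symm
  have h2 : ((l % 4096 : ℕ) : ℝ) ≤ 4096 := by exact_mod_cast (Nat.mod_lt l (by norm_num)).le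
  have : gridTime k k₀ (L + 1) l - gridTime k k₀ L (l / 4096) =
      ((l % 4096 : ℕ) / 4096) * ((4096 : ℝ) ^ (k₀ + L))⁻¹ := by
    rw [gridTime, gridTime, h1, ← add_assoc k₀, pow_succ, pow_succ _ (k₀ + L)]
    field_simp
    ring
  rw [this, abs_of_nonneg (by positivity)]
  refine mul_le_of_le_one_left (by positivity) ?_
  rw [div_le_one (by norm_num)]
  exact h2

lemma prob_subcell_ge [IsProbabilityMeasure P] (hw : IsWhiteNoiseField d P h) (hd : 0 < d)
    {γ : ℝ → EuclideanSpace ℝ (Fin d)} (hγ : IsHolderCurve γ) {n m s : ℕ} (hn : 1 ≤ n)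
    (hnm : (2 : ℝ) ^ n ≤ 256 ^ (m + 1)) {z τ : ℝ} (hz : 0 < z) (hz2 : z ≤ 1 / 2)
    (hzs : 256000 * √d ≤ z ^ 3 * 256 ^ s) (k : ℤ) (L : ℕ) :
    (gaussianReal 0 (Real.log 2).toNNReal).real (Set.Ici (τ + 1)) -
      ∑ i ∈ Finset.range L, 4096 ^ (i + 1) * Real.exp (-(9 ^ i / (192 * z ^ 2))) ≤
    P.real {ω | ∀ l < 4096 ^ L, τ ≤ layerField h (n, γ (gridTime k (m + s) L l)) ω} := by
  set E : ℕ → Set Ω := fun L =>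
    {ω | ∀ l < 4096 ^ L, τ + (1 / 2) ^ L ≤ layerField h (n, γ (gridTime k (m + s) L l)) ω} with hE
  have h0 : P.real (E 0) = (gaussianReal 0 (Real.log 2).toNNReal).real (Set.Ici (τ + 1)) := by
    rw [← prob_layerField_ge hw hn (γ (gridTime k (m + s) 0 0))]
    simp [hE]
  rw [← h0]
  refine (prob_chain E _ (fun L => ?_) L).trans (measureReal_mono fun ω hω l hl => ?_)
  swap
  · have : (0 : ℝ) ≤ (1 / 2) ^ L := by positivity
    linarith [hω l hl]
  have hsub : E L \ E (L + 1) ⊆ ⋃ l ∈ Finset.range (4096 ^ (L + 1)),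
      {ω | (1 / 2 : ℝ) ^ (L + 1) ≤ layerField h (n, γ (gridTime k (m + s) L (l / 4096))) ω -
        layerField h (n, γ (gridTime k (m + s) (L + 1) l)) ω} := by
    rintro ω ⟨h1, h2⟩
    simp only [hE, Set.mem_ofPred_eq, not_forall, not_le] at h2
    obtain ⟨l, hl, h2⟩ := h2
    simp only [Set.mem_iUnion]
    refine ⟨l, Finset.mem_range.2 hl, ?_⟩
    have h3 := h1 (l / 4096) (Nat.div_lt_of_lt_mul (by rw [pow_succ] at hl; linarith))
    have e : (1 / 2 : ℝ) ^ L = 2 * (1 / 2) ^ (L + 1) := by rw [pow_succ]; ring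
    rw [Set.mem_ofPred_eq]
    linarith
  refine (measureReal_mono hsub (measure_ne_top _ _)).trans ((measureReal_biUnion_finset_le _ _).trans ?_)
  calc _ ≤ ∑ l ∈ Finset.range (4096 ^ (L + 1)), Real.exp (-(9 ^ L / (192 * z ^ 2))) := by
        refine Finset.sum_le_sum fun l _ => ?_
        have hb := hγ (m + s + L) _ _ (abs_gridTime_sub_le k (m + s) L l)
        rw [← dist_eq_norm, dist_comm] at hb
        have h6 : z * (1 / 6) ^ L ≤ z := mul_le_of_le_one_right hz.le (pow_le_one₀ (by norm_num) (by norm_num))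
        have hp := prob_layerField_sub_ge_le hw hd hn (z := z * (1 / 6) ^ L)
          (τ := (1 / 2) ^ (L + 1)) (by positivity) (by linarith) (by positivity)
          (x := γ (gridTime k (m + s) L (l / 4096))) (y := γ (gridTime k (m + s) (L + 1) l)) ?_
        · refine hp.trans (Real.exp_le_exp.2 (le_of_eq ?_))
          have : (9 : ℝ) ^ L = 36 ^ L / 4 ^ L := by rw [← div_pow]; norm_num
          rw [this, mul_pow, ← pow_mul, ← pow_mul, mul_comm L 2, mul_comm _ 2, pow_mul, pow_mul,
            pow_succ]
          norm_num
          rw [one_div_pow, one_div_pow]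
          field_simp
          norm_num
        · calc √d * dist _ _ * 2 ^ n ≤ √d * (1000 * ((256 : ℝ) ^ (m + s + L))⁻¹) * 256 ^ (m + 1) := by
                gcongr
            _ = (256000 * √d) * ((256 : ℝ) ^ s)⁻¹ * ((256 : ℝ) ^ L)⁻¹ := by
                rw [pow_add, pow_add, pow_succ]; field_simp; norm_num
            _ ≤ (z ^ 3 * 256 ^ s) * ((256 : ℝ) ^ s)⁻¹ * ((256 : ℝ) ^ L)⁻¹ := by gcongr
            _ = z ^ 3 * ((256 : ℝ) ^ L)⁻¹ := by field_simp
            _ ≤ z ^ 3 * ((216 : ℝ) ^ L)⁻¹ := by gcongr; norm_num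
            _ = _ := by
              rw [mul_pow, ← pow_mul, mul_comm L 3, pow_mul, ← inv_pow]; norm_num
    _ = _ := by rw [Finset.sum_const, Finset.card_range, nsmul_eq_mul]; push_cast; ring

lemma exists_sum_exp_le {ε : ℝ} (hε : 0 < ε) : ∃ z : ℝ, 0 < z ∧ z ≤ 1 / 2 ∧ ∀ L : ℕ,
    ∑ i ∈ Finset.range L, (4096 : ℝ) ^ (i + 1) * Real.exp (-(9 ^ i / (192 * z ^ 2))) ≤ ε := by
  have ht : Filter.Tendsto (fun z : ℝ => 1 / (192 * z ^ 2)) (nhdsWithin 0 (Set.Ioi 0)) Filter.atTop := by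
    simp only [one_div]
    refine Filter.Tendsto.inv_tendsto_nhdsGT_zero ?_
    refine tendsto_nhdsWithin_iff.2 ⟨?_, ?_⟩
    · have : Continuous fun z : ℝ => 192 * z ^ 2 := by fun_prop
      have h0 := (this.tendsto 0).mono_left (nhdsWithin_le_nhds (s := Set.Ioi 0))
      simpa using h0
    · filter_upwards [self_mem_nhdsWithin] with z hz
      have : (0 : ℝ) < z := hz
      rw [Set.mem_Ioi]
      positivity
  have he : Filter.Tendsto (fun c : ℝ => Real.exp (-c)) Filter.atTop (nhds 0) :=
    Real.tendsto_exp_neg_atTop_nhds_zero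
  have e1 := (ht.eventually (he.eventually_lt_const (show (0 : ℝ) < 1 / 8192 by norm_num)))
  have e2 := (ht.eventually (he.eventually_lt_const (show (0 : ℝ) < ε / 8192 by positivity)))
  have e3 : ∀ᶠ z : ℝ in nhdsWithin 0 (Set.Ioi 0), z ≤ 1 / 2 :=
    nhdsWithin_le_nhds (eventually_le_nhds (by norm_num))
  have e4 : ∀ᶠ z : ℝ in nhdsWithin 0 (Set.Ioi 0), 0 < z := self_mem_nhdsWithin
  obtain ⟨z, h1, h2, h3, h4⟩ := (e1.and (e2.and (e3.and e4))).exists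
  refine ⟨z, h4, h3, fun L => ?_⟩
  set q := Real.exp (-(1 / (192 * z ^ 2))) with hq
  have hq0 : 0 < q := Real.exp_pos _
  calc _ ≤ ∑ i ∈ Finset.range L, (4096 * q) * (1 / 2) ^ i := by
        refine Finset.sum_le_sum fun i _ => ?_
        have : Real.exp (-(9 ^ i / (192 * z ^ 2))) ≤ q * q ^ i := by
          rw [← pow_succ', hq, ← Real.exp_nat_mul, Real.exp_le_exp]
          have h9 : ((i + 1 : ℕ) : ℝ) ≤ 9 ^ i := by
            have := one_add_mul_le_pow (show (-2 : ℝ) ≤ 8 by norm_num) i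
            push_cast
            norm_num at this
            have : (0 : ℝ) ≤ i := by positivity
            linarith
          rw [mul_neg, neg_le_neg_iff, mul_one_div]
          gcongr
        calc _ ≤ (4096 : ℝ) ^ (i + 1) * (q * q ^ i) := by gcongr
          _ = 4096 * q * (4096 * q) ^ i := by rw [mul_pow, pow_succ]; ring
          _ ≤ _ := by gcongr; linarith
    _ = 4096 * q * ∑ i ∈ Finset.range L, (1 / 2 : ℝ) ^ i := by rw [Finset.mul_sum]
    _ ≤ 4096 * q * 2 := by
        gcongr
        exact sum_geometric_two_le L
    _ ≤ ε := by linarith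

end Cell

lemma IsNoise.pow_card_le_prob_above_biUnion {Ω Z I : Type} [MeasurableSpace Ω] [MeasurableSpace Z]
    {μ : Measure Z} {P : Measure Ω} {X : I → Ω → ℝ} {R : I → Set Z} (h : IsNoise μ P X R)
    [IsProbabilityMeasure P] (a : I → ℝ) {J : Type*} (F : Finset J) (S : J → Set I)
    (hS : ∀ j ∈ F, (S j).Finite) {q : ℝ} (hq : 0 ≤ q)
    (hq' : ∀ j ∈ F, q ≤ P.real (above X a (S j))) :
    q ^ F.card ≤ P.real (above X a (⋃ j ∈ F, S j)) := by
  classical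
  induction F using Finset.induction_on with
  | empty => simp [above]
  | insert j F hj ih =>
    rw [Finset.card_insert_of_notMem hj, pow_succ', Finset.set_biUnion_insert]
    refine le_trans ?_ (h.prob_above_mul_le a (hS j (Finset.mem_insert_self _ _))
      (F.finite_toSet.biUnion fun k hk => hS k (Finset.mem_insert_of_mem hk)))
    have h1 := hq' j (Finset.mem_insert_self _ _)
    have h2 := ih (fun k hk => hS k (Finset.mem_insert_of_mem hk))
      fun k hk => hq' k (Finset.mem_insert_of_mem hk)
    have : 0 ≤ q ^ F.card := by positivity
    gcongr

/-- The space-scale points visited by `γ` at the times of `T` in the `i`-th interval of level `m`. -/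
def cellSet {E : Type*} (γ : ℝ → E) (T : Set ℝ) (m : ℕ) (i : ℤ) : Set (ℕ × E) :=
  {p | 8 * m + 1 ≤ p.1 ∧ p.1 ≤ 8 * m + 8 ∧ ∃ t ∈ T, |4096 ^ m * t - i| ≤ 1 / 2 ∧ p.2 = γ t}

lemma cellSet_finite {E : Type*} (γ : ℝ → E) {T : Set ℝ} (hT : T.Finite) (m : ℕ) (i : ℤ) :
    (cellSet γ T m i).Finite := by
  refine ((Set.finite_Icc (8 * m + 1) (8 * m + 8)).prod (hT.image γ)).subset ?_
  rintro ⟨n, x⟩ ⟨h1, h2, t, ht, -, rfl⟩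
  exact ⟨⟨h1, h2⟩, t, ht, rfl⟩

section Cell

variable {d : ℕ} {Ω : Type} [MeasurableSpace Ω] {P : Measure Ω}
  {h : ℕ → EuclideanSpace ℝ (Fin d) → Ω → ℝ}

lemma prob_cell_ge [IsProbabilityMeasure P] (hw : IsWhiteNoiseField d P h) (hd : 0 < d)
    {γ : ℝ → EuclideanSpace ℝ (Fin d)} (hγ : IsHolderCurve γ) {s r : ℕ} {T : Set ℝ}
    (hT : ∀ t ∈ T, ∃ j : ℕ, t = j / 4096 ^ r) {z τ q : ℝ} (hz : 0 < z) (hz2 : z ≤ 1 / 2)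
    (hzs : 256000 * √d ≤ z ^ 3 * 256 ^ s) (hq : 0 ≤ q) (hq1 : q ≤ 1)
    (hzq : ∀ L : ℕ, q ≤ (gaussianReal 0 (Real.log 2).toNNReal).real (Set.Ici (τ + 1)) -
      ∑ i ∈ Finset.range L, 4096 ^ (i + 1) * Real.exp (-(9 ^ i / (192 * z ^ 2)))) (m : ℕ) (i : ℤ) :
    q ^ (24 * 4096 ^ s) ≤ P.real (IsNoise.above (layerField h) (fun _ => τ) (cellSet γ T m i)) := by
  set L := r - (m + s) with hL
  set K : Finset ℤ := Finset.Icc (i * 4096 ^ s - 4096 ^ s) (i * 4096 ^ s + 4096 ^ s) with hK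
  set F : Finset (ℕ × ℤ) := Finset.Icc (8 * m + 1) (8 * m + 8) ×ˢ K
  set S : ℕ × ℤ → Set (ℕ × EuclideanSpace ℝ (Fin d)) := fun p =>
    (fun l => (p.1, γ (gridTime p.2 (m + s) L l))) '' Set.Iio (4096 ^ L) with hS
  have hfin : ∀ p, (S p).Finite := fun p => (Set.finite_Iio _).image _
  have hge := (isNoise_layerField hw).pow_card_le_prob_above_biUnion (fun _ => τ) F S
    (fun p _ => hfin p) hq (fun p hp => by
      obtain ⟨hp1, hp2⟩ := Finset.mem_product.1 hp
      rw [Finset.mem_Icc] at hp1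
      refine (hzq L).trans ((prob_subcell_ge hw hd hγ (n := p.1) (m := m) (s := s)
        (by omega) ?_ hz hz2 hzs p.2 L).trans (measureReal_mono fun ω hω => ?_))
      · calc (2 : ℝ) ^ p.1 ≤ 2 ^ (8 * (m + 1)) := pow_le_pow_right₀ one_le_two (by omega)
          _ = _ := by rw [pow_mul]; norm_num
      · rintro _ ⟨l, hl, rfl⟩
        exact hω l hl)
  have hcard : F.card ≤ 24 * 4096 ^ s := by
    rw [Finset.card_product, Nat.card_Icc, hK, Int.card_Icc]
    have : (i * 4096 ^ s + 4096 ^ s + 1 - (i * 4096 ^ s - 4096 ^ s) : ℤ) =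
        ((2 * 4096 ^ s + 1 : ℕ) : ℤ) := by push_cast; ring
    rw [this, Int.toNat_natCast, show 8 * m + 8 + 1 - (8 * m + 1) = 8 by omega]
    have : 1 ≤ 4096 ^ s := Nat.one_le_pow _ _ (by norm_num)
    omega
  refine (pow_le_pow_of_le_one hq hq1 hcard).trans (hge.trans (measureReal_mono
    (IsNoise.above_anti _ ?_)))
  rintro ⟨n, x⟩ ⟨h1, h2, t, ht, hti, hx⟩
  obtain ⟨j, rfl⟩ := hT t ht
  simp only at h1 h2 hx
  subst hx
  simp only [Set.mem_iUnion]
  set k : ℤ := ⌊(4096 : ℝ) ^ (m + s) * (j / 4096 ^ r)⌋ with hk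
  refine ⟨(n, k), Finset.mem_product.2 ⟨Finset.mem_Icc.2 ⟨h1, h2⟩, ?_⟩, ?_⟩
  · rw [abs_le] at hti
    have h4 : (1 : ℝ) ≤ 4096 ^ s := one_le_pow₀ (by norm_num)
    have e : (4096 : ℝ) ^ (m + s) * (j / 4096 ^ r) - i * 4096 ^ s =
        4096 ^ s * (4096 ^ m * (j / 4096 ^ r) - i) := by rw [pow_add]; ring
    have h5 : (4096 : ℝ) ^ s * (-(1 / 2)) ≤ 4096 ^ s * (4096 ^ m * (j / 4096 ^ r) - i) := by
      gcongr; exact hti.1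
    have h6 : (4096 : ℝ) ^ s * (4096 ^ m * (j / 4096 ^ r) - i) ≤ 4096 ^ s * (1 / 2) := by
      gcongr; exact hti.2
    rw [hK, Finset.mem_Icc]
    constructor
    · rw [hk, Int.le_floor]; push_cast; linarith
    · have : (k : ℝ) ≤ ((i * 4096 ^ s + 4096 ^ s : ℤ) : ℝ) := by
        push_cast; exact (Int.floor_le _).trans (by linarith)
      exact_mod_cast this
  · have hfl : (4096 : ℝ) ^ (m + s) * (j / 4096 ^ r) * 4096 ^ L =
        (j * 4096 ^ (m + s - r) : ℕ) := by
      push_cast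
      have : (4096 : ℝ) ^ (m + s) * 4096 ^ L = 4096 ^ (m + s - r) * 4096 ^ r := by
        rw [← pow_add, ← pow_add]; congr 1; omega
      field_simp
      linear_combination (j : ℝ) * this
    set J := j * 4096 ^ (m + s - r)
    have hP : (0 : ℝ) < 4096 ^ L := by positivity
    have h7 : ((J / 4096 ^ L : ℕ) : ℝ) * 4096 ^ L + ((J % 4096 ^ L : ℕ) : ℝ) = J := by
      have := Nat.div_add_mod J (4096 ^ L)
      rw [mul_comm] at this
      exact_mod_cast this
    have h8 : ((J % 4096 ^ L : ℕ) : ℝ) < 4096 ^ L := by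
      exact_mod_cast Nat.mod_lt J (by positivity)
    have hkJ : k = ((J / 4096 ^ L : ℕ) : ℤ) := by
      rw [hk, Int.floor_eq_iff, Int.cast_natCast]
      constructor
      · refine le_of_mul_le_mul_right ?_ hP
        rw [hfl, ← h7]
        exact le_add_of_nonneg_right (Nat.cast_nonneg _)
      · refine lt_of_mul_lt_mul_right ?_ hP.le
        rw [hfl, ← h7]
        linarith
    refine ⟨J % 4096 ^ L, Nat.mod_lt _ (by positivity), ?_⟩
    have : gridTime k (m + s) L (J % 4096 ^ L) = j / 4096 ^ r := by
      rw [gridTime, hkJ, pow_add]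
      rw [Int.cast_natCast, h7, ← hfl, pow_add]
      field_simp
    simp only [this]

end Cell

lemma exists_scale {z c K : ℝ} (hz : 0 < z) (hz2 : z ≤ 1 / 2) (hc : 0 < c) (hK : 0 < K) :
    ∃ D : ℝ, ∀ d : ℕ, D ≤ d → ∃ s : ℕ, 256000 * √d ≤ z ^ 3 * 256 ^ s ∧
      K * Real.exp (c * 4096 ^ s) ≤ 2 ^ d := by
  set B := (256 * 256000 / z ^ 3) ^ 3 with hB
  set l := Real.log 2 with hl
  have hl0 : 0 < l := Real.log_pos one_lt_two
  refine ⟨max 1 (max ((4 * c ^ 2 * B / l ^ 2) ^ 2) (2 * |Real.log K| / l)), fun d hd => ?_⟩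
  have hd1 : (1 : ℝ) ≤ d := (le_max_left _ _).trans hd
  have hd2 : (4 * c ^ 2 * B / l ^ 2) ^ 2 ≤ d := ((le_max_left _ _).trans (le_max_right _ _)).trans hd
  have hd3 : 2 * |Real.log K| / l ≤ d := ((le_max_right _ _).trans (le_max_right _ _)).trans hd
  have hsq : (1 : ℝ) ≤ √d := Real.one_le_sqrt.2 hd1
  have hx : 1 ≤ 256000 * √d / z ^ 3 := by
    rw [one_le_div (by positivity)]
    have : z ^ 3 ≤ 1 := pow_le_one₀ hz.le (by linarith)
    linarith
  obtain ⟨n, hn1, hn2⟩ := exists_nat_pow_near hx (show (1 : ℝ) < 256 by norm_num)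
  refine ⟨n + 1, ?_, ?_⟩
  · rw [div_lt_iff₀ (by positivity)] at hn2
    linarith
  · set M : ℝ := 4096 ^ (n + 1) with hM
    have hM2 : M ^ 2 ≤ B * (d * √d) := by
      calc M ^ 2 = (256 * 256 ^ n) ^ 3 := by
            rw [hM, ← pow_succ', ← pow_mul, ← pow_mul, mul_comm _ 2, mul_comm _ 3, pow_mul, pow_mul]
            norm_num
        _ ≤ (256 * (256000 * √d / z ^ 3)) ^ 3 := by gcongr
        _ = B * (√d ^ 2 * √d) := by rw [hB]; ring
        _ = _ := by rw [Real.sq_sqrt (by positivity)]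
    have hs : 4 * c ^ 2 * B / l ^ 2 ≤ √d := Real.le_sqrt_of_sq_le hd2
    have h1 : c * M ≤ d * l / 2 := by
      refine abs_le_of_sq_le_sq' ?_ (by positivity) |>.2
      rw [div_le_iff₀ (by positivity)] at hs
      calc (c * M) ^ 2 = c ^ 2 * M ^ 2 := by ring
        _ ≤ c ^ 2 * (B * (d * √d)) := by gcongr
        _ = (4 * c ^ 2 * B) * (d * √d) / 4 := by ring
        _ ≤ (√d * l ^ 2) * (d * √d) / 4 := by gcongr
        _ = √d ^ 2 * d * l ^ 2 / 4 := by ring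
        _ = _ := by rw [Real.sq_sqrt (by positivity)]; ring
    have h2 : Real.log K ≤ d * l / 2 := by
      rw [div_le_iff₀ hl0] at hd3
      linarith [le_abs_self (Real.log K)]
    calc K * Real.exp (c * M) = Real.exp (Real.log K + c * M) := by rw [Real.exp_add, Real.exp_log hK]
      _ ≤ Real.exp (d * l) := Real.exp_le_exp.2 (by linarith)
      _ = 2 ^ d := by rw [mul_comm, hl, ← Real.rpow_def_of_pos two_pos, Real.rpow_natCast]

section Sup

variable {d : ℕ}

/-- The point of the dyadic lattice of mesh `2^{-j}` with integer coordinates `k`. -/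
noncomputable def dyadicPt (j : ℕ) (k : Fin d → ℤ) : EuclideanSpace ℝ (Fin d) :=
  WithLp.toLp 2 fun i => k i / 2 ^ j

lemma norm_le_sqrt_mul {x : EuclideanSpace ℝ (Fin d)} {c : ℝ} (hc : 0 ≤ c) (hx : ∀ i, |x i| ≤ c) :
    ‖x‖ ≤ √d * c := by
  rw [EuclideanSpace.norm_eq]
  refine (Real.sqrt_le_sqrt (Finset.sum_le_sum (g := fun _ => c ^ 2) fun i _ => ?_)).trans ?_
  · rw [Real.norm_eq_abs]; have := hx i; gcongr
  · simp [Real.sqrt_sq hc]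

lemma dist_dyadicPt_le (j : ℕ) (k : Fin d → ℤ) :
    dist (dyadicPt (j + 1) k) (dyadicPt j fun i => k i / 2) ≤ √d * ((2 : ℝ) ^ (j + 1))⁻¹ := by
  rw [dist_eq_norm]
  refine norm_le_sqrt_mul (by positivity) fun i => ?_
  have h1 : (k i : ℝ) = 2 * ((k i / 2 : ℤ) : ℝ) + ((k i % 2 : ℤ) : ℝ) := by
    exact_mod_cast (Int.mul_ediv_add_emod (k i) 2).symm
  have h2 : (dyadicPt (j + 1) k - dyadicPt j fun i => k i / 2) i =
      ((k i % 2 : ℤ) : ℝ) * ((2 : ℝ) ^ (j + 1))⁻¹ := by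
    simp only [dyadicPt, PiLp.sub_apply]
    rw [h1, pow_succ]
    field_simp
    ring
  have h3 : |((k i % 2 : ℤ) : ℝ)| ≤ 1 := by
    rcases Int.emod_two_eq_zero_or_one (k i) with h | h <;> simp [h]
  rw [h2, abs_mul, abs_of_pos (show (0 : ℝ) < ((2 : ℝ) ^ (j + 1))⁻¹ by positivity)]
  exact mul_le_of_le_one_left (by positivity) h3

/-- Integer coordinates of the dyadic points of mesh `2^{-j}` in `[-R, R]^d`. -/
noncomputable def dyadicBox (d R j : ℕ) : Finset (Fin d → ℤ) :=
  Fintype.piFinset fun _ => Finset.Icc (-(R * 2 ^ j : ℤ)) (R * 2 ^ j)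

lemma card_dyadicBox (R j : ℕ) : ((dyadicBox d R j).card : ℝ) ≤ (3 * (R + 1) * 2 ^ j) ^ d := by
  rw [dyadicBox, Fintype.card_piFinset_const, Int.card_Icc]
  have : ((R * 2 ^ j : ℤ) + 1 - -(R * 2 ^ j : ℤ)) = ((2 * R * 2 ^ j + 1 : ℕ) : ℤ) := by
    push_cast; ring
  rw [this, Int.toNat_natCast]
  push_cast
  have : (1 : ℝ) ≤ 2 ^ j := one_le_pow₀ one_le_two
  have hR : (0 : ℝ) ≤ R := Nat.cast_nonneg _
  gcongr
  nlinarith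

lemma div_two_mem_dyadicBox {R j : ℕ} {k : Fin d → ℤ} (hk : k ∈ dyadicBox d R (j + 1)) :
    (fun i => k i / 2) ∈ dyadicBox d R j := by
  simp only [dyadicBox, Fintype.mem_piFinset, Finset.mem_Icc, pow_succ, ← mul_assoc] at hk ⊢
  intro i
  have := hk i
  omega

lemma exists_dyadicPt_dist_le {R : ℕ} {x : EuclideanSpace ℝ (Fin d)} (hx : ‖x‖ ≤ R) (j : ℕ) :
    ∃ k ∈ dyadicBox d R j, dist (dyadicPt j k) x ≤ √d * ((2 : ℝ) ^ j)⁻¹ := by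
  refine ⟨fun i => ⌊x i * 2 ^ j⌋, ?_, ?_⟩
  · simp only [dyadicBox, Fintype.mem_piFinset, Finset.mem_Icc]
    intro i
    have h1 := abs_le.1 ((PiLp.norm_apply_le x i).trans hx)
    have h2 : (0 : ℝ) < 2 ^ j := by positivity
    constructor
    · rw [Int.le_floor]; push_cast; nlinarith
    · have : ((⌊x i * 2 ^ j⌋ : ℤ) : ℝ) ≤ ((R * 2 ^ j : ℤ) : ℝ) := by
        push_cast
        exact (Int.floor_le _).trans (by nlinarith)
      exact (Int.cast_le (R := ℝ)).1 this
  · rw [dist_eq_norm]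
    refine norm_le_sqrt_mul (by positivity) fun i => ?_
    have h2 : (0 : ℝ) < 2 ^ j := by positivity
    have h3 : (dyadicPt j (fun i => ⌊x i * 2 ^ j⌋) - x) i =
        (⌊x i * 2 ^ j⌋ - x i * 2 ^ j) * ((2 : ℝ) ^ j)⁻¹ := by
      simp only [dyadicPt, PiLp.sub_apply]
      field_simp
    rw [h3, abs_mul, abs_of_pos (show (0 : ℝ) < ((2 : ℝ) ^ j)⁻¹ by positivity)]
    refine mul_le_of_le_one_left (by positivity) ?_
    have := Int.floor_le (x i * 2 ^ j)
    have := Int.lt_floor_add_one (x i * 2 ^ j)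
    rw [abs_le]; constructor <;> linarith

lemma le_of_dyadic {f : EuclideanSpace ℝ (Fin d) → ℝ} (hf : Continuous f) {R j₀ : ℕ} {M : ℝ}
    (hM : 0 ≤ M) (h0 : ∀ k ∈ dyadicBox d R j₀, f (dyadicPt j₀ k) ≤ M)
    (hs : ∀ L, ∀ k ∈ dyadicBox d R (j₀ + L + 1), f (dyadicPt (j₀ + L + 1) k) ≤
      f (dyadicPt (j₀ + L) fun i => k i / 2) + M * (9 / 10) ^ L)
    {x : EuclideanSpace ℝ (Fin d)} (hx : ‖x‖ ≤ R) : f x ≤ 11 * M := by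
  have key : ∀ L, ∀ k ∈ dyadicBox d R (j₀ + L), f (dyadicPt (j₀ + L) k) ≤
      M + M * ∑ i ∈ Finset.range L, (9 / 10 : ℝ) ^ i := by
    intro L
    induction L with
    | zero => simpa using h0
    | succ L ih =>
      intro k hk
      have h1 := hs L k hk
      have h2 := ih _ (div_two_mem_dyadicBox hk)
      rw [Finset.sum_range_succ]
      rw [← add_assoc]
      linarith
  have key2 : ∀ L, ∀ k ∈ dyadicBox d R (j₀ + L), f (dyadicPt (j₀ + L) k) ≤ 11 * M := by
    intro L k hk
    refine (key L k hk).trans ?_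
    have := geom_sum_Ico_le_of_lt_one (m := 0) (n := L) (show (0 : ℝ) ≤ 9 / 10 by norm_num)
      (by norm_num)
    rw [← Finset.range_eq_Ico] at this
    norm_num at this
    nlinarith
  choose k hk hd using fun L => exists_dyadicPt_dist_le hx (j₀ + L)
  have hlim : Filter.Tendsto (fun L => dyadicPt (j₀ + L) (k L)) Filter.atTop (nhds x) := by
    rw [tendsto_iff_dist_tendsto_zero]
    refine squeeze_zero (fun _ => dist_nonneg) hd ?_
    rw [← mul_zero (√d)]
    refine Filter.Tendsto.const_mul _ (Filter.Tendsto.inv_tendsto_atTop ?_)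
    refine (tendsto_pow_atTop_atTop_of_one_lt one_lt_two).comp ?_
    exact Filter.tendsto_atTop_mono (fun n => Nat.le_add_left n j₀) Filter.tendsto_id
  exact le_of_tendsto ((hf.tendsto x).comp hlim) (Filter.Eventually.of_forall fun L =>
    key2 L _ (hk L))

variable {Ω : Type} [MeasurableSpace Ω] {P : Measure Ω}
  {h : ℕ → EuclideanSpace ℝ (Fin d) → Ω → ℝ}

lemma half_pow_summable (C : ℝ) :
    ∑' p : ℕ × ℕ, ENNReal.ofReal (C * ((1 / 2) ^ p.1 * (1 / 2) ^ p.2)) ≠ ⊤ := by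
  refine Summable.tsum_ofReal_ne_top (Summable.mul_left C ?_)
  exact Summable.mul_of_nonneg summable_geometric_two summable_geometric_two
    (fun _ => by positivity) fun _ => by positivity

lemma two_pow_mul_exp_le {M : ℝ} (hM : (d + 1 : ℕ) ≤ M ^ 2 / 96) (N : ℕ) :
    ((2 : ℝ) ^ d) ^ N * Real.exp (-(M ^ 2 / 96 * N)) ≤ (1 / 2) ^ N := by
  have h1 : Real.exp (-(M ^ 2 / 96 * N)) ≤ ((1 / 2) ^ (d + 1)) ^ N := by
    have h2 : Real.exp (-1) ≤ 1 / 2 := by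
      have := Real.exp_neg_one_lt_d9; linarith
    calc _ = Real.exp (-(M ^ 2 / 96)) ^ N := by rw [← Real.exp_nat_mul]; congr 1; ring
      _ ≤ Real.exp (-(d + 1 : ℕ)) ^ N := by gcongr
      _ = (Real.exp (-1) ^ (d + 1)) ^ N := by rw [← Real.exp_nat_mul _ (d + 1)]; congr 2; ring
      _ ≤ _ := by gcongr
  calc _ ≤ ((2 : ℝ) ^ d) ^ N * ((1 / 2) ^ (d + 1)) ^ N := by gcongr
    _ = _ := by
      rw [← mul_pow, pow_succ, ← mul_assoc, ← mul_pow]; norm_num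

lemma ae_eventually_le [IsProbabilityMeasure P] (hw : IsWhiteNoiseField d P h) (hd : 0 < d) (R : ℕ) :
    ∃ M : ℝ, ∀ᵐ ω ∂P, ∀ᶠ n : ℕ in Filter.atTop, ∀ x, ‖x‖ ≤ R → h n x ω ≤ M * n := by
  set M := √(96 * (d + 1 : ℕ)) with hM
  have hM2 : M ^ 2 = 96 * (d + 1 : ℕ) := Real.sq_sqrt (by positivity)
  have hM0 : 0 ≤ M := Real.sqrt_nonneg _
  have hM96 : ((d + 1 : ℕ) : ℝ) ≤ M ^ 2 / 96 := by rw [hM2]; linarith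
  set n₀ := d + 2 with hn₀
  set C : ℝ := (3 * (R + 1) * 2 ^ (n₀ + 1)) ^ d with hC
  have hC0 : 0 ≤ C := by positivity
  set A : ℕ × ℕ → Set Ω := fun p => ⋃ k ∈ dyadicBox d R (p.1 + 1 + n₀ + p.2 + 1),
    {ω | M * (p.1 + 1 : ℕ) * (9 / 10) ^ p.2 ≤
      extField h (p.1 + 1, dyadicPt (p.1 + 1 + n₀ + p.2 + 1) k) ω -
      extField h (p.1 + 1, dyadicPt (p.1 + 1 + n₀ + p.2) fun i => k i / 2) ω} with hA
  set B : ℕ → Set Ω := fun n => ⋃ k ∈ dyadicBox d R (n + 1 + n₀),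
    {ω | M * (n + 1 : ℕ) ≤ extField h (n + 1, dyadicPt (n + 1 + n₀) k) ω} with hB
  have hAle : ∀ p, P.real (A p) ≤ C * ((1 / 2) ^ p.1 * (1 / 2) ^ p.2) := by
    rintro ⟨n, L⟩
    have hz : (1 / 2 : ℝ) * (4 / 5) ^ L ≤ 1 / 2 :=
      mul_le_of_le_one_right (by norm_num) (pow_le_one₀ (by norm_num) (by norm_num))
    have hterm : ∀ k ∈ dyadicBox d R (n + 1 + n₀ + L + 1),
        P.real {ω | M * (n + 1 : ℕ) * (9 / 10) ^ L ≤
          extField h (n + 1, dyadicPt (n + 1 + n₀ + L + 1) k) ω -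
          extField h (n + 1, dyadicPt (n + 1 + n₀ + L) fun i => k i / 2) ω} ≤
        Real.exp (-(M ^ 2 / 96 * (n + 1 + L : ℕ))) := by
      intro k _
      refine (prob_extField_sub_ge_le hw hd (n + 1) (z := 1 / 2 * (4 / 5) ^ L) (by positivity) hz
        (by positivity) ?_).trans (Real.exp_le_exp.2 ?_)
      · have hd2 : (d : ℝ) ≤ 2 ^ d := by exact_mod_cast Nat.lt_two_pow_self.le
        calc √d * dist _ _ * 2 ^ (n + 1) ≤
            √d * (√d * ((2 : ℝ) ^ (n + 1 + n₀ + L + 1))⁻¹) * 2 ^ (n + 1) := by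
              gcongr
              exact dist_dyadicPt_le _ _
          _ = (√d * √d) * ((2 : ℝ) ^ d)⁻¹ * (1 / 8) * (1 / 2) ^ L := by
              rw [one_div_pow, hn₀]
              simp only [pow_add, pow_succ]
              field_simp
              norm_num
          _ = d * ((2 : ℝ) ^ d)⁻¹ * (1 / 8) * (1 / 2) ^ L := by
              rw [Real.mul_self_sqrt (Nat.cast_nonneg d)]
          _ ≤ 2 ^ d * ((2 : ℝ) ^ d)⁻¹ * (1 / 8) * (64 / 125) ^ L := by
              refine mul_le_mul ?_ (pow_le_pow_left₀ (by norm_num) (by norm_num) L)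
                (by positivity) (by positivity)
              gcongr
          _ = _ := by
              rw [mul_pow, ← pow_mul, mul_comm L 3, pow_mul, mul_inv_cancel₀ (by positivity)]
              norm_num
      · have e1 : (M * (n + 1 : ℕ) * (9 / 10 : ℝ) ^ L) ^ 2 =
            M ^ 2 * (n + 1 : ℕ) ^ 2 * (81 / 100) ^ L := by
          rw [mul_pow, mul_pow, ← pow_mul, mul_comm L 2, pow_mul]; norm_num
        have e2 : ((1 / 2 : ℝ) * (4 / 5) ^ L) ^ 2 = 1 / 4 * (16 / 25) ^ L := by
          rw [mul_pow, ← pow_mul, mul_comm L 2, pow_mul]; norm_num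
        rw [neg_div, neg_le_neg_iff, e1, e2, le_div_iff₀ (by positivity)]
        have h3 : (1 + (1 / 4 : ℝ) * L) * (16 / 25) ^ L ≤ (81 / 100) ^ L := by
          have := one_add_mul_le_pow (show (-2 : ℝ) ≤ 1 / 4 by norm_num) L
          calc _ ≤ (1 + 1 / 4 : ℝ) ^ L * (16 / 25) ^ L := by gcongr; linarith
            _ = (4 / 5 : ℝ) ^ L := by rw [← mul_pow]; norm_num
            _ ≤ _ := pow_le_pow_left₀ (by norm_num) (by norm_num) L
        have h4 : ((n + 1 + L : ℕ) : ℝ) ≤ 8 * ((n + 1 : ℕ) * (1 + 1 / 4 * L)) := by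
          push_cast
          have : (0 : ℝ) ≤ n := Nat.cast_nonneg _
          have : (0 : ℝ) ≤ L := Nat.cast_nonneg _
          nlinarith
        calc _ = M ^ 2 * (n + 1 : ℕ) * (1 / 8 * (n + 1 + L : ℕ) * (16 / 25) ^ L) := by ring
          _ ≤ M ^ 2 * (n + 1 : ℕ) * (1 / 8 * (8 * ((n + 1 : ℕ) * (1 + 1 / 4 * L))) * (16 / 25) ^ L) := by
              gcongr
          _ = M ^ 2 * (n + 1 : ℕ) * ((n + 1 : ℕ) * ((1 + 1 / 4 * L) * (16 / 25) ^ L)) := by ring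
          _ ≤ M ^ 2 * (n + 1 : ℕ) * ((n + 1 : ℕ) * (81 / 100) ^ L) := by gcongr
          _ = _ := by ring
    calc P.real (A (n, L)) ≤ ∑ k ∈ dyadicBox d R (n + 1 + n₀ + L + 1),
          Real.exp (-(M ^ 2 / 96 * (n + 1 + L : ℕ))) :=
          (measureReal_biUnion_finset_le _ _).trans (Finset.sum_le_sum hterm)
      _ = (dyadicBox d R (n + 1 + n₀ + L + 1)).card *
          Real.exp (-(M ^ 2 / 96 * (n + 1 + L : ℕ))) := by rw [Finset.sum_const, nsmul_eq_mul]
      _ ≤ (3 * (R + 1) * 2 ^ (n + 1 + n₀ + L + 1)) ^ d *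
          Real.exp (-(M ^ 2 / 96 * (n + 1 + L : ℕ))) := by gcongr; exact card_dyadicBox _ _
      _ = C * (((2 : ℝ) ^ d) ^ (n + 1 + L) * Real.exp (-(M ^ 2 / 96 * (n + 1 + L : ℕ)))) := by
          rw [hC, ← pow_mul, mul_comm d, pow_mul, ← mul_assoc, ← mul_pow]
          congr 2
          simp only [pow_add]; ring
      _ ≤ C * (1 / 2) ^ (n + 1 + L) := by gcongr; exact two_pow_mul_exp_le hM96 _
      _ ≤ C * ((1 / 2) ^ n * (1 / 2) ^ L) := by
          rw [← pow_add]
          gcongr C * ?_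
          exact pow_le_pow_of_le_one (by norm_num) (by norm_num) (by omega)
  have hBle : ∀ n, P.real (B n) ≤ C * ((1 / 2) ^ n) := by
    intro n
    have hterm : ∀ k ∈ dyadicBox d R (n + 1 + n₀),
        P.real {ω | M * (n + 1 : ℕ) ≤ extField h (n + 1, dyadicPt (n + 1 + n₀) k) ω} ≤
        Real.exp (-(M ^ 2 / 96 * (n + 1 : ℕ))) := by
      intro k _
      refine ((isNoise_extField hw).prob_ge_le (n + 1, _) (v := (n + 1 : ℕ)) (by positivity) ?_).trans
        (Real.exp_le_exp.2 ?_)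
      · rw [measureReal_def, coneMeasure_coneSlab (by positivity) (inv_two_pow_le_one _), one_div,
          inv_inv, Real.log_pow, ENNReal.toReal_ofReal (by positivity)]
        have := Real.log_two_lt_d9
        have h0 : (0 : ℝ) ≤ (n + 1 : ℕ) := Nat.cast_nonneg _
        nlinarith
      · rw [neg_div, neg_le_neg_iff, le_div_iff₀ (by positivity)]
        have : 0 ≤ M ^ 2 * ((n + 1 : ℕ) : ℝ) ^ 2 := by positivity
        nlinarith
    calc P.real (B n) ≤ ∑ k ∈ dyadicBox d R (n + 1 + n₀),
          Real.exp (-(M ^ 2 / 96 * (n + 1 : ℕ))) :=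
          (measureReal_biUnion_finset_le _ _).trans (Finset.sum_le_sum hterm)
      _ = (dyadicBox d R (n + 1 + n₀)).card *
          Real.exp (-(M ^ 2 / 96 * (n + 1 : ℕ))) := by rw [Finset.sum_const, nsmul_eq_mul]
      _ ≤ (3 * (R + 1) * 2 ^ (n + 1 + n₀ + 1)) ^ d *
          Real.exp (-(M ^ 2 / 96 * (n + 1 : ℕ))) := by
          gcongr
          refine (card_dyadicBox _ _).trans (pow_le_pow_left₀ (by positivity)
            (mul_le_mul_of_nonneg_left ?_ (by positivity)) _)
          exact pow_le_pow_right₀ one_le_two (by omega)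
      _ = C * (((2 : ℝ) ^ d) ^ (n + 1) * Real.exp (-(M ^ 2 / 96 * (n + 1 : ℕ)))) := by
          rw [hC, ← pow_mul, mul_comm d, pow_mul, ← mul_assoc, ← mul_pow]
          congr 2
          simp only [pow_add]; ring
      _ ≤ C * (1 / 2) ^ (n + 1) := by gcongr; exact two_pow_mul_exp_le hM96 _
      _ ≤ C * (1 / 2) ^ n := by
          gcongr C * ?_
          exact pow_le_pow_of_le_one (by norm_num) (by norm_num) (by omega)
  have hAae : ∀ᵐ ω ∂P, {p | ω ∈ A p}.Finite := by
    refine ae_finite_setOfPred_mem (ne_top_of_le_ne_top (half_pow_summable C)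
      (ENNReal.tsum_le_tsum fun p => ?_))
    rw [← ofReal_measureReal (measure_ne_top P (A p))]
    exact ENNReal.ofReal_le_ofReal (hAle p)
  have hBae : ∀ᵐ ω ∂P, {n | ω ∈ B n}.Finite := by
    refine ae_finite_setOfPred_mem (ne_top_of_le_ne_top
      (Summable.tsum_ofReal_ne_top (Summable.mul_left C summable_geometric_two))
      (ENNReal.tsum_le_tsum fun n => ?_))
    rw [← ofReal_measureReal (measure_ne_top P (B n))]
    exact ENNReal.ofReal_le_ofReal (hBle n)
  refine ⟨11 * M, ?_⟩
  filter_upwards [hAae, hBae] with ω h1 h2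
  have h3 : ∀ᶠ n in Filter.atTop, ∀ p, ω ∈ A p → p.1 < n := by
    obtain ⟨b, hb⟩ := (h1.image Prod.fst).bddAbove
    filter_upwards [Filter.eventually_gt_atTop b] with n hn p hp
    exact (hb ⟨p, hp, rfl⟩).trans_lt hn
  have h4 : ∀ᶠ n in Filter.atTop, ω ∉ B n := by
    obtain ⟨b, hb⟩ := h2.bddAbove
    filter_upwards [Filter.eventually_gt_atTop b] with n hn hp
    exact absurd (hb hp) (not_le.2 hn)
  obtain ⟨N, hN⟩ := Filter.eventually_atTop.1 (h3.and h4)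
  refine Filter.eventually_atTop.2 ⟨N + 1, fun n hn x hx => ?_⟩
  obtain ⟨n, rfl⟩ : ∃ n', n = n' + 1 := ⟨n - 1, by omega⟩
  obtain ⟨h5, h6⟩ := hN n (by omega)
  have hext : ∀ y, extField h (n + 1, y) ω = h (n + 1) y ω := fun y => by simp [extField]
  rw [mul_assoc]
  refine le_of_dyadic (hw.2.2 ω (n + 1)) (j₀ := n + 1 + n₀) (M := M * (n + 1 : ℕ)) (by positivity)
    (fun k hk => ?_) (fun L k hk => ?_) hx
  · rw [← hext]
    by_contra! hlt
    exact h6 (Set.mem_biUnion hk hlt.le)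
  · rw [← hext, ← hext, ← sub_le_iff_le_add']
    by_contra! hlt
    exact absurd (h5 (n, L) (Set.mem_biUnion hk hlt.le)) (lt_irrefl _)

end Sup

section Averaging

variable {ι S : Type*} [Fintype ι] [DecidableEq ι] [Fintype S]

lemma card_mul_sum_eq_sum_sum_update (i : ι) (f : (ι → S) → ℝ) :
    (Fintype.card S : ℝ) * ∑ U, f U = ∑ U, ∑ u, f (Function.update U i u) := by
  classical
  have h1 : ∀ U : ι → S, ∑ u, f (Function.update U i u) =
      ∑ V, if ∀ j, j ≠ i → V j = U j then f V else 0 := by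
    intro U
    rw [← Finset.sum_filter]
    refine Finset.sum_bij (fun u _ => Function.update U i u) ?_ ?_ ?_ ?_
    · intro u _
      simp +contextual [Function.update_of_ne]
    · intro u _ v _ huv
      simpa using congrFun huv i
    · intro V hV
      refine ⟨V i, Finset.mem_univ _, ?_⟩
      ext1 j
      by_cases hj : j = i
      · subst hj; simp
      · simp only [Finset.mem_filter] at hV
        rw [Function.update_of_ne hj, hV.2 j hj]
    · intros; rfl
  have h2 : ∀ V : ι → S, (∑ U : ι → S, if ∀ j, j ≠ i → V j = U j then (1 : ℝ) else 0) =
      Fintype.card S := by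
    intro V
    rw [← Finset.sum_filter, Finset.sum_const, nsmul_eq_mul, mul_one, ← Finset.card_univ (α := S)]
    congr 1
    refine (Finset.card_bij (fun u _ => Function.update V i u) ?_ ?_ ?_).symm
    · intro u _
      simp +contextual [Function.update_of_ne]
    · intro u _ v _ huv
      simpa using congrFun huv i
    · intro U hU
      refine ⟨U i, Finset.mem_univ _, ?_⟩
      ext1 j
      by_cases hj : j = i
      · subst hj; simp
      · simp only [Finset.mem_filter] at hU
        rw [Function.update_of_ne hj, hU.2 j hj]
  simp_rw [h1]
  rw [Finset.sum_comm, Finset.mul_sum]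
  refine Finset.sum_congr rfl fun V _ => ?_
  rw [← h2 V, Finset.sum_mul]
  refine Finset.sum_congr rfl fun U _ => ?_
  split_ifs <;> simp

/-- Integrating out independent coordinates one at a time. -/
lemma sum_mul_prod_le [Nonempty S] (J : Finset ι) (F G : ι → (ι → S) → ℝ) (hF : ∀ i U, 0 ≤ F i U)
    (hG : ∀ i U, 0 ≤ G i U)
    (hFinv : ∀ i ∈ J, ∀ j ∈ J, i ≠ j → ∀ U u, F i (Function.update U j u) = F i U)
    (hGinv : ∀ i ∈ J, ∀ j ∈ J, ∀ U u, G i (Function.update U j u) = G i U)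
    (hFG : ∀ i ∈ J, ∀ U, ∑ u, F i (Function.update U i u) ≤ Fintype.card S * G i U)
    (W : (ι → S) → ℝ) (hW : ∀ U, 0 ≤ W U)
    (hWinv : ∀ j ∈ J, ∀ U u, W (Function.update U j u) = W U) :
    ∑ U, W U * ∏ i ∈ J, F i U ≤ ∑ U, W U * ∏ i ∈ J, G i U := by
  induction J using Finset.induction_on generalizing W with
  | empty => simp
  | insert j J hj ih =>
    have hcard : (0 : ℝ) < Fintype.card S := by exact_mod_cast Fintype.card_pos
    have h1 : ∑ U, W U * ∏ i ∈ insert j J, F i U ≤ ∑ U, (W U * G j U) * ∏ i ∈ J, F i U := by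
      refine le_of_mul_le_mul_left ?_ hcard
      rw [card_mul_sum_eq_sum_sum_update j, Finset.mul_sum]
      refine Finset.sum_le_sum fun U _ => ?_
      have h2 : ∀ u, W (Function.update U j u) * ∏ i ∈ insert j J, F i (Function.update U j u) =
          (W U * ∏ i ∈ J, F i U) * F j (Function.update U j u) := by
        intro u
        rw [Finset.prod_insert hj, hWinv j (Finset.mem_insert_self _ _),
          Finset.prod_congr rfl fun i hi => hFinv i (Finset.mem_insert_of_mem hi) j
            (Finset.mem_insert_self _ _) (by rintro rfl; exact hj hi) U u]
        ring
      simp_rw [h2]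
      rw [← Finset.mul_sum]
      calc _ ≤ (W U * ∏ i ∈ J, F i U) * (Fintype.card S * G j U) :=
            mul_le_mul_of_nonneg_left (hFG j (Finset.mem_insert_self _ _) U)
              (mul_nonneg (hW U) (Finset.prod_nonneg fun i _ => hF i U))
        _ = _ := by ring
    refine h1.trans ((ih (fun i hi k hk => hFinv i (Finset.mem_insert_of_mem hi) k
      (Finset.mem_insert_of_mem hk)) (fun i hi k hk => hGinv i (Finset.mem_insert_of_mem hi) k
      (Finset.mem_insert_of_mem hk)) (fun i hi => hFG i (Finset.mem_insert_of_mem hi))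
      (fun U => W U * G j U) (fun U => mul_nonneg (hW U) (hG j U)) ?_).trans_eq ?_)
    · intro k hk U u
      rw [hWinv k (Finset.mem_insert_of_mem hk), hGinv j (Finset.mem_insert_self _ _) k
        (Finset.mem_insert_of_mem hk)]
    · refine Finset.sum_congr rfl fun U _ => ?_
      rw [Finset.prod_insert hj, mul_assoc]

open Classical in
/-- Exponential moment of the number of events among those attached to `J`, when the events attached
to each of the two classes of `J` are conditionally independent and rare. -/
lemma sum_mul_pow_card_le [Nonempty S] (J : Finset ι) (c : ι → Prop) (A B : ι → (ι → S) → Prop)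
    {ρ x : ℝ} (hx : 1 ≤ x) (hρ : 0 ≤ ρ) (hAB : ∀ i ∈ J, ∀ U, A i U → B i U)
    (hAinv : ∀ i ∈ J, ∀ j ∈ J, i ≠ j → (c i ↔ c j) → ∀ U u, A i (Function.update U j u) ↔ A i U)
    (hBinv : ∀ i ∈ J, ∀ j ∈ J, ∀ U u, B i (Function.update U j u) ↔ B i U)
    (hcard : ∀ i ∈ J, ∀ U, ((Finset.univ.filter fun u => A i (Function.update U i u)).card : ℝ) ≤
      ρ * Fintype.card S)
    (W : (ι → S) → ℝ) (hW : ∀ U, 0 ≤ W U)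
    (hWinv : ∀ j ∈ J, ∀ U u, W (Function.update U j u) = W U) :
    ∑ U, W U * x ^ (J.filter fun i => A i U).card ≤
      ∑ U, W U * (1 + ρ * (x ^ 2 - 1)) ^ (J.filter fun i => B i U).card := by
  have hx2 : 0 ≤ x ^ 2 - 1 := by nlinarith
  set z := 1 + ρ * (x ^ 2 - 1) with hz
  have hz1 : 1 ≤ z := by have := mul_nonneg hρ hx2; linarith
  have hp : ∀ (y : ℝ) (K : Finset ι) (Q : ι → Prop),
      y ^ (K.filter Q).card = ∏ i ∈ K, if Q i then y else 1 := by
    intro y K Q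
    rw [Finset.prod_ite]; simp
  have hclass : ∀ K ⊆ J, (∀ i ∈ K, ∀ j ∈ K, c i ↔ c j) →
      ∑ U, W U * ∏ i ∈ K, (if A i U then x ^ 2 else 1) ≤
        ∑ U, W U * ∏ i ∈ K, (if B i U then z else 1) := by
    intro K hK hcK
    refine sum_mul_prod_le K (fun i U => if A i U then x ^ 2 else 1)
      (fun i U => if B i U then z else 1) (fun i U => by split_ifs <;> positivity)
      (fun i U => by split_ifs <;> linarith) (fun i hi j hj hij U u => ?_)
      (fun i hi j hj U u => ?_) (fun i hi U => ?_) W hW fun j hj => hWinv j (hK hj)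
    · simp only [hAinv i (hK hi) j (hK hj) hij (hcK i hi j hj) U u]
    · simp only [hBinv i (hK hi) j (hK hj) U u]
    · by_cases hb : B i U
      · rw [if_pos hb]
        have h1 : ∀ u : S, (if A i (Function.update U i u) then x ^ 2 else 1) =
            1 + (x ^ 2 - 1) * if A i (Function.update U i u) then (1 : ℝ) else 0 := by
          intro u; split_ifs <;> ring
        simp_rw [h1]
        rw [Finset.sum_add_distrib, ← Finset.mul_sum, Finset.sum_boole]
        have := mul_le_mul_of_nonneg_left (hcard i (hK hi) U) hx2
        simp only [Finset.sum_const, nsmul_eq_mul, mul_one, Finset.card_univ]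
        rw [hz]
        linarith
      · have : ∀ u, ¬ A i (Function.update U i u) := fun u hu =>
          hb ((hBinv i (hK hi) i (hK hi) U u).1 (hAB i (hK hi) _ hu))
        simp [this, hb]
  have hsplit : ∀ (f : ι → ℝ), ∏ i ∈ J, f i =
      (∏ i ∈ J.filter c, f i) * ∏ i ∈ J.filter fun i => ¬ c i, f i := fun f =>
    (Finset.prod_filter_mul_prod_filter_not J c f).symm
  have h0 := hclass (J.filter c) (Finset.filter_subset _ _) (fun i hi j hj => by
    simp only [Finset.mem_filter] at hi hj; tauto)
  have h1 := hclass (J.filter fun i => ¬ c i) (Finset.filter_subset _ _) (fun i hi j hj => by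
    simp only [Finset.mem_filter] at hi hj; tauto)
  simp only [hp]
  have hone : ∀ (K : Finset ι) U, 1 ≤ ∏ i ∈ K, (if B i U then z else 1) := fun K U =>
    Finset.one_le_prod fun i _ => by split_ifs <;> linarith
  calc ∑ U, W U * ∏ i ∈ J, (if A i U then x else 1)
      ≤ ∑ U, (1 / 2 * (W U * ∏ i ∈ J.filter c, (if A i U then x ^ 2 else 1)) +
        1 / 2 * (W U * ∏ i ∈ J.filter fun i => ¬ c i, (if A i U then x ^ 2 else 1))) := by
        refine Finset.sum_le_sum fun U _ => ?_
        rw [hsplit]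
        have hsq : ∀ K : Finset ι, ∏ i ∈ K, (if A i U then x ^ 2 else 1) =
            (∏ i ∈ K, (if A i U then x else 1)) ^ 2 := by
          intro K
          rw [← Finset.prod_pow]
          refine Finset.prod_congr rfl fun i _ => ?_
          split_ifs <;> simp
        rw [hsq, hsq]
        set p := ∏ i ∈ J.filter c, (if A i U then x else 1)
        set q := ∏ i ∈ J.filter fun i => ¬ c i, (if A i U then x else 1)
        have := mul_nonneg (hW U) (sq_nonneg (p - q))
        linarith [show W U * (p - q) ^ 2 = W U * p ^ 2 + W U * q ^ 2 - 2 * (W U * (p * q)) by ring]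
    _ ≤ 1 / 2 * ∑ U, W U * ∏ i ∈ J.filter c, (if B i U then z else 1) +
        1 / 2 * ∑ U, W U * ∏ i ∈ J.filter fun i => ¬ c i, (if B i U then z else 1) := by
        rw [Finset.sum_add_distrib, ← Finset.mul_sum, ← Finset.mul_sum]
        linarith
    _ = ∑ U, (1 / 2 * (W U * ∏ i ∈ J.filter c, (if B i U then z else 1)) +
        1 / 2 * (W U * ∏ i ∈ J.filter fun i => ¬ c i, (if B i U then z else 1))) := by
        rw [Finset.sum_add_distrib, ← Finset.mul_sum, ← Finset.mul_sum]
    _ ≤ _ := by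
        refine Finset.sum_le_sum fun U _ => ?_
        rw [hsplit]
        have h2 := hone (J.filter c) U
        have h3 := hone (J.filter fun i => ¬ c i) U
        set p := ∏ i ∈ J.filter c, (if B i U then z else 1)
        set q := ∏ i ∈ J.filter fun i => ¬ c i, (if B i U then z else 1)
        have h4 : 1 / 2 * p + 1 / 2 * q ≤ p * q := by nlinarith
        have := mul_le_mul_of_nonneg_left h4 (hW U)
        linarith

end Averaging

lemma exists_separated_finset (n : ℕ) : ∃ S : Finset (EuclideanSpace ℝ (Fin n)),
    (∀ x ∈ S, ‖x‖ ≤ 64) ∧ (∀ x ∈ S, ∀ y ∈ S, x ≠ y → 32 < dist x y) ∧ 2 ^ n ≤ S.card := by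
  set A : Set (EuclideanSpace ℝ (Fin n)) := Metric.closedBall 0 64 with hA
  have htop : Metric.packingNumber (32 : NNReal) A ≠ ⊤ := by
    obtain ⟨N, -, hN, hcov⟩ := Metric.exists_finite_isCover_of_isCompact (X := EuclideanSpace ℝ (Fin n))
      (ε := 16) (s := A) (by norm_num) (isCompact_closedBall _ _)
    have h1 := Metric.packingNumber_two_mul_le_externalCoveringNumber (16 : NNReal) A
    have h2 : Metric.externalCoveringNumber (16 : NNReal) A ≤ N.encard :=
      iInf₂_le N hcov
    have h3 : (2 * 16 : NNReal) = 32 := by norm_num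
    rw [h3] at h1
    exact ne_top_of_le_ne_top (Set.encard_ne_top_iff.2 hN) (h1.trans h2)
  have hfin : (Metric.maximalSeparatedSet (32 : NNReal) A).Finite := by
    rw [← Set.encard_ne_top_iff, Metric.encard_maximalSeparatedSet htop]; exact htop
  have hmem : ∀ x, x ∈ hfin.toFinset ↔ x ∈ Metric.maximalSeparatedSet (32 : NNReal) A := by simp
  refine ⟨hfin.toFinset, fun x hx => ?_, fun x hx y hy hxy => ?_, ?_⟩
  · simpa [hA] using Metric.maximalSeparatedSet_subset ((hmem x).1 hx)
  · have h1 : ((32 : NNReal) : ENNReal) < edist x y :=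
      Metric.isSeparated_maximalSeparatedSet ((hmem x).1 hx) ((hmem y).1 hy) hxy
    rw [edist_nndist, ENNReal.coe_lt_coe] at h1
    rw [← coe_nndist]
    exact_mod_cast h1
  · have hcov := (Metric.isCover_maximalSeparatedSet htop).subset_iUnion_closedBall
    set v := (volume (Metric.ball (0 : EuclideanSpace ℝ (Fin n)) 1)).toReal with hv
    have hvpos : 0 < v := ENNReal.toReal_pos (Metric.measure_ball_pos volume _ one_pos).ne'
      measure_ball_lt_top.ne
    have hball : ∀ (x : EuclideanSpace ℝ (Fin n)) (r : ℝ), 0 ≤ r →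
        volume.real (Metric.closedBall x r) = r ^ n * v := by
      intro x r hr
      rw [measureReal_def, Measure.addHaar_closedBall volume x hr, ENNReal.toReal_mul,
        ENNReal.toReal_ofReal (by positivity), finrank_euclideanSpace_fin]
    have h1 : volume.real A ≤ ∑ x ∈ hfin.toFinset, volume.real (Metric.closedBall x 32) := by
      refine le_trans (measureReal_mono ?_ ?_) (measureReal_biUnion_finset_le _ _)
      · intro x hx
        simpa using hcov hx
      · refine ne_top_of_le_ne_top ?_ (measure_biUnion_finset_le _ _)
        exact ENNReal.sum_ne_top.2 fun x _ => measure_closedBall_lt_top.ne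
    simp only [hA, hball _ _ (show (0 : ℝ) ≤ 64 by norm_num),
      hball _ _ (show (0 : ℝ) ≤ 32 by norm_num), Finset.sum_const, nsmul_eq_mul] at h1
    have h2 : (64 : ℝ) ^ n = 2 ^ n * 32 ^ n := by rw [← mul_pow]; norm_num
    rw [h2] at h1
    have h3 : (0 : ℝ) < 32 ^ n * v := by positivity
    have h4 : (2 : ℝ) ^ n ≤ (hfin.toFinset.card : ℝ) := by
      refine le_of_mul_le_mul_right ?_ h3
      linarith
    exact_mod_cast h4

/-- A product of a Euclidean space with two complex planes embeds in Euclidean space. -/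
lemma exists_splitting (n : ℕ) :
    ∃ L : EuclideanSpace ℝ (Fin n) × ℂ × ℂ →ₗ[ℝ] EuclideanSpace ℝ (Fin (n + 4)),
      ∀ p, ‖L p‖ ^ 2 = ‖p.1‖ ^ 2 + ‖p.2.1‖ ^ 2 + ‖p.2.2‖ ^ 2 := by
  refine ⟨{ toFun := fun p => WithLp.toLp 2
              (Fin.append (p.1 : Fin n → ℝ) ![p.2.1.re, p.2.1.im, p.2.2.re, p.2.2.im])
            map_add' := ?_
            map_smul' := ?_ }, ?_⟩
  · intro p q
    ext i
    refine Fin.addCases (fun j => ?_) (fun j => ?_) i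
    · simp
    · fin_cases j <;> simp
  · intro c p
    ext i
    refine Fin.addCases (fun j => ?_) (fun j => ?_) i
    · simp
    · fin_cases j <;> simp
  · intro p
    rw [EuclideanSpace.norm_sq_eq, EuclideanSpace.norm_sq_eq, Fin.sum_univ_add]
    simp only [LinearMap.coe_mk, AddHom.coe_mk, Fin.append_left, Fin.append_right,
      Fin.sum_univ_four, Complex.sq_norm, Complex.normSq_apply, Real.norm_eq_abs, sq_abs]
    simp
    ring

section Interp

variable {F : Type*} [NormedAddCommGroup F] [NormedSpace ℝ F]

/-- Piecewise linear interpolation of a sequence of points. -/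
noncomputable def interp (V : ℤ → F) (u : ℝ) : F :=
  (1 - Int.fract u) • V ⌊u⌋ + Int.fract u • V (⌊u⌋ + 1)

lemma interp_eq (V : ℤ → F) {i : ℤ} {u : ℝ} (h1 : i ≤ u) (h2 : u ≤ i + 1) :
    interp V u = (1 - (u - i)) • V i + (u - i) • V (i + 1) := by
  rcases h2.lt_or_eq with h2 | rfl
  · have : ⌊u⌋ = i := Int.floor_eq_iff.2 ⟨h1, h2⟩
    rw [interp, Int.fract, this]
  · have : ⌊(i : ℝ) + 1⌋ = i + 1 := by simp
    rw [interp, Int.fract, this]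
    simp

lemma norm_interp_le {V : ℤ → F} {A : ℝ} (hV : ∀ i, ‖V i‖ ≤ A) (u : ℝ) : ‖interp V u‖ ≤ A := by
  have h0 := Int.fract_nonneg u
  have h1 := (Int.fract_lt_one u).le
  refine (norm_add_le _ _).trans ?_
  rw [norm_smul, norm_smul, Real.norm_of_nonneg h0, Real.norm_of_nonneg (sub_nonneg.2 h1)]
  have := mul_le_mul_of_nonneg_left (hV ⌊u⌋) (sub_nonneg.2 h1)
  have := mul_le_mul_of_nonneg_left (hV (⌊u⌋ + 1)) h0
  linarith

lemma interp_zero {V : ℤ → F} (hV : V 0 = 0) : interp V 0 = 0 := by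
  simp [interp, hV]

lemma norm_interp_sub_le {V : ℤ → F} {A : ℝ} (hV : ∀ i, ‖V i‖ ≤ A) (u v : ℝ) :
    ‖interp V u - interp V v‖ ≤ 2 * A * |u - v| := by
  wlog huv : u ≤ v generalizing u v
  · rw [norm_sub_rev, abs_sub_comm]; exact this v u (not_le.1 huv).le
  have hA : 0 ≤ A := (norm_nonneg _).trans (hV 0)
  have hcell : ∀ (i : ℤ) (x y : ℝ), i ≤ x → x ≤ i + 1 → i ≤ y → y ≤ i + 1 →
      ‖interp V x - interp V y‖ ≤ 2 * A * |x - y| := by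
    intro i x y h1 h2 h3 h4
    rw [interp_eq V h1 h2, interp_eq V h3 h4]
    have : (1 - (x - i)) • V i + (x - i) • V (i + 1) - ((1 - (y - i)) • V i + (y - i) • V (i + 1)) =
        (x - y) • (V (i + 1) - V i) := by module
    rw [this, norm_smul, Real.norm_eq_abs, mul_comm]
    gcongr
    exact (norm_sub_le _ _).trans (by linarith [hV i, hV (i + 1)])
  rcases le_or_gt v (⌊u⌋ + 1) with h | h
  · exact hcell ⌊u⌋ u v (Int.floor_le u) (Int.lt_floor_add_one u).le ((Int.floor_le u).trans huv) h
  · rcases le_or_gt v (⌊u⌋ + 2) with h' | h'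
    · have e1 := hcell ⌊u⌋ u (⌊u⌋ + 1) (Int.floor_le u) (Int.lt_floor_add_one u).le
        (by linarith) le_rfl
      have e2 := hcell (⌊u⌋ + 1) (⌊u⌋ + 1) v (by push_cast; linarith) (by push_cast; linarith)
        (by push_cast; linarith) (by push_cast; linarith)
      have hu := Int.lt_floor_add_one u
      rw [abs_of_nonpos (by linarith)] at e1 e2 ⊢
      calc _ ≤ ‖interp V u - interp V (⌊u⌋ + 1)‖ + ‖interp V (⌊u⌋ + 1) - interp V v‖ :=
            norm_sub_le_norm_sub_add_norm_sub _ _ _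
        _ ≤ _ := by linarith
    · have hu := Int.lt_floor_add_one u
      rw [abs_of_nonpos (by linarith)]
      calc _ ≤ ‖interp V u‖ + ‖interp V v‖ := norm_sub_le _ _
        _ ≤ 2 * A * 1 := by linarith [norm_interp_le hV u, norm_interp_le hV v]
        _ ≤ _ := by gcongr; linarith

lemma interp_update_sub (V : ℤ → F) {i : ℤ} {u : ℝ} (hu : |u - i| ≤ 1 / 2) (x y : F) :
    interp (Function.update V i x) u - interp (Function.update V i y) u =
      (1 - |u - i|) • (x - y) := by
  obtain ⟨h1, h2⟩ := abs_le.1 hu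
  rcases le_total (i : ℝ) u with h | h
  · rw [interp_eq _ h (by linarith), interp_eq _ h (by linarith), abs_of_nonneg (by linarith)]
    simp only [Function.update_self, Function.update_of_ne (show i + 1 ≠ i by omega)]
    module
  · have e1 : ((i - 1 : ℤ) : ℝ) ≤ u := by push_cast; linarith
    have e2 : u ≤ ((i - 1 : ℤ) : ℝ) + 1 := by push_cast; linarith
    rw [interp_eq _ e1 e2, interp_eq _ e1 e2, abs_of_nonpos (by linarith)]
    simp only [sub_add_cancel, Function.update_self, Function.update_of_ne (show i - 1 ≠ i by omega)]
    push_cast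
    module

lemma interp_congr {V V' : ℤ → F} {i : ℤ} {u : ℝ} (hu : |u - i| ≤ 1 / 2)
    (hV : ∀ j, |j - i| ≤ 1 → V j = V' j) : interp V u = interp V' u := by
  obtain ⟨h1, h2⟩ := abs_le.1 hu
  rcases le_total (i : ℝ) u with h | h
  · rw [interp_eq _ h (by linarith), interp_eq _ h (by linarith), hV i (by simp),
      hV (i + 1) (by simp)]
  · have e1 : ((i - 1 : ℤ) : ℝ) ≤ u := by push_cast; linarith
    have e2 : u ≤ ((i - 1 : ℤ) : ℝ) + 1 := by push_cast; linarith
    rw [interp_eq _ e1 e2, interp_eq _ e1 e2, hV (i - 1) (by simp), sub_add_cancel,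
      hV i (by simp)]

end Interp

lemma sum_pow_le_of_injOn {κ : Type*} (s : Finset κ) (f : κ → ℕ) (hf : Set.InjOn f s) {θ : ℝ}
    (h0 : 0 ≤ θ) (h1 : θ < 1) : ∑ k ∈ s, θ ^ f k ≤ (1 - θ)⁻¹ := by
  rw [← Finset.sum_image (f := fun n => θ ^ n) hf, ← tsum_geometric_of_lt_one h0 h1]
  exact (summable_geometric_of_lt_one h0 h1).sum_le_tsum _ fun _ _ => by positivity

section LevelSum

variable {G : Type*} [NormedAddCommGroup G] [NormedSpace ℝ G]

/-- Superposition of curves `f k`, at the scales `256^{-k}` in space and `4096^{-k}` in time. -/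
noncomputable def levelSum (f : ℤ → ℝ → G) (s : Finset ℤ) (t : ℝ) : G :=
  ∑ k ∈ s, (256 : ℝ) ^ (-k) • f k (4096 ^ k * t)

lemma levelSum_sub (f : ℤ → ℝ → G) (s : Finset ℤ) (x y : ℝ) :
    levelSum f s x - levelSum f s y =
      ∑ k ∈ s, (256 : ℝ) ^ (-k) • (f k (4096 ^ k * x) - f k (4096 ^ k * y)) := by
  simp only [levelSum, smul_sub, Finset.sum_sub_distrib]

lemma levelSum_eq_add (f : ℤ → ℝ → G) (s : Finset ℤ) (p : ℤ → Prop) [DecidablePred p] (t : ℝ) :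
    levelSum f s t = levelSum f (s.filter p) t + levelSum f (s.filter fun k => ¬ p k) t :=
  (Finset.sum_filter_add_sum_filter_not s p _).symm

lemma levelSum_sub_eq_add (f : ℤ → ℝ → G) (s : Finset ℤ) (p : ℤ → Prop) [DecidablePred p]
    (x y : ℝ) : levelSum f s x - levelSum f s y =
      (levelSum f (s.filter p) x - levelSum f (s.filter p) y) +
      (levelSum f (s.filter fun k => ¬ p k) x - levelSum f (s.filter fun k => ¬ p k) y) := by
  rw [levelSum_eq_add f s p x, levelSum_eq_add f s p y]; abel

lemma norm_levelSum_sub_le_of_le {f : ℤ → ℝ → G} {a : ℝ} (ha : 0 ≤ a)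
    (hf : ∀ k u v, ‖f k u - f k v‖ ≤ a * |u - v|) {s : Finset ℤ} {m : ℤ} (hs : ∀ k ∈ s, k ≤ m)
    (x y : ℝ) : ‖levelSum f s x - levelSum f s y‖ ≤
      a * (16 / 15) * ((256 : ℝ) ^ (-m) * (4096 ^ m * |x - y|)) := by
  rw [levelSum_sub]
  have hterm : ∀ k ∈ s, ‖(256 : ℝ) ^ (-k) • (f k (4096 ^ k * x) - f k (4096 ^ k * y))‖ ≤
      a * ((256 : ℝ) ^ (-m) * (4096 ^ m * |x - y|)) * (1 / 16) ^ (m - k).toNat := by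
    intro k hk
    have hkm := hs k hk
    rw [norm_smul, Real.norm_of_nonneg (by positivity)]
    calc _ ≤ (256 : ℝ) ^ (-k) * (a * |4096 ^ k * x - 4096 ^ k * y|) := by gcongr; exact hf _ _ _
      _ = (256 : ℝ) ^ (-k) * (a * (4096 ^ k * |x - y|)) := by
          rw [← mul_sub, abs_mul, abs_of_pos (show (0 : ℝ) < 4096 ^ k by positivity)]
      _ = a * ((256 : ℝ) ^ (-k) * 4096 ^ k) * |x - y| := by ring
      _ = a * (((256 : ℝ) ^ (-m) * 4096 ^ m) * (1 / 16) ^ (m - k).toNat) * |x - y| := by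
          congr 2
          have h1 : ∀ n : ℤ, (256 : ℝ) ^ (-n) * 4096 ^ n = 16 ^ n := fun n => by
            rw [zpow_neg, ← inv_zpow, ← mul_zpow]; norm_num
          rw [h1, h1, ← zpow_natCast, Int.toNat_of_nonneg (by omega), one_div, inv_zpow, ← zpow_neg,
            ← zpow_add₀ (by norm_num)]
          congr 1; ring
      _ = _ := by ring
  refine (norm_sum_le _ _).trans ((Finset.sum_le_sum hterm).trans ?_)
  rw [← Finset.mul_sum]
  have h2 := sum_pow_le_of_injOn s (fun k => (m - k).toNat) (fun k hk l hl hkl => by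
    have := hs k hk; have := hs l hl; simp only at hkl; omega) (θ := 1 / 16) (by norm_num)
    (by norm_num)
  have h3 : (1 - 1 / 16 : ℝ)⁻¹ = 16 / 15 := by norm_num
  rw [h3] at h2
  calc _ ≤ a * ((256 : ℝ) ^ (-m) * (4096 ^ m * |x - y|)) * (16 / 15) := by gcongr
    _ = _ := by ring

lemma norm_levelSum_le_of_ge {f : ℤ → ℝ → G} {c : ℝ} (hc : 0 ≤ c)
    (hf : ∀ k u, ‖f k u‖ ≤ c) {s : Finset ℤ} {m : ℤ} (hs : ∀ k ∈ s, m ≤ k) (x : ℝ) :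
    ‖levelSum f s x‖ ≤ c * (256 / 255) * (256 : ℝ) ^ (-m) := by
  have hterm : ∀ k ∈ s, ‖(256 : ℝ) ^ (-k) • f k (4096 ^ k * x)‖ ≤
      c * (256 : ℝ) ^ (-m) * (1 / 256) ^ (k - m).toNat := by
    intro k hk
    have hkm := hs k hk
    rw [norm_smul, Real.norm_of_nonneg (by positivity)]
    calc _ ≤ (256 : ℝ) ^ (-k) * c := by gcongr; exact hf _ _
      _ = _ := by
          rw [← zpow_natCast, Int.toNat_of_nonneg (by omega), one_div, inv_zpow, ← zpow_neg,
            mul_assoc, ← zpow_add₀ (by norm_num), mul_comm]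
          congr 2; ring
  refine (norm_sum_le _ _).trans ((Finset.sum_le_sum hterm).trans ?_)
  rw [← Finset.mul_sum]
  have h2 := sum_pow_le_of_injOn s (fun k => (k - m).toNat) (fun k hk l hl hkl => by
    have := hs k hk; have := hs l hl; simp only at hkl; omega) (θ := 1 / 256) (by norm_num)
    (by norm_num)
  have h3 : (1 - 1 / 256 : ℝ)⁻¹ = 256 / 255 := by norm_num
  rw [h3] at h2
  calc _ ≤ c * (256 : ℝ) ^ (-m) * (256 / 255) := by gcongr
    _ = _ := by ring

lemma norm_levelSum_sub_le {f : ℤ → ℝ → G} {a c : ℝ} (ha : 0 ≤ a) (hc : 0 ≤ c)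
    (hf : ∀ k u v, ‖f k u - f k v‖ ≤ a * |u - v|) (hfc : ∀ k u, ‖f k u‖ ≤ c) (s : Finset ℤ)
    (j : ℤ) {x y : ℝ} (hxy : |x - y| ≤ (4096 ^ j)⁻¹) :
    ‖levelSum f s x - levelSum f s y‖ ≤ (2 * a + c / 100) * (256 : ℝ) ^ (-j) := by
  rw [levelSum_sub_eq_add f s (fun k => k ≤ j)]
  have h1 := norm_levelSum_sub_le_of_le ha hf (s := s.filter fun k => k ≤ j) (m := j)
    (fun k hk => (Finset.mem_filter.1 hk).2) x y
  have h2 : ∀ z, ‖levelSum f (s.filter fun k => ¬ k ≤ j) z‖ ≤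
      c * (256 / 255) * (256 : ℝ) ^ (-(j + 1)) := fun z =>
    norm_levelSum_le_of_ge hc hfc (fun k hk => by
      have := (Finset.mem_filter.1 hk).2; omega) z
  have h3 : (256 : ℝ) ^ (-(j + 1)) = (256 : ℝ) ^ (-j) * (1 / 256) := by
    rw [neg_add, zpow_add₀ (by norm_num)]; norm_num
  have h4 : 4096 ^ j * |x - y| ≤ 1 := by
    calc _ ≤ (4096 : ℝ) ^ j * (4096 ^ j)⁻¹ := by gcongr
      _ = 1 := mul_inv_cancel₀ (by positivity)
  have hb : (0 : ℝ) < (256 : ℝ) ^ (-j) := by positivity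
  rw [h3] at h2
  have h5 : a * (16 / 15) * ((256 : ℝ) ^ (-j) * (4096 ^ j * |x - y|)) ≤
      a * (16 / 15) * ((256 : ℝ) ^ (-j) * 1) := by gcongr
  have h6 := norm_sub_le (levelSum f (s.filter fun k => ¬ k ≤ j) x)
    (levelSum f (s.filter fun k => ¬ k ≤ j) y)
  refine (norm_add_le _ _).trans ?_
  have := mul_nonneg ha hb.le
  have := mul_nonneg hc hb.le
  nlinarith [h2 x, h2 y]

end LevelSum

/-- A large circle through the origin. -/
noncomputable def loop (u : ℝ) : ℂ := 8192 * (Complex.exp (Complex.I * (Real.pi / 4096 * u : ℝ)) - 1)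

lemma loop_zero : loop 0 = 0 := by simp [loop]

lemma norm_loop_sub (u v : ℝ) :
    ‖loop u - loop v‖ = 16384 * |Real.sin (Real.pi / 4096 * (u - v) / 2)| := by
  have : loop u - loop v = 8192 * (Complex.exp (Complex.I * (Real.pi / 4096 * v : ℝ)) *
      (Complex.exp (Complex.I * (Real.pi / 4096 * (u - v) : ℝ)) - 1)) := by
    rw [mul_sub, mul_sub, ← Complex.exp_add, loop, loop]
    push_cast
    ring_nf
  rw [this, norm_mul, norm_mul, Complex.norm_exp_I_mul_ofReal, Complex.norm_exp_I_mul_ofReal_sub_one,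
    norm_mul, Real.norm_eq_abs, Real.norm_eq_abs]
  norm_num
  ring

lemma norm_loop_sub_le (u v : ℝ) : ‖loop u - loop v‖ ≤ 7 * |u - v| := by
  rw [norm_loop_sub]
  have h1 : |Real.sin (Real.pi / 4096 * (u - v) / 2)| ≤ |Real.pi / 4096 * (u - v) / 2| :=
    Real.abs_sin_le_abs
  have h2 : |Real.pi / 4096 * (u - v) / 2| = Real.pi / 8192 * |u - v| := by
    rw [show Real.pi / 4096 * (u - v) / 2 = Real.pi / 8192 * (u - v) by ring, abs_mul,
      abs_of_pos (by positivity)]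
  have := Real.pi_lt_d2
  have h3 := abs_nonneg (u - v)
  nlinarith

lemma norm_loop_le (u : ℝ) : ‖loop u‖ ≤ 16384 := by
  have := norm_loop_sub u 0
  rw [loop_zero, sub_zero] at this
  rw [this]
  have := Real.abs_sin_le_one (Real.pi / 4096 * (u - 0) / 2)
  linarith

lemma le_norm_loop_sub {u v : ℝ} (huv : |u - v| ≤ 4096) : 4 * |u - v| ≤ ‖loop u - loop v‖ := by
  rw [norm_loop_sub]
  have h2 : |Real.pi / 4096 * (u - v) / 2| = Real.pi / 8192 * |u - v| := by
    rw [show Real.pi / 4096 * (u - v) / 2 = Real.pi / 8192 * (u - v) by ring, abs_mul,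
      abs_of_pos (by positivity)]
  have h1 := Real.mul_abs_le_abs_sin (x := Real.pi / 4096 * (u - v) / 2) (by
    rw [h2]; nlinarith [Real.pi_pos])
  rw [h2] at h1
  have h3 : 2 / Real.pi * (Real.pi / 8192 * |u - v|) = |u - v| / 4096 := by
    field_simp; ring
  rw [h3] at h1
  linarith

/-- The deterministic part of the random curves, separating times at every scale. -/
noncomputable def spiral (c : ℤ) (s : Finset ℤ) : ℝ → ℂ :=
  levelSum (fun _ => loop) (s.filter fun k => k % 2 = c)

lemma norm_spiral_sub_le (c : ℤ) (s : Finset ℤ) (j : ℤ) {x y : ℝ} (hxy : |x - y| ≤ (4096 ^ j)⁻¹) :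
    ‖spiral c s x - spiral c s y‖ ≤ 200 * (256 : ℝ) ^ (-j) := by
  refine (norm_levelSum_sub_le (by norm_num) (by norm_num) (fun _ => norm_loop_sub_le)
    (fun _ => norm_loop_le) _ j hxy).trans ?_
  gcongr
  norm_num

lemma le_norm_spiral_sub {s : Finset ℤ} {m : ℤ} (hm : m ∈ s) {x y : ℝ} (h1 : 1 ≤ 4096 ^ m * |x - y|)
    (h2 : 4096 ^ m * |x - y| ≤ 4096) :
    2 * (256 : ℝ) ^ (-m) ≤ ‖spiral (m % 2) s x - spiral (m % 2) s y‖ := by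
  set s' := s.filter fun k => k % 2 = m % 2 with hs'
  set R := 4096 ^ m * |x - y| with hR
  rw [spiral, ← hs', levelSum_sub_eq_add _ s' (fun k => k ≤ m), levelSum_sub_eq_add _ _ (fun k => k < m)]
  have e1 : ((s'.filter fun k => k ≤ m).filter fun k => ¬ k < m) = {m} := by
    ext k; simp only [hs', Finset.mem_filter, Finset.mem_singleton]
    constructor
    · rintro ⟨⟨-, h⟩, h'⟩; omega
    · rintro rfl; simp [hm]
  rw [e1]
  have hb : (0 : ℝ) < (256 : ℝ) ^ (-m) := by positivity
  have hmain : (256 : ℝ) ^ (-m) * (4 * R) ≤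
      ‖levelSum (fun _ => loop) {m} x - levelSum (fun _ => loop) {m} y‖ := by
    rw [levelSum_sub, Finset.sum_singleton, norm_smul, Real.norm_of_nonneg hb.le]
    have habs : |4096 ^ m * x - 4096 ^ m * y| = R := by
      rw [← mul_sub, abs_mul, abs_of_pos (by positivity)]
    have := le_norm_loop_sub (u := 4096 ^ m * x) (v := 4096 ^ m * y) (by rw [habs]; exact h2)
    rw [habs] at this
    gcongr
  have hcoarse := norm_levelSum_sub_le_of_le (f := fun _ => loop) (by norm_num)
    (fun _ => norm_loop_sub_le) (s := (s'.filter fun k => k ≤ m).filter fun k => k < m) (m := m - 1)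
    (fun k hk => by have := (Finset.mem_filter.1 hk).2; omega) x y
  have hfine : ∀ z, ‖levelSum (fun _ => loop) (s'.filter fun k => ¬ k ≤ m) z‖ ≤ _ := fun z =>
    norm_levelSum_le_of_ge (f := fun _ => loop) (c := 16384) (m := m + 2) (by norm_num)
    (fun _ => norm_loop_le) (fun k hk => by
      simp only [hs', Finset.mem_filter] at hk; omega) z
  have e2 : (256 : ℝ) ^ (-(m + 2)) = (256 : ℝ) ^ (-m) * (1 / 65536) := by
    rw [neg_add, zpow_add₀ (by norm_num)]; norm_num
  have e3 : (256 : ℝ) ^ (-(m - 1)) * (4096 ^ (m - 1) * |x - y|) =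
      (256 : ℝ) ^ (-m) * R * (1 / 16) := by
    rw [hR, neg_sub, sub_eq_add_neg 1 m, zpow_add₀ (by norm_num), zpow_sub_one₀ (by norm_num)]; ring
  rw [e2] at hfine
  rw [e3] at hcoarse
  set c := levelSum (fun _ => loop) ((s'.filter fun k => k ≤ m).filter fun k => k < m) x -
    levelSum (fun _ => loop) ((s'.filter fun k => k ≤ m).filter fun k => k < m) y
  set q := levelSum (fun _ => loop) {m} x - levelSum (fun _ => loop) {m} y
  have h6 := norm_sub_le (levelSum (fun _ => loop) (s'.filter fun k => ¬ k ≤ m) x)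
    (levelSum (fun _ => loop) (s'.filter fun k => ¬ k ≤ m) y)
  set w := levelSum (fun _ => loop) (s'.filter fun k => ¬ k ≤ m) x -
    levelSum (fun _ => loop) (s'.filter fun k => ¬ k ≤ m) y
  have h7 : ‖q‖ ≤ ‖c + q + w‖ + ‖c‖ + ‖w‖ := by
    have : q = (c + q + w) - c - w := by abel
    calc ‖q‖ = ‖(c + q + w) - c - w‖ := by rw [← this]
      _ ≤ _ := (norm_sub_le _ _).trans (by gcongr; exact norm_sub_le _ _)
  have h8 := mul_le_mul_of_nonneg_left h1 hb.le
  linarith [hfine x, hfine y]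

section Curve

variable {F E : Type*} [NormedAddCommGroup F] [NormedSpace ℝ F] [NormedAddCommGroup E]
  [NormedSpace ℝ E]

/-- The random part of the curves, interpolating at every scale the points prescribed by `U`. -/
noncomputable def randomPart (U : ℤ → ℤ → F) (s : Finset ℤ) : ℝ → F :=
  levelSum (fun k => interp (U k)) s

/-- The curve with random part prescribed by `U`, using the levels of `s`. -/
noncomputable def curve (L : F × ℂ × ℂ →ₗ[ℝ] E) (U : ℤ → ℤ → F) (s : Finset ℤ) (t : ℝ) : E :=
  L (randomPart U s t, spiral 0 s t, spiral 1 s t)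

variable {L : F × ℂ × ℂ →ₗ[ℝ] E}

lemma curve_sub (U V : ℤ → ℤ → F) (s : Finset ℤ) (x y : ℝ) :
    curve L U s x - curve L V s y = L (randomPart U s x - randomPart V s y,
      spiral 0 s x - spiral 0 s y, spiral 1 s x - spiral 1 s y) := by
  rw [curve, curve, ← map_sub]; rfl

lemma norm_randomPart_sub_le_curve
    (hL : ∀ p, ‖L p‖ ^ 2 = ‖p.1‖ ^ 2 + ‖p.2.1‖ ^ 2 + ‖p.2.2‖ ^ 2)
    (U V : ℤ → ℤ → F) (s : Finset ℤ) (x y : ℝ) :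
    ‖randomPart U s x - randomPart V s y‖ ≤ ‖curve L U s x - curve L V s y‖ := by
  rw [curve_sub]
  refine le_of_sq_le_sq ?_ (norm_nonneg _)
  rw [hL]
  nlinarith [sq_nonneg ‖spiral 0 s x - spiral 0 s y‖, sq_nonneg ‖spiral 1 s x - spiral 1 s y‖]

lemma norm_spiral_sub_le_curve
    (hL : ∀ p, ‖L p‖ ^ 2 = ‖p.1‖ ^ 2 + ‖p.2.1‖ ^ 2 + ‖p.2.2‖ ^ 2)
    (U V : ℤ → ℤ → F) (s : Finset ℤ) (m : ℤ) (x y : ℝ) :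
    ‖spiral (m % 2) s x - spiral (m % 2) s y‖ ≤ ‖curve L U s x - curve L V s y‖ := by
  rw [curve_sub]
  refine le_of_sq_le_sq ?_ (norm_nonneg _)
  rw [hL]
  rcases Int.emod_two_eq_zero_or_one m with h | h <;> rw [h] <;>
  nlinarith [sq_nonneg ‖spiral 0 s x - spiral 0 s y‖, sq_nonneg ‖spiral 1 s x - spiral 1 s y‖,
    sq_nonneg ‖randomPart U s x - randomPart V s y‖]

lemma le_norm_curve_sub
    (hL : ∀ p, ‖L p‖ ^ 2 = ‖p.1‖ ^ 2 + ‖p.2.1‖ ^ 2 + ‖p.2.2‖ ^ 2)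
    (U V : ℤ → ℤ → F) {s : Finset ℤ} {m : ℤ} (hm : m ∈ s) {x y : ℝ}
    (h1 : 1 ≤ 4096 ^ m * |x - y|) (h2 : 4096 ^ m * |x - y| ≤ 4096) :
    2 * (256 : ℝ) ^ (-m) ≤ ‖curve L U s x - curve L V s y‖ :=
  (le_norm_spiral_sub hm h1 h2).trans (norm_spiral_sub_le_curve hL U V s m x y)

lemma curve_zero {U : ℤ → ℤ → F} (hU : ∀ k, U k 0 = 0) (s : Finset ℤ) : curve L U s 0 = 0 := by
  have h1 : randomPart U s 0 = 0 := by simp [randomPart, levelSum, interp_zero (hU _)]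
  have h2 : ∀ c, spiral c s 0 = 0 := fun c => by simp [spiral, levelSum, loop_zero]
  rw [curve, h1, h2, h2]
  exact map_zero L

lemma isHolderCurve_curve
    (hL : ∀ p, ‖L p‖ ^ 2 = ‖p.1‖ ^ 2 + ‖p.2.1‖ ^ 2 + ‖p.2.2‖ ^ 2)
    {U : ℤ → ℤ → F} (hU : ∀ k i, ‖U k i‖ ≤ 64) (s : Finset ℤ) :
    IsHolderCurve (curve L U s) := by
  intro j x y hxy
  have hxy' : |x - y| ≤ ((4096 : ℝ) ^ (j : ℤ))⁻¹ := by rwa [zpow_natCast]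
  have h1 : ‖randomPart U s x - randomPart U s y‖ ≤ 300 * (256 : ℝ) ^ (-(j : ℤ)) := by
    refine (norm_levelSum_sub_le (a := 128) (c := 64) (by norm_num) (by norm_num)
      (fun k u v => (norm_interp_sub_le (hU k) u v).trans_eq (by norm_num))
      (fun k => norm_interp_le (hU k)) s j hxy').trans ?_
    gcongr
    norm_num
  have h2 := fun c => norm_spiral_sub_le c s j hxy'
  rw [zpow_neg, zpow_natCast] at h1 h2
  rw [curve_sub]
  refine le_of_sq_le_sq ?_ (by positivity)
  rw [hL]
  have hb : (0 : ℝ) < ((256 : ℝ) ^ j)⁻¹ := by positivity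
  have e1 := pow_le_pow_left₀ (norm_nonneg _) h1 2
  have e2 := pow_le_pow_left₀ (norm_nonneg _) (h2 0) 2
  have e3 := pow_le_pow_left₀ (norm_nonneg _) (h2 1) 2
  simp only at *
  nlinarith [sq_nonneg ((256 : ℝ) ^ j)⁻¹]

/-- At level `k`, near the time `i 4096^{-k}`, the random part prescribed by `U` comes close to the
one prescribed by `V`, at times of `T`. -/
def Meets (U V : ℤ → ℤ → F) (r : ℕ) (T : Set ℝ) (k i : ℤ) : Prop :=
  ∃ x ∈ T, ∃ y ∈ T, |4096 ^ k * x - i| ≤ 1 / 2 ∧ 4096 ^ k * |x - y| ≤ 1 ∧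
    ‖randomPart U (Finset.Icc (-(r : ℤ)) k) x - randomPart V (Finset.Icc (-(r : ℤ)) k) y‖ ≤
      3 * (256 : ℝ) ^ (-k)

lemma norm_randomPart_sub_le_add {U V : ℤ → ℤ → F} (hU : ∀ k i, ‖U k i‖ ≤ 64)
    (hV : ∀ k i, ‖V k i‖ ≤ 64) (r : ℕ) {k m : ℤ} (hkm : k ≤ m) (x y : ℝ) :
    ‖randomPart U (Finset.Icc (-(r : ℤ)) k) x - randomPart V (Finset.Icc (-(r : ℤ)) k) y‖ ≤
      ‖randomPart U (Finset.Icc (-(r : ℤ)) m) x - randomPart V (Finset.Icc (-(r : ℤ)) m) y‖ +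
        (256 : ℝ) ^ (-k) := by
  have hsub : (Finset.Icc (-(r : ℤ)) m).filter (fun l => l ≤ k) = Finset.Icc (-(r : ℤ)) k := by
    ext l; simp only [Finset.mem_filter, Finset.mem_Icc]; omega
  have hsplit : ∀ (W : ℤ → ℤ → F) z, randomPart W (Finset.Icc (-(r : ℤ)) m) z =
      randomPart W (Finset.Icc (-(r : ℤ)) k) z +
        levelSum (fun k => interp (W k)) ((Finset.Icc (-(r : ℤ)) m).filter fun l => ¬ l ≤ k) z := by
    intro W z
    rw [randomPart, levelSum_eq_add _ _ (fun l => l ≤ k), hsub]; rfl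
  have hfine : ∀ (W : ℤ → ℤ → F), (∀ k i, ‖W k i‖ ≤ 64) → ∀ z,
      ‖levelSum (fun k => interp (W k)) ((Finset.Icc (-(r : ℤ)) m).filter fun l => ¬ l ≤ k) z‖ ≤
        64 * (256 / 255) * (256 : ℝ) ^ (-(k + 1)) := fun W hW z =>
    norm_levelSum_le_of_ge (by norm_num) (fun k => norm_interp_le (hW k))
      (fun l hl => by have := (Finset.mem_filter.1 hl).2; omega) z
  rw [hsplit U x, hsplit V y]
  have h3 : (256 : ℝ) ^ (-(k + 1)) = (256 : ℝ) ^ (-k) * (1 / 256) := by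
    rw [neg_add, zpow_add₀ (by norm_num)]; norm_num
  have hu := hfine U hU x
  have hv := hfine V hV y
  rw [h3] at hu hv
  set p := randomPart U (Finset.Icc (-(r : ℤ)) k) x
  set q := randomPart V (Finset.Icc (-(r : ℤ)) k) y
  set u := levelSum (fun k => interp (U k)) ((Finset.Icc (-(r : ℤ)) m).filter fun l => ¬ l ≤ k) x
  set v := levelSum (fun k => interp (V k)) ((Finset.Icc (-(r : ℤ)) m).filter fun l => ¬ l ≤ k) y
  have hb : (0 : ℝ) < (256 : ℝ) ^ (-k) := by positivity
  have : ‖p - q‖ ≤ ‖p + u - (q + v)‖ + ‖u‖ + ‖v‖ := by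
    calc ‖p - q‖ = ‖(p + u - (q + v)) - u + v‖ := by congr 1; abel
      _ ≤ _ := (norm_add_le _ _).trans (by gcongr; exact norm_sub_le _ _)
  linarith

lemma Meets.exists_parent {U V : ℤ → ℤ → F} (hU : ∀ k i, ‖U k i‖ ≤ 64) (hV : ∀ k i, ‖V k i‖ ≤ 64)
    {r : ℕ} {T : Set ℝ} {k i : ℤ} (h : Meets U V r T (k + 1) i) :
    ∃ j, Meets U V r T k j ∧ |i - 4096 * j| ≤ 2048 := by
  obtain ⟨x, hx, y, hy, h1, h2, h3⟩ := h
  have e1 : (4096 : ℝ) ^ (k + 1) = 4096 * 4096 ^ k := by rw [zpow_add_one₀ (by norm_num), mul_comm]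
  have h4 := abs_sub_round ((4096 : ℝ) ^ k * x)
  refine ⟨round ((4096 : ℝ) ^ k * x), ⟨x, hx, y, hy, h4, ?_, ?_⟩, ?_⟩
  · rw [e1, mul_assoc] at h2
    have : 0 ≤ (4096 : ℝ) ^ k * |x - y| := by positivity
    linarith
  · have := norm_randomPart_sub_le_add hU hV r (show k ≤ k + 1 by omega) x y
    have e3 : (256 : ℝ) ^ (-(k + 1)) = (256 : ℝ) ^ (-k) * (1 / 256) := by
      rw [neg_add, zpow_add₀ (by norm_num)]; norm_num
    rw [e3] at h3
    have hb : (0 : ℝ) < (256 : ℝ) ^ (-k) := by positivity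
    linarith
  · rw [e1, mul_assoc] at h1
    generalize round ((4096 : ℝ) ^ k * x) = j at *
    generalize (4096 : ℝ) ^ k * x = X at *
    have h5 : |((i - 4096 * j : ℤ) : ℝ)| < ((2049 : ℤ) : ℝ) := by
      push_cast
      rw [abs_le] at h1 h4
      rw [abs_lt]
      constructor <;> linarith [h1.1, h1.2, h4.1, h4.2]
    have h6 : |i - 4096 * j| < 2049 := by exact_mod_cast h5
    omega

lemma meets_of_norm_curve_sub_lt
    (hL : ∀ p, ‖L p‖ ^ 2 = ‖p.1‖ ^ 2 + ‖p.2.1‖ ^ 2 + ‖p.2.2‖ ^ 2)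
    {U V : ℤ → ℤ → F} (hU : ∀ k i, ‖U k i‖ ≤ 64)
    (hV : ∀ k i, ‖V k i‖ ≤ 64) {r : ℕ} {T : Set ℝ} (hT : ∀ t ∈ T, 0 ≤ t ∧ t ≤ 4096 ^ r) {m i : ℤ}
    (hm : m ≤ r) {x y : ℝ} (hx : x ∈ T) (hy : y ∈ T) (hxi : |4096 ^ m * x - i| ≤ 1 / 2)
    (hxy : ‖curve L U (Finset.Icc (-(r : ℤ)) r) x - curve L V (Finset.Icc (-(r : ℤ)) r) y‖ <
      2 * (256 : ℝ) ^ (-m)) : Meets U V r T m i := by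
  refine ⟨x, hx, y, hy, hxi, ?_, ?_⟩
  · by_contra! hlt
    have hpos : 0 < |x - y| := by
      by_contra! h0
      have : (4096 : ℝ) ^ m * |x - y| ≤ 0 := mul_nonpos_of_nonneg_of_nonpos (by positivity) h0
      linarith
    obtain ⟨n, hn1, hn2⟩ := exists_mem_Ico_zpow hpos (show (1 : ℝ) < 4096 by norm_num)
    have hnr : n ≤ r := by
      have h1 : |x - y| ≤ (4096 : ℝ) ^ (r : ℤ) := by
        rw [zpow_natCast, abs_le]
        have := hT x hx; have := hT y hy
        constructor <;> linarith
      exact (zpow_le_zpow_iff_right₀ (show (1 : ℝ) < 4096 by norm_num)).1 (hn1.trans h1)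
    have hnm : -n ≤ m := by
      have h1 : (4096 : ℝ) ^ (-m) < 4096 ^ (n + 1) := by
        refine lt_trans ?_ hn2
        rw [zpow_neg, inv_lt_iff_one_lt_mul₀ (by positivity), mul_comm]
        exact hlt
      have := (zpow_lt_zpow_iff_right₀ (show (1 : ℝ) < 4096 by norm_num)).1 h1
      omega
    have h1 := le_norm_curve_sub hL U V (s := Finset.Icc (-(r : ℤ)) r) (m := -n) (x := x) (y := y)
      (Finset.mem_Icc.2 ⟨by omega, by omega⟩)
      (by rw [zpow_neg, ← div_eq_inv_mul, one_le_div (by positivity)]; exact hn1)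
      (by
        rw [zpow_neg, ← div_eq_inv_mul, div_le_iff₀ (by positivity)]
        rw [zpow_add_one₀ (by norm_num)] at hn2; linarith)
    have h2 : (256 : ℝ) ^ (-m) ≤ 256 ^ (- -n) := zpow_le_zpow_right₀ (by norm_num) (by omega)
    linarith
  · have h1 := norm_randomPart_sub_le_add hU hV r hm x y
    have h2 := norm_randomPart_sub_le_curve hL U V (Finset.Icc (-(r : ℤ)) r) x y
    linarith

lemma randomPart_congr {U U' : ℤ → ℤ → F} {k i : ℤ} {x : ℝ} (hx : |4096 ^ k * x - i| ≤ 1 / 2)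
    (h1 : ∀ l < k, U l = U' l) (h2 : ∀ j, |j - i| ≤ 1 → U k j = U' k j) (a : ℤ) :
    randomPart U (Finset.Icc a k) x = randomPart U' (Finset.Icc a k) x := by
  rw [randomPart, randomPart, levelSum, levelSum]
  refine Finset.sum_congr rfl fun l hl => ?_
  rcases (Finset.mem_Icc.1 hl).2.lt_or_eq with h | rfl
  · rw [h1 l h]
  · rw [interp_congr hx h2]

lemma Meets.congr {U U' V : ℤ → ℤ → F} {r : ℕ} {T : Set ℝ} {k i : ℤ} (h : Meets U V r T k i)
    (h1 : ∀ l < k, U l = U' l) (h2 : ∀ j, |j - i| ≤ 1 → U k j = U' k j) : Meets U' V r T k i := by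
  obtain ⟨x, hx, y, hy, e1, e2, e3⟩ := h
  refine ⟨x, hx, y, hy, e1, e2, ?_⟩
  rwa [← randomPart_congr e1 h1 h2]

lemma norm_randomPart_sub_le {U : ℤ → ℤ → F} (hU : ∀ k i, ‖U k i‖ ≤ 64) (a k : ℤ) {x y : ℝ}
    (hxy : |4096 ^ k * x - 4096 ^ k * y| ≤ 1 / 32) :
    ‖randomPart U (Finset.Icc a k) x - randomPart U (Finset.Icc a k) y‖ ≤
      4.5 * (256 : ℝ) ^ (-k) := by
  have h1 := norm_levelSum_sub_le_of_le (f := fun k => interp (U k)) (a := 128) (by norm_num)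
    (fun k u v => (norm_interp_sub_le (hU k) u v).trans_eq (by norm_num))
    (s := Finset.Icc a k) (m := k) (fun l hl => (Finset.mem_Icc.1 hl).2) x y
  rw [← mul_sub, abs_mul, abs_of_pos (show (0 : ℝ) < 4096 ^ k by positivity)] at hxy
  refine h1.trans ?_
  have hb : (0 : ℝ) < (256 : ℝ) ^ (-k) := by positivity
  calc _ ≤ 128 * (16 / 15) * ((256 : ℝ) ^ (-k) * (1 / 32)) := by gcongr
    _ ≤ _ := by linarith

lemma dist_le_of_meets {U U' V : ℤ → ℤ → F} (hU' : ∀ k i, ‖U' k i‖ ≤ 64)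
    (hV : ∀ k i, ‖V k i‖ ≤ 64) {a k i : ℤ} (hk : a ≤ k) (h1 : ∀ l < k, U l = U' l)
    (h2 : ∀ j, j ≠ i → U k j = U' k j) {x y x' y' : ℝ} (hx : |4096 ^ k * x - i| ≤ 1 / 2)
    (hxx : |4096 ^ k * x - 4096 ^ k * x'| ≤ 1 / 32) (hyy : |4096 ^ k * y - 4096 ^ k * y'| ≤ 1 / 32)
    (e : ‖randomPart U (Finset.Icc a k) x - randomPart V (Finset.Icc a k) y‖ ≤ 3 * 256 ^ (-k))
    (e' : ‖randomPart U' (Finset.Icc a k) x' - randomPart V (Finset.Icc a k) y'‖ ≤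
      3 * 256 ^ (-k)) : dist (U k i) (U' k i) ≤ 32 := by
  have hb : (0 : ℝ) < (256 : ℝ) ^ (-k) := by positivity
  have h3 : randomPart U (Finset.Icc a k) x - randomPart U' (Finset.Icc a k) x =
      ((256 : ℝ) ^ (-k) * (1 - |4096 ^ k * x - i|)) • (U k i - U' k i) := by
    rw [randomPart, randomPart, levelSum, levelSum, ← Finset.sum_sub_distrib,
      Finset.sum_eq_single k]
    · have e1 : U k = Function.update (U k) i (U k i) := by simp
      have e2 : U' k = Function.update (U k) i (U' k i) := by
        ext1 j
        by_cases hj : j = i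
        · subst hj; simp
        · rw [Function.update_of_ne hj, h2 j hj]
      rw [← smul_sub, mul_smul, ← interp_update_sub (U k) hx, ← e1, ← e2]
    · intro l hl hlk
      rw [h1 l (lt_of_le_of_ne (Finset.mem_Icc.1 hl).2 hlk), sub_self]
    · intro h; exact absurd (Finset.mem_Icc.2 ⟨hk, le_rfl⟩) h
  have h4 : ‖randomPart U (Finset.Icc a k) x - randomPart U' (Finset.Icc a k) x‖ ≤
      15 * 256 ^ (-k) := by
    have f1 := norm_randomPart_sub_le hU' a k hxx
    have f2 := norm_randomPart_sub_le hV a k hyy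
    set p := randomPart U (Finset.Icc a k) x
    set p' := randomPart U' (Finset.Icc a k) x
    set q' := randomPart U' (Finset.Icc a k) x'
    set v := randomPart V (Finset.Icc a k) y
    set v' := randomPart V (Finset.Icc a k) y'
    calc ‖p - p'‖ = ‖((p - v) - (q' - v')) - (p' - q') + (v - v')‖ := by congr 1; abel
      _ ≤ ‖p - v‖ + ‖q' - v'‖ + ‖p' - q'‖ + ‖v - v'‖ :=
          (norm_add_le _ _).trans (add_le_add_left ((norm_sub_le _ _).trans
            (add_le_add_left (norm_sub_le _ _) _)) _)
      _ ≤ _ := by linarith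
  rw [h3, norm_smul, Real.norm_of_nonneg (by have := hx; nlinarith), mul_assoc, mul_comm 15] at h4
  have h5 := le_of_mul_le_mul_left h4 hb
  rw [dist_eq_norm]
  have : 1 / 2 * ‖U k i - U' k i‖ ≤ (1 - |4096 ^ k * x - i|) * ‖U k i - U' k i‖ := by
    gcongr; linarith
  linarith

open Classical in
lemma card_filter_meets_le {κ : Type*} [Fintype κ] {U : κ → ℤ → ℤ → F} {V : ℤ → ℤ → F}
    (hU : ∀ u k i, ‖U u k i‖ ≤ 64) (hV : ∀ k i, ‖V k i‖ ≤ 64) {r : ℕ} {T : Set ℝ} {k i : ℤ}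
    (hk : -(r : ℤ) ≤ k) (h1 : ∀ u v, ∀ l < k, U u l = U v l)
    (h2 : ∀ u v, ∀ j, j ≠ i → U u k j = U v k j)
    (h3 : ∀ u v, u ≠ v → 32 < dist (U u k i) (U v k i)) :
    (Finset.univ.filter fun u => Meets (U u) V r T k i).card ≤ 3201 := by
  have hex : ∀ u, ∃ p : ℝ × ℝ, Meets (U u) V r T k i → |4096 ^ k * p.1 - i| ≤ 1 / 2 ∧
      4096 ^ k * |p.1 - p.2| ≤ 1 ∧ ‖randomPart (U u) (Finset.Icc (-(r : ℤ)) k) p.1 -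
        randomPart V (Finset.Icc (-(r : ℤ)) k) p.2‖ ≤ 3 * (256 : ℝ) ^ (-k) := by
    intro u
    by_cases h : Meets (U u) V r T k i
    · obtain ⟨x, hx, y, hy, e⟩ := h
      exact ⟨(x, y), fun _ => e⟩
    · exact ⟨0, fun h' => absurd h' h⟩
  choose p hp using hex
  have hfl : ∀ X Y : ℝ, ⌊32 * (X - i)⌋ = ⌊32 * (Y - i)⌋ → |X - Y| ≤ 1 / 32 := by
    intro X Y h
    have := Int.abs_sub_lt_one_of_floor_eq_floor h
    rw [show 32 * (X - i) - 32 * (Y - i) = 32 * (X - Y) by ring, abs_mul] at this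
    norm_num at this
    linarith
  have hcard : (Finset.Icc (-16 : ℤ) 16 ×ˢ Finset.Icc (-48 : ℤ) 48).card = 3201 := by
    rw [Finset.card_product, Int.card_Icc, Int.card_Icc]; rfl
  rw [← hcard]
  refine Finset.card_le_card_of_injOn
    (fun u => (⌊32 * (4096 ^ k * (p u).1 - i)⌋, ⌊32 * (4096 ^ k * (p u).2 - i)⌋)) ?_ ?_
  · intro u hu
    obtain ⟨e1, e2, -⟩ := hp u (Finset.mem_filter.1 hu).2
    have e3 : |4096 ^ k * (p u).1 - 4096 ^ k * (p u).2| ≤ 1 := by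
      rwa [← mul_sub, abs_mul, abs_of_pos (by positivity)]
    rw [abs_le] at e1 e3
    simp only [Finset.coe_product, Finset.coe_Icc, Set.mem_prod, Set.mem_Icc]
    refine ⟨⟨Int.le_floor.2 ?_, Int.floor_le_iff.2 ?_⟩, Int.le_floor.2 ?_, Int.floor_le_iff.2 ?_⟩ <;>
    push_cast <;> linarith
  · intro u hu v hv huv
    by_contra hne
    obtain ⟨e1, e2, e3⟩ := hp u (Finset.mem_filter.1 hu).2
    obtain ⟨f1, f2, f3⟩ := hp v (Finset.mem_filter.1 hv).2
    simp only [Prod.mk.injEq] at huv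
    exact absurd (dist_le_of_meets (hU v) hV hk (h1 u v) (h2 u v) e1 (hfl _ _ huv.1)
      (hfl _ _ huv.2) e3 f3) (not_le.2 (h3 u v hne))

end Curve

section Configuration

variable {F : Type*} [NormedAddCommGroup F] [NormedSpace ℝ F]

/-- The pairs (level, position) at which the curves are random. -/
noncomputable def levelIndex (r : ℕ) : Finset (ℤ × ℤ) :=
  Finset.Icc (-(r : ℤ)) r ×ˢ Finset.Icc 1 (4096 ^ (2 * r) + 2)

/-- Extension by zero of a configuration. -/
noncomputable def extendConfig {r : ℕ} {S : Finset F} (U : levelIndex r → S) (k i : ℤ) : F :=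
  if h : (k, i) ∈ levelIndex r then U ⟨(k, i), h⟩ else 0

lemma extendConfig_zero {r : ℕ} {S : Finset F} (U : levelIndex r → S) (k : ℤ) :
    extendConfig U k 0 = 0 := by
  rw [extendConfig, dif_neg]
  simp [levelIndex]

lemma norm_extendConfig_le {r : ℕ} {S : Finset F} (hS : ∀ x ∈ S, ‖x‖ ≤ 64) (U : levelIndex r → S)
    (k i : ℤ) : ‖extendConfig U k i‖ ≤ 64 := by
  rw [extendConfig]
  split_ifs
  · exact hS _ (U _).2
  · simp

lemma extendConfig_update_of_ne {r : ℕ} {S : Finset F} (U : levelIndex r → S) (p : levelIndex r)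
    (u : S) {k i : ℤ} (h : (k, i) ≠ p.1) :
    extendConfig (Function.update U p u) k i = extendConfig U k i := by
  rw [extendConfig, extendConfig]
  split_ifs with h1
  · rw [Function.update_of_ne]
    intro h2; exact h (by rw [← h2])
  · rfl

lemma extendConfig_update_self {r : ℕ} {S : Finset F} (U : levelIndex r → S) (p : levelIndex r)
    (u : S) : extendConfig (Function.update U p u) p.1.1 p.1.2 = u := by
  rw [extendConfig, dif_pos p.2]
  simp

lemma Meets.extendConfig_update {r : ℕ} {S : Finset F} {V : ℤ → ℤ → F} {T : Set ℝ} {k i : ℤ}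
    (U : levelIndex r → S) (p : levelIndex r) (u : S) (hp : k ≤ p.1.1)
    (hp' : k = p.1.1 → 1 < |p.1.2 - i|) :
    Meets (extendConfig (Function.update U p u)) V r T k i ↔ Meets (extendConfig U) V r T k i := by
  have h1 : ∀ l < k, extendConfig (Function.update U p u) l = extendConfig U l := by
    intro l hl; ext1 j
    exact extendConfig_update_of_ne U p u (by rintro h; rw [← h] at hp; simp at hp; omega)
  have h2 : ∀ j, |j - i| ≤ 1 → extendConfig (Function.update U p u) k j = extendConfig U k j := by
    intro j hj
    refine extendConfig_update_of_ne U p u ?_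
    intro h
    rw [← h] at hp'
    simp at hp'
    omega
  exact ⟨fun h => h.congr h1 h2, fun h => h.congr (fun l hl => (h1 l hl).symm)
    fun j hj => (h2 j hj).symm⟩

open Classical in
/-- The number of positions at level `k` at which the random part of `U` meets the one of `V`. -/
noncomputable def meetCount {r : ℕ} {S : Finset F} (V : ℤ → ℤ → F) (T : Set ℝ) (k : ℤ)
    (U : levelIndex r → S) : ℕ :=
  ((Finset.univ.filter fun p : levelIndex r => p.1.1 = k).filter
    fun p => Meets (extendConfig U) V r T k p.1.2).card

variable {r ℓ : ℕ} {S : Finset F} {V : ℤ → ℤ → F} {T : Set ℝ}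

lemma meetCount_update (U : levelIndex r → S) (p : levelIndex r) (u : S) {k : ℤ} (hp : k < p.1.1) :
    meetCount V T k (Function.update U p u) = meetCount V T k U := by
  classical
  rw [meetCount, meetCount]
  congr 1
  ext q
  simp only [Finset.mem_filter]
  rw [Meets.extendConfig_update U p u hp.le (fun h => absurd h hp.ne)]

lemma mem_levelIndex_of_meets {U : ℤ → ℤ → F} (hT : ∀ t ∈ T, 0 ≤ t ∧ t ≤ 4096 ^ r) {k j : ℤ}
    (hk : -(r : ℤ) - 1 ≤ k) (hk' : k ≤ r) (hj : 1 ≤ j) (h : Meets U V r T k j) :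
    (k, j) ∈ levelIndex r := by
  obtain ⟨x, hx, -, -, h1, -⟩ := h
  obtain ⟨hx0, hxr⟩ := hT x hx
  rw [abs_le] at h1
  have hj' : (1 : ℝ) ≤ j := by exact_mod_cast hj
  have hkr : -(r : ℤ) ≤ k := by
    by_contra! hlt
    have e : k = -((r : ℤ) + 1) := by omega
    have : (4096 : ℝ) ^ k * x ≤ 1 / 4096 := by
      rw [e, zpow_neg, zpow_add_one₀ (by norm_num), zpow_natCast, mul_inv, mul_assoc,
        inv_mul_le_iff₀ (by positivity)]
      linarith
    linarith [h1.1, h1.2]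
  refine Finset.mem_product.2 ⟨Finset.mem_Icc.2 ⟨hkr, hk'⟩, Finset.mem_Icc.2 ⟨hj, ?_⟩⟩
  have h2 : (4096 : ℝ) ^ k * x ≤ 4096 ^ (2 * r) := by
    calc (4096 : ℝ) ^ k * x ≤ 4096 ^ (r : ℤ) * 4096 ^ r := by
          exact mul_le_mul (zpow_le_zpow_right₀ (by norm_num) hk') hxr hx0 (by positivity)
      _ = _ := by rw [zpow_natCast, two_mul, pow_add]
  have h3 : (j : ℝ) < ((4096 ^ (2 * r) + 2 : ℤ) : ℝ) := by push_cast; linarith [h1.1, h1.2]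
  exact (by exact_mod_cast h3 : j < 4096 ^ (2 * r) + 2).le

lemma nonneg_of_meets {U : ℤ → ℤ → F} (hT : ∀ t ∈ T, 0 ≤ t) {k j : ℤ} (h : Meets U V r T k j) :
    0 ≤ j := by
  obtain ⟨x, hx, -, -, h1, -⟩ := h
  have := hT x hx
  rw [abs_le] at h1
  have h2 : 0 ≤ (4096 : ℝ) ^ k * x := by positivity
  have h3 : ((-1 : ℤ) : ℝ) < j := by push_cast; linarith [h1.1, h1.2]
  have : -1 < j := by exact_mod_cast h3
  omega

lemma pos_of_meets {U : ℤ → ℤ → F} (hT : ∀ t ∈ T, 4096 ^ ℓ ≤ t) {k j : ℤ} (hk : -(ℓ : ℤ) ≤ k)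
    (h : Meets U V r T k j) : 1 ≤ j := by
  obtain ⟨x, hx, -, -, h1, -⟩ := h
  have := hT x hx
  rw [abs_le] at h1
  have h2 : 1 ≤ (4096 : ℝ) ^ k * x := by
    calc (1 : ℝ) = 4096 ^ (-(ℓ : ℤ)) * 4096 ^ ℓ := by
          rw [zpow_neg, zpow_natCast, inv_mul_cancel₀ (by positivity)]
      _ ≤ _ := by
          gcongr
          norm_num
  have h3 : ((0 : ℤ) : ℝ) < j := by push_cast; linarith [h1.1, h1.2]
  have : 0 < j := by exact_mod_cast h3
  omega

open Classical in
lemma card_filter_parent_le (hT : ∀ t ∈ T, 4096 ^ ℓ ≤ t ∧ t ≤ 4096 ^ r) {k : ℤ}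
    (hk : -(r : ℤ) - 1 ≤ k) (hk' : k ≤ r) (U : levelIndex r → S) :
    ((Finset.univ.filter fun p : levelIndex r => p.1.1 = k + 1).filter
      fun p => ∃ j, Meets (extendConfig U) V r T k j ∧ |p.1.2 - 4096 * j| ≤ 2048).card ≤
      4097 * meetCount V T k U + if k < -ℓ then 4097 else 0 := by
  have hT0 : ∀ t ∈ T, 0 ≤ t := fun t ht => le_trans (by positivity) (hT t ht).1
  set Q := (Finset.univ.filter fun p : levelIndex r => p.1.1 = k).filter
    fun p => Meets (extendConfig U) V r T k p.1.2 with hQ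
  set Y : Finset ℤ := if k < -ℓ then Finset.Icc (-2048) 2048 else ∅ with hY
  have hYc : Y.card = if k < -ℓ then 4097 else 0 := by
    rw [hY]; split_ifs
    · rw [Int.card_Icc]; rfl
    · rfl
  have h1 : (Q.biUnion fun p => Finset.Icc (4096 * p.1.2 - 2048) (4096 * p.1.2 + 2048)).card ≤
      4097 * Q.card := by
    rw [mul_comm]
    refine Finset.card_biUnion_le_card_mul _ _ _ fun p _ => ?_
    rw [Int.card_Icc]; omega
  calc _ ≤ ((Q.biUnion fun p => Finset.Icc (4096 * p.1.2 - 2048) (4096 * p.1.2 + 2048)) ∪ Y).card := by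
        refine Finset.card_le_card_of_injOn (fun p => p.1.2) ?_ ?_
        · intro p hp
          simp only [Finset.coe_filter, Finset.mem_filter, Set.mem_ofPred_eq] at hp
          obtain ⟨⟨-, hp1⟩, j, hj, hpj⟩ := hp
          rw [abs_le] at hpj
          simp only [Finset.mem_coe, Finset.mem_union]
          rcases (nonneg_of_meets hT0 hj).eq_or_lt with h0 | h0
          · right
            have : k < -(ℓ : ℤ) := by
              by_contra! hlt
              have := pos_of_meets (fun t ht => (hT t ht).1) hlt hj
              omega
            rw [hY, if_pos this, Finset.mem_Icc]
            omega
          · left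
            have hm := mem_levelIndex_of_meets (fun t ht => ⟨hT0 t ht, (hT t ht).2⟩) hk hk' h0 hj
            refine Finset.mem_biUnion.2 ⟨⟨(k, j), hm⟩, ?_, Finset.mem_Icc.2 ?_⟩
            · rw [hQ]
              exact Finset.mem_filter.2 ⟨Finset.mem_filter.2 ⟨Finset.mem_univ _, rfl⟩, hj⟩
            · simp only; omega
        · intro p hp q hq h
          simp only [Finset.coe_filter, Finset.mem_filter, Set.mem_ofPred_eq] at hp hq
          exact Subtype.ext (Prod.ext (hp.1.2.trans hq.1.2.symm) h)
    _ ≤ _ := (Finset.card_union_le _ _).trans (by rw [hYc]; exact Nat.add_le_add_right h1 _)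

lemma sum_mul_pow_meetCount_le (hS : ∀ x ∈ S, ‖x‖ ≤ 64)
    (hS' : ∀ x ∈ S, ∀ y ∈ S, x ≠ y → 32 < dist x y) (hS0 : S.Nonempty) (hV : ∀ k i, ‖V k i‖ ≤ 64)
    (hT : ∀ t ∈ T, 4096 ^ ℓ ≤ t ∧ t ≤ 4096 ^ r) {k : ℤ} (hk : -(r : ℤ) - 1 ≤ k) (hk' : k < r)
    {x : ℝ} (hx : 1 ≤ x) (W : (levelIndex r → S) → ℝ) (hW : ∀ U, 0 ≤ W U)
    (hWinv : ∀ p : levelIndex r, p.1.1 = k + 1 → ∀ U u, W (Function.update U p u) = W U) :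
    ∑ U, W U * x ^ meetCount V T (k + 1) U ≤ ∑ U, W U *
      (1 + 3201 / S.card * (x ^ 2 - 1)) ^ (4097 * meetCount V T k U + if k < -ℓ then 4097 else 0) := by
  classical
  have hSne : Nonempty S := hS0.to_subtype
  have hc : (0 : ℝ) < S.card := by exact_mod_cast hS0.card_pos
  refine (sum_mul_pow_card_le (ρ := 3201 / S.card)
    (Finset.univ.filter fun p : levelIndex r => p.1.1 = k + 1)
    (fun p => Even p.1.2) (fun p U => Meets (extendConfig U) V r T (k + 1) p.1.2)
    (fun p U => ∃ j, Meets (extendConfig U) V r T k j ∧ |p.1.2 - 4096 * j| ≤ 2048)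
    hx (by positivity) ?_ ?_ ?_ ?_ W hW ?_).trans ?_
  · intro p hp U hU
    exact hU.exists_parent (norm_extendConfig_le hS U) hV
  · intro p hp q hq hpq hpar U u
    have e1 := (Finset.mem_filter.1 hp).2
    have e2 := (Finset.mem_filter.1 hq).2
    refine Meets.extendConfig_update U q u e2.ge fun _ => ?_
    have h1 : q.1.2 ≠ p.1.2 := fun h => hpq (Subtype.ext (Prod.ext (e1.trans e2.symm) h.symm))
    have h2 : Even (q.1.2 - p.1.2) := by rw [Int.even_sub]; exact hpar.symm
    obtain ⟨c, hc⟩ := h2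
    rw [lt_abs]
    omega
  · intro p hp q hq U u
    have e2 := (Finset.mem_filter.1 hq).2
    refine exists_congr fun j => and_congr_left fun _ => ?_
    exact Meets.extendConfig_update U q u (by omega) (fun h => by omega)
  · intro p hp U
    have e1 := (Finset.mem_filter.1 hp).2
    rw [Fintype.card_coe, div_mul_cancel₀ _ hc.ne']
    rw [← e1]
    have := card_filter_meets_le (U := fun u : S => extendConfig (Function.update U p u)) (V := V)
      (r := r) (T := T) (k := p.1.1) (i := p.1.2) (fun u => norm_extendConfig_le hS _) hV
      (by omega) ?_ ?_ ?_
    · exact_mod_cast this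
    · intro u v l hl
      ext1 j
      have : (l, j) ≠ p.1 := by intro h; rw [← h] at hl; simp at hl
      rw [extendConfig_update_of_ne U p u this, extendConfig_update_of_ne U p v this]
    · intro u v j hj
      have : (p.1.1, j) ≠ p.1 := by intro h; rw [← h] at hj; simp at hj
      rw [extendConfig_update_of_ne U p u this, extendConfig_update_of_ne U p v this]
    · intro u v huv
      rw [extendConfig_update_self, extendConfig_update_self]
      exact hS' _ u.2 _ v.2 fun h => huv (Subtype.ext h)
  · intro q hq U u
    exact hWinv q (Finset.mem_filter.1 hq).2 U u
  · refine Finset.sum_le_sum fun U _ => mul_le_mul_of_nonneg_left ?_ (hW U)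
    refine pow_le_pow_right₀ ?_ (card_filter_parent_le hT hk hk'.le U)
    have : 0 ≤ 3201 / (S.card : ℝ) * (x ^ 2 - 1) := mul_nonneg (by positivity) (by nlinarith)
    linarith

lemma one_add_pow_le_one_add {lam ρ : ℝ} (hlam : 1 ≤ lam) (hρ : 0 ≤ ρ)
    (hρlam : 16 * 4097 * ρ * lam ^ 2 ≤ 1) (k : ℤ) :
    (1 + ρ * (((if 0 ≤ k + 1 then lam else 1) * (1 + (2 : ℝ) ^ min (k + 1) 0)) ^ 2 - 1)) ^ 4097 ≤
      1 + (2 : ℝ) ^ min k 0 := by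
  set b := (2 : ℝ) ^ min k 0 with hb
  have hb0 : 0 < b := by positivity
  have hb1 : b ≤ 1 := by
    calc b ≤ (2 : ℝ) ^ (0 : ℤ) := zpow_le_zpow_right₀ (by norm_num) (min_le_right _ _)
      _ = 1 := zpow_zero _
  have hl2 : 1 ≤ lam ^ 2 := by nlinarith
  have h1 : ((if 0 ≤ k + 1 then lam else 1) * (1 + (2 : ℝ) ^ min (k + 1) 0)) ^ 2 - 1 ≤
      8 * lam ^ 2 * b := by
    split_ifs with hk
    · rw [min_eq_right hk, zpow_zero]
      have : 1 / 2 ≤ b := by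
        calc (1 : ℝ) / 2 = (2 : ℝ) ^ (-1 : ℤ) := by norm_num
          _ ≤ b := zpow_le_zpow_right₀ (by norm_num) (by omega)
      nlinarith
    · have h2 : (2 : ℝ) ^ min (k + 1) 0 = 2 * b := by
        rw [hb, min_eq_left (by omega), min_eq_left (by omega), zpow_add_one₀ (by norm_num), mul_comm]
      have h3 : (2 : ℝ) ^ min (k + 1) 0 ≤ 1 := by
        calc _ ≤ (2 : ℝ) ^ (0 : ℤ) := zpow_le_zpow_right₀ (by norm_num) (min_le_right _ _)
          _ = 1 := zpow_zero _
      rw [h2] at h3 ⊢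
      nlinarith
  have h0 : 0 ≤ ((if 0 ≤ k + 1 then lam else 1) * (1 + (2 : ℝ) ^ min (k + 1) 0)) ^ 2 - 1 := by
    have e1 : 1 ≤ (if 0 ≤ k + 1 then lam else 1) := by split_ifs <;> linarith
    have e2 : 1 ≤ 1 + (2 : ℝ) ^ min (k + 1) 0 := by
      have : 0 < (2 : ℝ) ^ min (k + 1) 0 := by positivity
      linarith
    have := one_le_pow₀ (one_le_mul_of_one_le_of_one_le e1 e2) (n := 2)
    linarith
  set y := ((if 0 ≤ k + 1 then lam else 1) * (1 + (2 : ℝ) ^ min (k + 1) 0)) ^ 2 - 1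
  have h2 : 4097 * (ρ * y) ≤ b / 2 := by
    have := mul_le_mul_of_nonneg_left h1 hρ
    nlinarith
  have h3 : 1 + ρ * y ≤ Real.exp (ρ * y) := by linarith [Real.add_one_le_exp (ρ * y)]
  calc (1 + ρ * y) ^ 4097 ≤ Real.exp (ρ * y) ^ 4097 :=
        pow_le_pow_left₀ (by have := mul_nonneg hρ h0; linarith) h3 _
    _ = Real.exp (4097 * (ρ * y)) := by rw [← Real.exp_nat_mul]; norm_num
    _ ≤ Real.exp (b / 2) := Real.exp_le_exp.2 h2
    _ ≤ 1 + b := by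
        have h4 := Real.add_one_le_exp (-(b / 2))
        have h5 : Real.exp (b / 2) * Real.exp (-(b / 2)) = 1 := by rw [← Real.exp_add]; simp
        have h6 := Real.exp_pos (b / 2)
        nlinarith

lemma mul_pow_add_ite_le {a b z : ℝ} {n : ℕ} (ha : 0 ≤ a) (hz : 1 ≤ z) (h : z ^ n ≤ b) (N : ℕ)
    (c : Prop) [Decidable c] :
    a * z ^ (n * N + if c then n else 0) ≤ (if c then b else 1) * (a * b ^ N) := by
  have h1 : (z ^ n) ^ N ≤ b ^ N := pow_le_pow_left₀ (by positivity) h _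
  rw [pow_add, pow_mul]
  split_ifs
  · have : 0 ≤ b := le_trans (by positivity) h
    calc a * ((z ^ n) ^ N * z ^ n) ≤ a * (b ^ N * b) := by gcongr
      _ = _ := by ring
  · rw [pow_zero, mul_one, one_mul]
    gcongr

/-- Exponential moment of the total number of meetings with a fixed curve. -/
lemma sum_pow_meetCount_le (hS : ∀ x ∈ S, ‖x‖ ≤ 64)
    (hS' : ∀ x ∈ S, ∀ y ∈ S, x ≠ y → 32 < dist x y) (hS0 : S.Nonempty) (hV : ∀ k i, ‖V k i‖ ≤ 64)
    (hT : ∀ t ∈ T, 4096 ^ ℓ ≤ t ∧ t ≤ 4096 ^ r) {lam : ℝ} (hlam : 1 ≤ lam)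
    (hS2 : 16 * 4097 * 3201 * lam ^ 2 ≤ S.card) :
    ∑ U : levelIndex r → S, lam ^ (∑ k ∈ Finset.Icc (0 : ℤ) r, meetCount V T k U) ≤
      Fintype.card (levelIndex r → S) * Real.exp (2 ^ (-(ℓ : ℤ))) := by
  classical
  have hc : (0 : ℝ) < S.card := by exact_mod_cast hS0.card_pos
  have hβ : ∀ k : ℤ, (0 : ℝ) < 2 ^ min k 0 := fun k => by positivity
  have key : ∀ k : ℤ, -(r : ℤ) - 1 ≤ k → k ≤ r →
      ∑ U : levelIndex r → S, lam ^ (∑ l ∈ Finset.Icc (0 : ℤ) k, meetCount V T l U) *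
        (1 + (2 : ℝ) ^ min k 0) ^ meetCount V T k U ≤
      Fintype.card (levelIndex r → S) * Real.exp (2 ^ min k (-(ℓ : ℤ))) := by
    intro k hk
    induction k, hk using Int.leInduction with
    | base =>
      intro _
      have h0 : ∀ U : levelIndex r → S, meetCount V T (-(r : ℤ) - 1) U = 0 := by
        intro U
        rw [meetCount, Finset.card_eq_zero, Finset.filter_eq_empty_iff]
        intro p hp
        have h1 := (Finset.mem_filter.1 hp).2
        have h2 := (Finset.mem_Icc.1 (Finset.mem_product.1 p.2).1).1
        omega
      simp only [h0]
      rw [Finset.Icc_eq_empty (by omega)]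
      simp only [Finset.sum_empty, pow_zero, mul_one, Finset.sum_const, nsmul_eq_mul,
        Finset.card_univ]
      exact le_mul_of_one_le_right (by positivity) (Real.one_le_exp (by positivity))
    | succ k hk ih =>
      intro hk'
      have ih := ih (by omega)
      set x := (if 0 ≤ k + 1 then lam else 1) * (1 + (2 : ℝ) ^ min (k + 1) 0) with hx
      have hx1 : 1 ≤ x := by
        have e1 : 1 ≤ (if 0 ≤ k + 1 then lam else 1) := by split_ifs <;> linarith
        exact one_le_mul_of_one_le_of_one_le e1 (by linarith [hβ (k + 1)])
      have e1 : ∀ U : levelIndex r → S,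
          lam ^ (∑ l ∈ Finset.Icc (0 : ℤ) (k + 1), meetCount V T l U) *
            (1 + (2 : ℝ) ^ min (k + 1) 0) ^ meetCount V T (k + 1) U =
          lam ^ (∑ l ∈ Finset.Icc (0 : ℤ) k, meetCount V T l U) * x ^ meetCount V T (k + 1) U := by
        intro U
        rw [hx, mul_pow, ← mul_assoc]
        congr 1
        split_ifs with h
        · rw [← pow_add]
          congr 1
          have : Finset.Icc (0 : ℤ) (k + 1) = insert (k + 1) (Finset.Icc 0 k) := by
            ext a; simp only [Finset.mem_insert, Finset.mem_Icc]; omega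
          rw [this, Finset.sum_insert (by simp), add_comm]
        · rw [one_pow, mul_one, Finset.Icc_eq_empty (by omega), Finset.Icc_eq_empty (by omega)]
      simp only [e1]
      have hinv : ∀ p : levelIndex r, p.1.1 = k + 1 → ∀ U u,
          ∑ l ∈ Finset.Icc (0 : ℤ) k, meetCount V T l (Function.update U p u : levelIndex r → S) =
          ∑ l ∈ Finset.Icc (0 : ℤ) k, meetCount V T l U := by
        intro p hp U u
        refine Finset.sum_congr rfl fun l hl => meetCount_update U p u ?_
        have := (Finset.mem_Icc.1 hl).2
        omega
      have hstep := sum_mul_pow_meetCount_le hS hS' hS0 hV hT hk (by omega) hx1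
        (fun U => lam ^ (∑ l ∈ Finset.Icc (0 : ℤ) k, meetCount V T l U))
        (fun U => by positivity)
        (fun p hp U u => congrArg (fun n : ℕ => lam ^ n) (hinv p hp U u))
      obtain ⟨n, hn⟩ : ∃ n, n = 4097 := ⟨_, rfl⟩
      rw [← hn] at hstep
      refine hstep.trans ?_
      set z := 1 + 3201 / (S.card : ℝ) * (x ^ 2 - 1) with hz
      have hz1 : 1 ≤ z := by
        have : 0 ≤ 3201 / (S.card : ℝ) * (x ^ 2 - 1) := mul_nonneg (by positivity) (by nlinarith)
        linarith
      have hzb : z ^ 4097 ≤ 1 + (2 : ℝ) ^ min k 0 := by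
        refine one_add_pow_le_one_add hlam (by positivity) ?_ k
        rw [show 16 * 4097 * (3201 / (S.card : ℝ)) * lam ^ 2 =
          16 * 4097 * 3201 * lam ^ 2 / S.card by ring, div_le_one hc]
        exact hS2
      rw [← hn] at hzb
      have e2 : ∀ U : levelIndex r → S, lam ^ (∑ l ∈ Finset.Icc (0 : ℤ) k, meetCount V T l U) *
          z ^ (n * meetCount V T k U + if k < -ℓ then n else 0) ≤
          (if k < -ℓ then 1 + (2 : ℝ) ^ min k 0 else 1) *
          (lam ^ (∑ l ∈ Finset.Icc (0 : ℤ) k, meetCount V T l U) *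
            (1 + (2 : ℝ) ^ min k 0) ^ meetCount V T k U) := by
        exact fun U => mul_pow_add_ite_le (by positivity) hz1 hzb _ _
      refine (Finset.sum_le_sum fun U _ => e2 U).trans ?_
      rw [← Finset.mul_sum]
      split_ifs with hkl
      · have hm0 : min k 0 = k := min_eq_left (by omega)
        rw [min_eq_left hkl.le, hm0] at ih
        have hexp : Real.exp (2 ^ min (k + 1) (-(ℓ : ℤ))) = Real.exp (2 ^ k) * Real.exp (2 ^ k) := by
          rw [min_eq_left (show k + 1 ≤ -(ℓ : ℤ) by omega), zpow_add_one₀ two_ne_zero, mul_two,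
            Real.exp_add]
        rw [hexp]
        rw [hm0]
        have h1 : 1 + (2 : ℝ) ^ k ≤ Real.exp (2 ^ k) := by linarith [Real.add_one_le_exp ((2 : ℝ) ^ k)]
        rw [mul_left_comm]
        refine mul_le_mul h1 (ih.trans_eq rfl) ?_ (Real.exp_pos _).le
        have hk0 : (0 : ℝ) ≤ 1 + 2 ^ k := add_nonneg zero_le_one (zpow_nonneg zero_le_two _)
        exact Finset.sum_nonneg fun U _ => mul_nonneg (pow_nonneg (zero_le_one.trans hlam) _)
          (pow_nonneg hk0 _)
      · rw [one_mul]
        rw [min_eq_right (show -(ℓ : ℤ) ≤ k by omega)] at ih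
        rw [min_eq_right (show -(ℓ : ℤ) ≤ k + 1 by omega)]
        exact ih
  have h1 := key r (by omega) le_rfl
  refine (Finset.sum_le_sum fun U _ => ?_).trans (h1.trans ?_)
  · exact le_mul_of_one_le_right (by positivity) (one_le_pow₀ (by linarith [hβ r]))
  · gcongr
    · norm_num
    · exact min_le_right _ _

end Configuration

section SecondMoment

lemma one_sub_le_prob_iUnion {Ω : Type} [MeasurableSpace Ω] {P : Measure Ω} [IsProbabilityMeasure P]
    {C : Type*} [Fintype C] [Nonempty C] {G : C → Set Ω} (hG : ∀ c, MeasurableSet (G c))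
    (hpos : ∀ c, 0 < P.real (G c)) {δ : ℝ}
    (hδ : ∀ c', ∑ c, P.real (G c ∩ G c') / (P.real (G c) * P.real (G c')) ≤
      Fintype.card C * (1 + δ)) : 1 - δ ≤ P.real (⋃ c, G c) := by
  have hn : (0 : ℝ) < Fintype.card C := by exact_mod_cast Fintype.card_pos
  set n := (Fintype.card C : ℝ)
  set g : C → Ω → ℝ := fun c => (G c).indicator fun _ => (P.real (G c))⁻¹ with hg
  have h_int : ∀ c, Integrable (g c) P := fun c => (integrable_const _).indicator (hG c)
  have hprod : ∀ c c', (fun ω => g c ω * g c' ω) =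
      (G c ∩ G c').indicator fun _ => (P.real (G c))⁻¹ * (P.real (G c'))⁻¹ := by
    intro c c'; ext ω
    by_cases h1 : ω ∈ G c <;> by_cases h2 : ω ∈ G c' <;> simp [hg, h1, h2]
  have hint2 : ∀ c c', Integrable (fun ω => g c ω * g c' ω) P := by
    intro c c'
    rw [hprod]
    exact (integrable_const _).indicator ((hG c).inter (hG c'))
  have hE : MeasurableSet (⋃ c, G c) := MeasurableSet.iUnion hG
  set Z : Ω → ℝ := fun ω => n⁻¹ * ∑ c, g c ω with hZ
  have hZi : Integrable Z P := (integrable_finsetSum _ fun c _ => h_int c).const_mul _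
  have hZ2e : (fun ω => Z ω ^ 2) = fun ω => n⁻¹ ^ 2 * ∑ c', ∑ c, g c ω * g c' ω := by
    ext ω
    rw [hZ, mul_pow, sq (∑ c, g c ω), Finset.mul_sum]
    simp only [Finset.sum_mul]
  have hZ2i : Integrable (fun ω => Z ω ^ 2) P := by
    rw [hZ2e]
    exact (integrable_finsetSum _ fun c' _ => integrable_finsetSum _ fun c _ => hint2 c c').const_mul _
  have h1 : ∫ ω, Z ω ∂P = 1 := by
    rw [hZ, integral_const_mul, integral_finsetSum _ fun c _ => h_int c]
    have : ∀ c, ∫ ω, g c ω ∂P = 1 := by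
      intro c
      rw [hg, integral_indicator (hG c), setIntegral_const, smul_eq_mul,
        mul_inv_cancel₀ (hpos c).ne']
    simp only [this, Finset.sum_const, Finset.card_univ, nsmul_eq_mul, mul_one]
    exact inv_mul_cancel₀ hn.ne'
  have h2 : ∫ ω, Z ω ^ 2 ∂P ≤ 1 + δ := by
    rw [hZ2e, integral_const_mul, integral_finsetSum _
      fun c' _ => integrable_finsetSum _ fun c _ => hint2 c c']
    have e : ∀ c', ∫ ω, ∑ c, g c ω * g c' ω ∂P ≤ n * (1 + δ) := by
      intro c'
      rw [integral_finsetSum _ fun c _ => hint2 c c']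
      refine le_trans (le_of_eq ?_) (hδ c')
      refine Finset.sum_congr rfl fun c _ => ?_
      rw [hprod, integral_indicator ((hG c).inter (hG c')), setIntegral_const, smul_eq_mul,
        div_eq_mul_inv, mul_inv]
    have e2 : ∑ c', ∫ ω, ∑ c, g c ω * g c' ω ∂P ≤ n * (n * (1 + δ)) := by
      refine (Finset.sum_le_sum fun c' _ => e c').trans_eq ?_
      simp [n]
    calc _ ≤ n⁻¹ ^ 2 * (n * (n * (1 + δ))) := mul_le_mul_of_nonneg_left e2 (by positivity)
      _ = 1 + δ := by field_simp
  have h3 : ∫ ω, (2 * Z ω - Z ω ^ 2) ∂P ≤ ∫ ω, (⋃ c, G c).indicator (fun _ => (1 : ℝ)) ω ∂P := by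
    refine integral_mono ((hZi.const_mul 2).sub hZ2i) ((integrable_const _).indicator hE) fun ω => ?_
    by_cases hω : ω ∈ ⋃ c, G c
    · rw [Set.indicator_of_mem hω]
      nlinarith [sq_nonneg (1 - Z ω)]
    · have : Z ω = 0 := by
        rw [hZ]
        simp only [Set.mem_iUnion, not_exists] at hω
        simp [hg, hω]
      rw [Set.indicator_of_notMem hω, this]; norm_num
  rw [integral_sub (hZi.const_mul 2) hZ2i, integral_const_mul, h1, integral_indicator hE,
    setIntegral_const, smul_eq_mul, mul_one] at h3
  linarith

end SecondMoment

section Pair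

variable {d : ℕ} {Ω : Type} [MeasurableSpace Ω] {P : Measure Ω} [IsProbabilityMeasure P]
  {h : ℕ → EuclideanSpace ℝ (Fin d) → Ω → ℝ}

/-- The points of a curve at the times of `T`, with the indices of the layers of the first `r + 1`
blocks. -/
def pathSet {E : Type*} (γ : ℝ → E) (T : Set ℝ) (r : ℕ) : Set (ℕ × E) :=
  {p | 1 ≤ p.1 ∧ p.1 ≤ 8 * r + 8 ∧ ∃ t ∈ T, p.2 = γ t}

lemma pathSet_finite {E : Type*} (γ : ℝ → E) {T : Set ℝ} (hT : T.Finite) (r : ℕ) :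
    (pathSet γ T r).Finite := by
  refine ((Set.finite_Icc 1 (8 * r + 8)).prod (hT.image γ)).subset ?_
  rintro ⟨n, x⟩ ⟨h1, h2, t, ht, rfl⟩
  exact ⟨⟨h1, h2⟩, t, ht, rfl⟩

lemma pow_card_le_prob_above_biUnion (hw : IsWhiteNoiseField d P h) (τ : ℝ) {κ : Type*}
    (A : κ → Set (ℕ × EuclideanSpace ℝ (Fin d))) (hA : ∀ c, (A c).Finite) {p : ℝ} (hp : 0 ≤ p)
    (hAp : ∀ c, p ≤ P.real (IsNoise.above (layerField h) (fun _ => τ) (A c))) (N : Finset κ) :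
    p ^ N.card ≤ P.real (IsNoise.above (layerField h) (fun _ => τ) (⋃ c ∈ N, A c)) := by
  classical
  induction N using Finset.induction_on with
  | empty => simp [IsNoise.above]
  | insert a N ha ih =>
    rw [Finset.card_insert_of_notMem ha, pow_succ', Finset.set_biUnion_insert]
    refine le_trans ?_ ((isNoise_layerField hw).prob_above_mul_le _ (hA a)
      (N.finite_toSet.biUnion fun c _ => hA c))
    exact mul_le_mul (hAp a) ih (by positivity) measureReal_nonneg

lemma mem_cellSet_of_mem_pathSet {E : Type*} {γ : ℝ → E} {T : Set ℝ} {n : ℕ} {t : ℝ} (ht : t ∈ T)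
    (hn : 1 ≤ n) : (n, γ t) ∈ cellSet γ T ((n - 1) / 8) (round (4096 ^ ((n - 1) / 8) * t)) :=
  ⟨by simp only; omega, by simp only; omega, t, ht, abs_sub_round _, rfl⟩

lemma prob_above_pathSet_pos (hw : IsWhiteNoiseField d P h) {τ p : ℝ} (hp : 0 < p)
    {γ : ℝ → EuclideanSpace ℝ (Fin d)} {T : Set ℝ} (hT : T.Finite) (r : ℕ)
    (hγ : ∀ m i, p ≤ P.real (IsNoise.above (layerField h) (fun _ => τ) (cellSet γ T m i))) :
    0 < P.real (IsNoise.above (layerField h) (fun _ => τ) (pathSet γ T r)) := by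
  classical
  set N : Finset (ℕ × ℤ) := (Finset.range (r + 1)).biUnion fun m =>
    hT.toFinset.image fun t => (m, round (4096 ^ m * t))
  refine lt_of_lt_of_le (pow_pos hp N.card) ((pow_card_le_prob_above_biUnion hw τ
    (fun c : ℕ × ℤ => cellSet γ T c.1 c.2) (fun c => cellSet_finite γ hT _ _) hp.le
    (fun c => hγ _ _) N).trans (measureReal_mono (IsNoise.above_anti _ ?_)))
  rintro ⟨n, x⟩ ⟨h1, h2, t, ht, hx⟩
  simp only at h1 h2 hx
  subst hx
  refine Set.mem_biUnion (x := ((n - 1) / 8, round (4096 ^ ((n - 1) / 8) * t))) ?_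
    (mem_cellSet_of_mem_pathSet ht h1)
  refine Finset.mem_coe.2 (Finset.mem_biUnion.2 ⟨(n - 1) / 8, Finset.mem_range.2 (by omega), ?_⟩)
  exact Finset.mem_image.2 ⟨t, hT.mem_toFinset.2 ht, rfl⟩

/-- Correlation of the events attached to two curves, in terms of the number of cells of the first
which are close to the second. -/
lemma prob_above_inter_mul_le (hw : IsWhiteNoiseField d P h) {τ p : ℝ} (hp : 0 ≤ p)
    {γ γ' : ℝ → EuclideanSpace ℝ (Fin d)} {T : Set ℝ} (hT : T.Finite) (r : ℕ)
    (hγ : ∀ m i, p ≤ P.real (IsNoise.above (layerField h) (fun _ => τ) (cellSet γ T m i)))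
    (N : Finset (ℕ × ℤ))
    (hN : ∀ m ≤ r, ∀ i : ℤ, (m, i) ∉ N → ∀ x ∈ T, |4096 ^ m * x - i| ≤ 1 / 2 → ∀ y ∈ T,
      2 * ((256 : ℝ) ^ m)⁻¹ ≤ dist (γ x) (γ' y)) :
    P.real (IsNoise.above (layerField h) (fun _ => τ) (pathSet γ T r) ∩
      IsNoise.above (layerField h) (fun _ => τ) (pathSet γ' T r)) * p ^ N.card ≤
    P.real (IsNoise.above (layerField h) (fun _ => τ) (pathSet γ T r)) *
      P.real (IsNoise.above (layerField h) (fun _ => τ) (pathSet γ' T r)) := by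
  have hnoise := isNoise_layerField hw
  set Q := pathSet γ T r
  set Q' := pathSet γ' T r
  set near := ⋃ c ∈ N, cellSet γ T c.1 c.2 with hnear
  set far := Q \ near with hfar
  have hQ : Q.Finite := pathSet_finite γ hT r
  have hQ' : Q'.Finite := pathSet_finite γ' hT r
  have hfarf : far.Finite := hQ.subset Set.sdiff_subset
  have hnearf : near.Finite := N.finite_toSet.biUnion fun c _ => cellSet_finite γ hT _ _
  have h1 : P.real (IsNoise.above (layerField h) (fun _ => τ) Q ∩
      IsNoise.above (layerField h) (fun _ => τ) Q') ≤
      P.real (IsNoise.above (layerField h) (fun _ => τ) far) *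
        P.real (IsNoise.above (layerField h) (fun _ => τ) Q') := by
    rw [← hnoise.prob_above_union_of_disjoint _ hfarf hQ', IsNoise.above_union]
    · exact measureReal_mono (Set.inter_subset_inter_left _ (IsNoise.above_anti _ Set.sdiff_subset))
    · rintro ⟨n, x⟩ ⟨⟨e1, e2, t, ht, hx⟩, hnot⟩ ⟨n', y⟩ ⟨f1, f2, t', ht', hy⟩
      simp only at e1 e2 f1 f2 hx hy ⊢
      subst hx hy
      rcases eq_or_ne n n' with rfl | hne
      · refine coneSlab_inter_null_of_dist ?_
        have hcell := mem_cellSet_of_mem_pathSet (γ := γ) ht e1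
        have := hN ((n - 1) / 8) (by omega) (round (4096 ^ ((n - 1) / 8) * t)) (fun hmem =>
          hnot (Set.mem_biUnion (Finset.mem_coe.2 hmem) hcell)) t ht (abs_sub_round _) t' ht'
        refine le_trans ?_ this
        gcongr
        rw [show (256 : ℝ) = 2 ^ 8 by norm_num, ← pow_mul]
        exact pow_le_pow_right₀ one_le_two (by omega)
      · exact coneSlab_inter_null_of_ne e1 f1 hne _ _
  have h2 : P.real (IsNoise.above (layerField h) (fun _ => τ) far) * p ^ N.card ≤
      P.real (IsNoise.above (layerField h) (fun _ => τ) Q) := by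
    refine le_trans ?_ ((hnoise.prob_above_mul_le (fun _ => τ) hfarf hnearf).trans
      (measureReal_mono (IsNoise.above_anti _ ?_)))
    · exact mul_le_mul_of_nonneg_left (pow_card_le_prob_above_biUnion hw τ
        (fun c : ℕ × ℤ => cellSet γ T c.1 c.2) (fun c => cellSet_finite γ hT _ _) hp
        (fun c => hγ _ _) N) measureReal_nonneg
    · intro x hx
      by_cases hxn : x ∈ near
      · exact Or.inr hxn
      · exact Or.inl ⟨hx, hxn⟩
  calc _ ≤ P.real (IsNoise.above (layerField h) (fun _ => τ) far) *
        P.real (IsNoise.above (layerField h) (fun _ => τ) Q') * p ^ N.card := by gcongr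
    _ = P.real (IsNoise.above (layerField h) (fun _ => τ) far) * p ^ N.card *
        P.real (IsNoise.above (layerField h) (fun _ => τ) Q') := by ring
    _ ≤ _ := by gcongr

end Pair

section Assembly

/-- The times of `[4096^ℓ, 4096^r]` which are multiples of `4096^{-r}`. -/
def gridTimes (ℓ r : ℕ) : Set ℝ :=
  {t | 4096 ^ ℓ ≤ t ∧ t ≤ 4096 ^ r ∧ ∃ j : ℕ, t = j / 4096 ^ r}

lemma gridTimes_finite (ℓ r : ℕ) : (gridTimes ℓ r).Finite := by
  refine ((Set.finite_Iic (4096 ^ r * 4096 ^ r)).image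
    fun j : ℕ => (j : ℝ) / 4096 ^ r).subset ?_
  rintro t ⟨-, h2, j, rfl⟩
  refine ⟨j, ?_, rfl⟩
  rw [div_le_iff₀ (by positivity)] at h2
  exact Set.mem_Iic.2 (by exact_mod_cast h2)

variable {d n : ℕ} {Ω : Type} [MeasurableSpace Ω] {P : Measure Ω} [IsProbabilityMeasure P]
  {h : ℕ → EuclideanSpace ℝ (Fin d) → Ω → ℝ}
  {L : EuclideanSpace ℝ (Fin n) × ℂ × ℂ →ₗ[ℝ] EuclideanSpace ℝ (Fin d)}

/-- The layers of the field are above `τ` along one of the curves with `r` levels. -/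
def goodEvent (h : ℕ → EuclideanSpace ℝ (Fin d) → Ω → ℝ) (τ : ℝ)
    (L : EuclideanSpace ℝ (Fin n) × ℂ × ℂ →ₗ[ℝ] EuclideanSpace ℝ (Fin d))
    (S : Finset (EuclideanSpace ℝ (Fin n))) (ℓ r : ℕ) : Set Ω :=
  ⋃ U : levelIndex r → S, IsNoise.above (layerField h) (fun _ => τ)
    (pathSet (curve L (extendConfig U) (Finset.Icc (-(r : ℤ)) r)) (gridTimes ℓ r) r)

lemma one_sub_le_prob_goodEvent (hw : IsWhiteNoiseField d P h)
    (hL : ∀ p, ‖L p‖ ^ 2 = ‖p.1‖ ^ 2 + ‖p.2.1‖ ^ 2 + ‖p.2.2‖ ^ 2)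
    {S : Finset (EuclideanSpace ℝ (Fin n))} (hS : ∀ x ∈ S, ‖x‖ ≤ 64)
    (hS' : ∀ x ∈ S, ∀ y ∈ S, x ≠ y → 32 < dist x y) (hS0 : S.Nonempty) {τ p : ℝ} (hp : 0 < p)
    (hp1 : p ≤ 1) (hS2 : 16 * 4097 * 3201 * p⁻¹ ^ 2 ≤ S.card)
    (hcell : ∀ γ : ℝ → EuclideanSpace ℝ (Fin d), IsHolderCurve γ → ∀ ℓ r m i,
      p ≤ P.real (IsNoise.above (layerField h) (fun _ => τ) (cellSet γ (gridTimes ℓ r) m i)))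
    (ℓ r : ℕ) :
    1 - (Real.exp (2 ^ (-(ℓ : ℤ))) - 1) ≤ P.real (goodEvent h τ L S ℓ r) := by
  classical
  have hSne : Nonempty S := hS0.to_subtype
  set T := gridTimes ℓ r with hT
  have hTf : T.Finite := gridTimes_finite ℓ r
  have hTb : ∀ t ∈ T, 4096 ^ ℓ ≤ t ∧ t ≤ 4096 ^ r := fun t ht => ⟨ht.1, ht.2.1⟩
  have hT0 : ∀ t ∈ T, 0 ≤ t ∧ t ≤ 4096 ^ r := fun t ht => ⟨le_trans (by positivity) ht.1, ht.2.1⟩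
  set γ : (levelIndex r → S) → ℝ → EuclideanSpace ℝ (Fin d) := fun U =>
    curve L (extendConfig U) (Finset.Icc (-(r : ℤ)) r) with hγ
  have hγH : ∀ U, IsHolderCurve (γ U) := fun U =>
    isHolderCurve_curve hL (norm_extendConfig_le hS U) _
  have hpos : ∀ U, 0 < P.real (IsNoise.above (layerField h) (fun _ => τ) (pathSet (γ U) T r)) :=
    fun U => prob_above_pathSet_pos hw hp hTf r (hcell _ (hγH U) ℓ r)
  refine one_sub_le_prob_iUnion (fun U => (isNoise_layerField hw).measurableSet_above _
    (pathSet_finite _ hTf r)) hpos fun V => ?_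
  rw [add_sub_cancel]
  refine le_trans (Finset.sum_le_sum fun U _ => ?_) (sum_pow_meetCount_le (V := extendConfig V)
    hS hS' hS0 (norm_extendConfig_le hS V) hTb ((one_le_inv₀ hp).2 hp1) hS2)
  set N : Finset (ℕ × ℤ) := (Finset.Icc (0 : ℤ) r).biUnion fun k =>
    ((Finset.univ.filter fun p : levelIndex r => p.1.1 = k).filter
      fun p => Meets (extendConfig U) (extendConfig V) r T k p.1.2).image
        fun p => (k.toNat, p.1.2) with hN
  have hNc : N.card ≤ ∑ k ∈ Finset.Icc (0 : ℤ) r, meetCount (extendConfig V) T k U :=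
    Finset.card_biUnion_le.trans (Finset.sum_le_sum fun k _ => Finset.card_image_le)
  have hpair := prob_above_inter_mul_le hw hp.le (γ := γ U) (γ' := γ V) hTf r
    (hcell _ (hγH U) ℓ r) N (by
      intro m hm i hmi x hx hxi y hy
      by_contra! hlt
      refine hmi ?_
      have hM : Meets (extendConfig U) (extendConfig V) r T (m : ℤ) i := by
        refine meets_of_norm_curve_sub_lt hL (norm_extendConfig_le hS U) (norm_extendConfig_le hS V)
          hT0 (by exact_mod_cast hm) hx hy (by rwa [zpow_natCast]) ?_
        rw [zpow_neg, zpow_natCast, ← dist_eq_norm]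
        exact hlt
      have hi := pos_of_meets (fun t ht => (hTb t ht).1) (by omega) hM
      have hmem := mem_levelIndex_of_meets hT0 (by omega) (by omega) hi hM
      refine Finset.mem_biUnion.2 ⟨m, Finset.mem_Icc.2 ⟨by omega, by omega⟩,
        Finset.mem_image.2 ⟨⟨(m, i), hmem⟩, ?_, by simp⟩⟩
      exact Finset.mem_filter.2 ⟨Finset.mem_filter.2 ⟨Finset.mem_univ _, rfl⟩, hM⟩)
  rw [div_le_iff₀ (mul_pos (hpos U) (hpos V))]
  have hpN : p ^ (∑ k ∈ Finset.Icc (0 : ℤ) r, meetCount (extendConfig V) T k U) ≤ p ^ N.card :=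
    pow_le_pow_of_le_one hp.le hp1 hNc
  rw [inv_pow, ← div_eq_inv_mul, le_div_iff₀ (by positivity)]
  exact (mul_le_mul_of_nonneg_left hpN measureReal_nonneg).trans hpair

lemma measurableSet_goodEvent (hw : IsWhiteNoiseField d P h) (τ : ℝ)
    (S : Finset (EuclideanSpace ℝ (Fin n))) (ℓ r : ℕ) : MeasurableSet (goodEvent h τ L S ℓ r) := by
  classical
  exact MeasurableSet.iUnion fun U => (isNoise_layerField hw).measurableSet_above _
    (pathSet_finite _ (gridTimes_finite ℓ r) r)

lemma prob_eventually_notMem_le {E : ℕ → Set Ω} (hE : ∀ r, MeasurableSet (E r)) {δ : ℝ}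
    (hEδ : ∀ r, 1 - δ ≤ P.real (E r)) :
    P {ω | ∀ᶠ r in Filter.atTop, ω ∉ E r} ≤ ENNReal.ofReal δ := by
  have h1 : {ω | ∀ᶠ r in Filter.atTop, ω ∉ E r} = ⋃ n, ⋂ r ≥ n, (E r)ᶜ := by
    ext ω
    simp [Filter.eventually_atTop]
  have hmono : Monotone fun n : ℕ => ⋂ r ≥ n, (E r)ᶜ := fun a b hab =>
    Set.biInter_subset_biInter_left fun r hr => hab.trans hr
  rw [h1, hmono.measure_iUnion]
  refine iSup_le fun n => ?_
  refine (measure_mono (Set.biInter_subset_of_mem (le_refl n : n ∈ {r | r ≥ n}))).trans ?_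
  rw [← ofReal_measureReal (measure_ne_top P _)]
  refine ENNReal.ofReal_le_ofReal ?_
  rw [probReal_compl_eq_one_sub (hE n)]
  linarith [hEδ n]

end Assembly

section Limit

variable {E : Type*} [NormedAddCommGroup E]

lemma IsHolderCurve.norm_le {γ : ℝ → E} (hγ : IsHolderCurve γ) (h0 : γ 0 = 0) (N : ℕ) :
    ∀ t : ℝ, |t| ≤ N → ‖γ t‖ ≤ 1000 * N := by
  induction N with
  | zero =>
    intro t ht
    have : t = 0 := by simpa using ht
    simp [this, h0]
  | succ N ih =>
    intro t ht
    push_cast at ht ⊢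
    have hN : (0 : ℝ) < (N : ℝ) + 1 := by positivity
    have h1 := ih (t * (N / (N + 1))) (by
      rw [abs_mul, abs_of_nonneg (show (0 : ℝ) ≤ N / (N + 1) by positivity), ← mul_div_assoc,
        div_le_iff₀ hN]
      nlinarith [abs_nonneg t])
    have h2 := hγ 0 t (t * (N / (N + 1))) (by
      rw [show t - t * (N / (N + 1)) = t / (N + 1) by field_simp; ring, abs_div, abs_of_pos hN,
        pow_zero, inv_one, div_le_one hN]
      exact ht)
    rw [pow_zero, inv_one, mul_one] at h2
    have h3 := norm_le_norm_add_norm_sub' (γ t) (γ (t * (N / (N + 1))))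
    linarith

lemma IsHolderCurve.continuous {γ : ℝ → E} (hγ : IsHolderCurve γ) : Continuous γ := by
  rw [Metric.continuous_iff]
  intro t ε hε
  obtain ⟨j, hj⟩ := exists_pow_lt_of_lt_one (show 0 < ε / 1000 by positivity)
    (show (1 / 256 : ℝ) < 1 by norm_num)
  refine ⟨((4096 : ℝ) ^ j)⁻¹, by positivity, fun s hs => ?_⟩
  rw [Real.dist_eq] at hs
  rw [dist_eq_norm]
  refine (hγ j s t hs.le).trans_lt ?_
  rw [one_div, inv_pow] at hj
  linarith

lemma exists_tendsto_ultrafilter [ProperSpace E] (G : Ultrafilter ℕ) {γ : ℕ → ℝ → E}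
    (hγ : ∀ᶠ r in (G : Filter ℕ), IsHolderCurve (γ r) ∧ γ r 0 = 0) :
    ∃ γ' : ℝ → E, (∀ t, Filter.Tendsto (fun r => γ r t) G (nhds (γ' t))) ∧ IsHolderCurve γ' := by
  have hlim : ∀ t, ∃ x, Filter.Tendsto (fun r => γ r t) G (nhds x) := by
    intro t
    obtain ⟨N, hN⟩ := exists_nat_ge |t|
    obtain ⟨x, -, hx⟩ := (isCompact_closedBall (0 : E) (1000 * N)).ultrafilter_le_nhds
      (G.map fun r => γ r t) (by
        rw [Filter.le_principal_iff, Ultrafilter.coe_map, Filter.mem_map]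
        filter_upwards [hγ] with r hr
        rw [Set.mem_preimage, mem_closedBall_zero_iff]
        exact IsHolderCurve.norm_le hr.1 hr.2 N t hN)
    exact ⟨x, hx⟩
  choose γ' hγ' using hlim
  refine ⟨γ', hγ', fun j s t hst => ?_⟩
  refine le_of_tendsto (((hγ' s).sub (hγ' t)).norm) ?_
  filter_upwards [hγ] with r hr
  exact hr.1 j s t hst

end Limit

section ThickPath

variable {d n : ℕ} {Ω : Type} {h : ℕ → EuclideanSpace ℝ (Fin d) → Ω → ℝ}
  {L : EuclideanSpace ℝ (Fin n) × ℂ × ℂ →ₗ[ℝ] EuclideanSpace ℝ (Fin d)}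

lemma mem_gridTimes {ℓ q r j : ℕ} (h1 : (4096 : ℝ) ^ ℓ ≤ j / 4096 ^ q)
    (h2 : (j : ℝ) / 4096 ^ q ≤ 4096 ^ r) (hqr : q ≤ r) : (j : ℝ) / 4096 ^ q ∈ gridTimes ℓ r := by
  refine ⟨h1, h2, j * 4096 ^ (r - q), ?_⟩
  obtain ⟨c, rfl⟩ := Nat.exists_eq_add_of_le hqr
  rw [Nat.add_sub_cancel_left, pow_add]
  push_cast
  field_simp

lemma continuous_layerField {ω : Ω} (hcont : ∀ n, Continuous fun x => h n x ω) (n : ℕ) :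
    Continuous fun x => layerField h (n, x) ω := by
  have h1 : ∀ n, Continuous fun x => extField h (n, x) ω := by
    intro n
    rcases eq_or_ne n 0 with rfl | hn
    · simpa [extField] using continuous_const
    · simpa [extField, hn] using hcont n
  exact (h1 n).sub (h1 (n - 1))

lemma mul_le_of_layerField_ge {ω : Ω} {x : EuclideanSpace ℝ (Fin d)} {τ : ℝ}
    (hx : ∀ n, 1 ≤ n → τ ≤ layerField h (n, x) ω) (n : ℕ) (hn : 1 ≤ n) : τ * n ≤ h n x ω := by
  have h1 : ∀ n : ℕ, τ * n ≤ extField h (n, x) ω := by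
    intro n
    induction n with
    | zero => simp [extField]
    | succ n ih =>
      have := hx (n + 1) (by omega)
      simp only [layerField, Nat.add_sub_cancel] at this
      push_cast
      linarith
  have h2 := h1 n
  simp only [extField] at h2
  rwa [if_neg (by omega)] at h2

lemma le_liminf_of_layerField_ge {ω : Ω} {x : EuclideanSpace ℝ (Fin d)} {τ : ℝ}
    (hbd : ∀ R : ℕ, ∃ M : ℝ, ∀ᶠ n : ℕ in Filter.atTop, ∀ x, ‖x‖ ≤ R → h n x ω ≤ M * n)
    (hx : ∀ n, 1 ≤ n → τ ≤ layerField h (n, x) ω) :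
    τ ≤ Filter.liminf (fun n : ℕ => h n x ω / n) Filter.atTop := by
  obtain ⟨R, hR⟩ := exists_nat_ge ‖x‖
  obtain ⟨M, hM⟩ := hbd R
  have hb : Filter.IsBoundedUnder (· ≤ ·) Filter.atTop fun n : ℕ => h n x ω / n := by
    refine ⟨M, Filter.eventually_map.2 ?_⟩
    filter_upwards [hM, Filter.eventually_ge_atTop 1] with n hn hn1
    rw [div_le_iff₀ (by exact_mod_cast hn1)]
    exact hn x hR
  refine Filter.le_liminf_of_le hb.isCoboundedUnder_ge ?_
  filter_upwards [Filter.eventually_ge_atTop 1] with n hn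
  rw [le_div_iff₀ (by exact_mod_cast hn)]
  exact mul_le_of_layerField_ge hx n hn

/-- If infinitely many of the finite level events occur, a limit of the corresponding curves gives
an unbounded path of thick points. -/
lemma exists_unbounded_path_of_frequently {ω : Ω} (hcont : ∀ n, Continuous fun x => h n x ω)
    (hbd : ∀ R : ℕ, ∃ M : ℝ, ∀ᶠ n : ℕ in Filter.atTop, ∀ x, ‖x‖ ≤ R → h n x ω ≤ M * n)
    (hL : ∀ p, ‖L p‖ ^ 2 = ‖p.1‖ ^ 2 + ‖p.2.1‖ ^ 2 + ‖p.2.2‖ ^ 2)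
    {S : Finset (EuclideanSpace ℝ (Fin n))} (hS : ∀ x ∈ S, ‖x‖ ≤ 64) {τ : ℝ} {ℓ : ℕ}
    (hE : ∃ᶠ r in Filter.atTop, ω ∈ goodEvent h τ L S ℓ r) :
    ∃ φ : ℝ → EuclideanSpace ℝ (Fin d), ContinuousOn φ (Set.Ici 0) ∧
      (φ '' Set.Ici 0 ⊆ {x : EuclideanSpace ℝ (Fin d) |
        τ ≤ Filter.liminf (fun n : ℕ => h n x ω / n) Filter.atTop}) ∧
      ¬ Bornology.IsBounded (φ '' Set.Ici 0) := by
  have hne : (Filter.atTop ⊓ Filter.principal {r | ω ∈ goodEvent h τ L S ℓ r}).NeBot :=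
    Filter.frequently_mem_iff_neBot.1 hE
  set G := Ultrafilter.of (Filter.atTop ⊓ Filter.principal {r | ω ∈ goodEvent h τ L S ℓ r})
  have hGle := Ultrafilter.of_le (Filter.atTop ⊓ Filter.principal {r | ω ∈ goodEvent h τ L S ℓ r})
  have hG1 : ∀ {p : ℕ → Prop}, (∀ᶠ r in Filter.atTop, p r) → ∀ᶠ r in (G : Filter ℕ), p r :=
    fun hp => (hGle.trans inf_le_left) hp
  have hG2 : ∀ᶠ r in (G : Filter ℕ), ω ∈ goodEvent h τ L S ℓ r :=
    (hGle.trans inf_le_right) (Filter.mem_principal_self _)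
  have hex : ∀ r, ∃ γ : ℝ → EuclideanSpace ℝ (Fin d), ω ∈ goodEvent h τ L S ℓ r →
      (IsHolderCurve γ ∧ γ 0 = 0) ∧ (∀ m ∈ Finset.Icc (-(r : ℤ)) r, ∀ x y,
        1 ≤ 4096 ^ m * |x - y| → 4096 ^ m * |x - y| ≤ 4096 → 2 * (256 : ℝ) ^ (-m) ≤ ‖γ x - γ y‖) ∧
      ∀ k, 1 ≤ k → k ≤ 8 * r + 8 → ∀ t ∈ gridTimes ℓ r, τ ≤ layerField h (k, γ t) ω := by
    intro r
    by_cases hω : ω ∈ goodEvent h τ L S ℓ r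
    · obtain ⟨U, hU⟩ := Set.mem_iUnion.1 hω
      refine ⟨curve L (extendConfig U) (Finset.Icc (-(r : ℤ)) r), fun _ =>
        ⟨⟨isHolderCurve_curve hL (norm_extendConfig_le hS U) _, curve_zero (extendConfig_zero U) _⟩,
          fun m hm x y h1 h2 => le_norm_curve_sub hL _ _ hm h1 h2, fun k h1 h2 t ht => ?_⟩⟩
      exact hU (k, _) ⟨h1, h2, t, ht, rfl⟩
    · exact ⟨0, fun h => absurd h hω⟩
  choose γ hγ using hex
  obtain ⟨γ', hlim, hH⟩ := exists_tendsto_ultrafilter G (γ := γ)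
    (hG2.mono fun r hr => (hγ r hr).1)
  have hγ'0 : γ' 0 = 0 := by
    refine tendsto_nhds_unique (hlim 0) (tendsto_const_nhds.congr' ?_)
    filter_upwards [hG2] with r hr
    exact (hγ r hr).1.2.symm
  have hgrow : ∀ m : ℕ, 2 * (256 : ℝ) ^ m ≤ ‖γ' (4096 ^ m)‖ := by
    intro m
    have h1 : 2 * (256 : ℝ) ^ m ≤ ‖γ' (4096 ^ m) - γ' 0‖ := by
      refine ge_of_tendsto (((hlim _).sub (hlim 0)).norm) ?_
      filter_upwards [hG2, hG1 (Filter.eventually_ge_atTop m)] with r hr hmr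
      have e : (4096 : ℝ) ^ (-(m : ℤ)) * |4096 ^ m - 0| = 1 := by
        rw [sub_zero, abs_of_pos (by positivity), zpow_neg, zpow_natCast,
          inv_mul_cancel₀ (by positivity)]
      have := (hγ r hr).2.1 (-(m : ℤ)) (Finset.mem_Icc.2 ⟨by omega, by omega⟩) (4096 ^ m) 0
        (by rw [e]) (by rw [e]; norm_num)
      rwa [neg_neg, zpow_natCast] at this
    rwa [hγ'0, sub_zero] at h1
  have hdyadic : ∀ k, 1 ≤ k → ∀ j q : ℕ, (4096 : ℝ) ^ ℓ ≤ j / 4096 ^ q →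
      τ ≤ layerField h (k, γ' (j / 4096 ^ q)) ω := by
    intro k hk j q hjq
    refine ge_of_tendsto (((continuous_layerField hcont k).tendsto _).comp (hlim _)) ?_
    have hev : ∀ᶠ r : ℕ in Filter.atTop, (j : ℝ) / 4096 ^ q ≤ 4096 ^ r :=
      (tendsto_pow_atTop_atTop_of_one_lt (show (1 : ℝ) < 4096 by norm_num)).eventually_ge_atTop _
    filter_upwards [hG2, hG1 hev, hG1 (Filter.eventually_ge_atTop (max q k))] with r hr h1 h2
    exact (hγ r hr).2.2 k hk (by have := (le_max_right q k).trans h2; omega) _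
      (mem_gridTimes hjq h1 ((le_max_left q k).trans h2))
  have hall : ∀ k, 1 ≤ k → ∀ t, (4096 : ℝ) ^ ℓ ≤ t → τ ≤ layerField h (k, γ' t) ω := by
    intro k hk t ht
    have ht0 : 0 ≤ t := le_trans (by positivity) ht
    have happ : Filter.Tendsto (fun q : ℕ => (⌈t * 4096 ^ q⌉₊ : ℝ) / 4096 ^ q) Filter.atTop
        (nhds t) := by
      have e1 : Filter.Tendsto (fun q : ℕ => t + (1 / 4096 : ℝ) ^ q) Filter.atTop (nhds t) := by
        simpa using (tendsto_pow_atTop_nhds_zero_of_lt_one (by norm_num)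
          (show (1 / 4096 : ℝ) < 1 by norm_num)).const_add t
      refine tendsto_of_tendsto_of_tendsto_of_le_of_le tendsto_const_nhds e1 (fun q => ?_)
        fun q => ?_
      · simp only
        rw [le_div_iff₀ (by positivity)]
        exact Nat.le_ceil _
      · simp only
        rw [div_le_iff₀ (by positivity), add_mul, ← mul_pow]
        norm_num
        exact (Nat.ceil_lt_add_one (by positivity)).le
    refine ge_of_tendsto (((continuous_layerField hcont k).comp hH.continuous).tendsto t |>.comp happ)
      (Filter.Eventually.of_forall fun q => hdyadic k hk _ q ?_)
    rw [le_div_iff₀ (by positivity)]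
    exact (mul_le_mul_of_nonneg_right ht (by positivity)).trans (Nat.le_ceil _)
  refine ⟨fun s => γ' (4096 ^ ℓ + s), ?_, ?_, ?_⟩
  · exact (hH.continuous.comp (continuous_const.add continuous_id)).continuousOn
  · rintro x ⟨s, hs, rfl⟩
    exact le_liminf_of_layerField_ge hbd fun k hk => hall k hk _ (by
      have : (0 : ℝ) ≤ s := hs
      linarith)
  · intro hb
    obtain ⟨C, hC⟩ := hb.exists_norm_le
    obtain ⟨m, hm⟩ := pow_unbounded_of_one_lt C (show (1 : ℝ) < 256 by norm_num)
    have h1 := hgrow (max m ℓ)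
    have h2 : (256 : ℝ) ^ m ≤ 256 ^ max m ℓ := pow_le_pow_right₀ (by norm_num) (le_max_left _ _)
    have h3 : (4096 : ℝ) ^ ℓ ≤ 4096 ^ max m ℓ := pow_le_pow_right₀ (by norm_num) (le_max_right _ _)
    have h4 := hC _ ⟨4096 ^ max m ℓ - 4096 ^ ℓ, Set.mem_Ici.2 (by linarith), rfl⟩
    simp only [add_sub_cancel] at h4
    have h5 : (0 : ℝ) < 256 ^ m := by positivity
    linarith

end ThickPath

lemma gaussianReal_Ici_pos (μ : ℝ) {v : NNReal} (hv : v ≠ 0) (a : ℝ) :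
    0 < (gaussianReal μ v).real (Set.Ici a) := by
  rw [measureReal_def, ENNReal.toReal_pos_iff]
  refine ⟨pos_iff_ne_zero.2 fun h => ?_, measure_lt_top _ _⟩
  have := gaussianReal_absolutelyContinuous' μ hv h
  simp at this

/-- In high dimension, every cell is above the threshold with probability much larger than
`2 ^ (-n / 2)`, along any Hölder curve. -/
lemma exists_cell_bound (τ : ℝ) : ∃ D : ℝ, ∀ n : ℕ, D ≤ n → ∃ p : ℝ, 0 < p ∧ p ≤ 1 ∧
    16 * 4097 * 3201 * p⁻¹ ^ 2 ≤ 2 ^ n ∧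
    ∀ (Ω : Type) (_ : MeasurableSpace Ω) (P : Measure Ω) (_ : IsProbabilityMeasure P)
      (h : ℕ → EuclideanSpace ℝ (Fin (n + 4)) → Ω → ℝ), IsWhiteNoiseField (n + 4) P h →
      ∀ γ : ℝ → EuclideanSpace ℝ (Fin (n + 4)), IsHolderCurve γ → ∀ ℓ r m i,
        p ≤ P.real (IsNoise.above (layerField h) (fun _ => τ) (cellSet γ (gridTimes ℓ r) m i)) := by
  set p₀ := (gaussianReal 0 (Real.log 2).toNNReal).real (Set.Ici (τ + 1)) with hp₀
  have hp₀0 : 0 < p₀ := gaussianReal_Ici_pos 0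
    (Real.toNNReal_pos.2 (Real.log_pos one_lt_two)).ne' _
  have hp₀1 : p₀ ≤ 1 := measureReal_le_one
  obtain ⟨z, hz, hz2, hzs⟩ := exists_sum_exp_le (half_pos hp₀0)
  set q := p₀ / 2 with hq
  have hq0 : 0 < q := half_pos hp₀0
  have hlog : Real.log q < 0 := Real.log_neg hq0 (by linarith)
  obtain ⟨D, hD⟩ := exists_scale hz hz2 (show 0 < 48 * -Real.log q by linarith)
    (show (0 : ℝ) < 16 * (16 * 4097 * 3201) by norm_num)
  refine ⟨D, fun n hn => ?_⟩
  obtain ⟨s, hs1, hs2⟩ := hD (n + 4) (by push_cast; linarith)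
  refine ⟨q ^ (24 * 4096 ^ s), by positivity, pow_le_one₀ hq0.le (by linarith), ?_, ?_⟩
  · have he : Real.exp (48 * -Real.log q * 4096 ^ s) = (q ^ (24 * 4096 ^ s))⁻¹ ^ 2 := by
      have h1 : 48 * -Real.log q * 4096 ^ s = -((24 * 4096 ^ s * 2 : ℕ) * Real.log q) := by
        push_cast; ring
      rw [h1, Real.exp_neg, Real.exp_nat_mul, Real.exp_log hq0, pow_mul, inv_pow]
    rw [he, pow_add] at hs2
    linarith
  · intro Ω _ P _ h hw γ hγ ℓ r m i
    refine prob_cell_ge hw (by omega) hγ (fun t ht => ht.2.2) hz hz2 hs1 hq0.le (by linarith)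
      (fun L => ?_) m i
    linarith [hzs L]

/-- For any fixed `α > 0` there exists a constant `C > 0` depending only on
`α` such that for every integer `d ≥ C`, for every probability space carrying a
white-noise Gaussian process `(h_n(x))`, almost surely the thick point set
`𝒯^W_α = {x : liminf_n h_n(x)/n ≥ α √(log 2)}` contains an unbounded path. -/
theorem white_noise_thick_points_unbounded_path :
    ∀ α : ℝ, 0 < α → ∃ C : ℝ, 0 < C ∧
      ∀ d : ℕ, 2 ≤ d → C ≤ (d : ℝ) →
      ∀ (Ω : Type) (_ : MeasurableSpace Ω) (P : Measure Ω), IsProbabilityMeasure P →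
      ∀ h : ℕ → EuclideanSpace ℝ (Fin d) → Ω → ℝ, IsWhiteNoiseField d P h →
        ∀ᵐ ω ∂P, ∃ φ : ℝ → EuclideanSpace ℝ (Fin d),
          ContinuousOn φ (Set.Ici 0) ∧
          (φ '' Set.Ici 0 ⊆ {x : EuclideanSpace ℝ (Fin d) |
            α * Real.sqrt (Real.log 2) ≤
              Filter.liminf (fun n : ℕ => h n x ω / n) Filter.atTop}) ∧
          ¬ Bornology.IsBounded (φ '' Set.Ici 0) := by
  intro α _
  obtain ⟨D, hD⟩ := exists_cell_bound (α * √(Real.log 2))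
  refine ⟨max (D + 4) 4, by positivity, fun d _ hd Ω _ P _ h hw => ?_⟩
  have hd4 : 4 ≤ d := by exact_mod_cast (le_max_right _ _).trans hd
  obtain ⟨n, rfl⟩ : ∃ n, d = n + 4 := ⟨d - 4, by omega⟩
  have hn : D ≤ n := by
    have := (le_max_left _ _).trans hd
    push_cast at this
    linarith
  obtain ⟨p, hp, hp1, hpn, hcell⟩ := hD n hn
  obtain ⟨S, hS, hS', hS2⟩ := exists_separated_finset n
  obtain ⟨L, hL⟩ := exists_splitting n
  have hS0 : S.Nonempty := Finset.card_pos.1 (lt_of_lt_of_le (by positivity) hS2)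
  have hSp : 16 * 4097 * 3201 * p⁻¹ ^ 2 ≤ (S.card : ℝ) := hpn.trans (by exact_mod_cast hS2)
  have hgood := one_sub_le_prob_goodEvent hw hL hS hS' hS0 hp hp1 hSp
    (hcell Ω _ P inferInstance h hw)
  choose M hM using ae_eventually_le hw (by omega)
  have hfreq : ∀ᵐ ω ∂P, ∃ ℓ : ℕ, ∃ᶠ r in Filter.atTop,
      ω ∈ goodEvent h (α * √(Real.log 2)) L S ℓ r := by
    rw [ae_iff]
    have hlim : Filter.Tendsto (fun ℓ : ℕ => ENNReal.ofReal (Real.exp (2 ^ (-(ℓ : ℤ))) - 1))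
        Filter.atTop (nhds 0) := by
      have h1 : Filter.Tendsto (fun ℓ : ℕ => (2 : ℝ) ^ (-(ℓ : ℤ))) Filter.atTop (nhds 0) := by
        simpa using tendsto_pow_atTop_nhds_zero_of_lt_one (r := (2⁻¹ : ℝ)) (by norm_num)
          (by norm_num)
      have h2 := ENNReal.tendsto_ofReal
        (((Real.continuous_exp.tendsto 0).comp h1).sub_const 1)
      simpa using h2
    refine le_antisymm (ge_of_tendsto' hlim fun ℓ => ?_) zero_le
    refine (measure_mono fun ω hω => ?_).trans (prob_eventually_notMem_le
      (fun r => measurableSet_goodEvent hw (α * √(Real.log 2)) S ℓ r) (hgood ℓ))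
    exact Filter.not_frequently.1 (not_exists.1 hω ℓ)
  filter_upwards [hfreq, ae_all_iff.2 hM] with ω ⟨ℓ, hℓ⟩ hω
  exact exists_unbounded_path_of_frequently (hw.2.2 ω) (fun R => ⟨M R, hω R⟩) hL hS hℓ
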